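/- Let k ≥ 3 and let g ∈ S_{2^k} be a 2^k-cycle. For any 2-element x ∈ S_{2^k} there exists a bijection Γ : Irr^x(S_{2^k}) → Irr^x(Sub_{S_{2^k}}(x)) satisfying: (I) Γ(χ)(1)_2 = χ(1)_2 for every χ ∈ Irr^x(S_{2^k}); (II) Γ(χ)(x) = ±χ(x) for every χ ∈ Irr^x(S_{2^k}); (III) for each χ ∈ Irr_{2'}(S_{2^k}) there exists ε ∈ {1, −1} (depending on χ) such that Γ(χ)(x) = ε·χ(x) and Γ(χ)(g) = ε·χ(g). -/

import Mathlib

open CategoryTheory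

noncomputable section

/-- The set of irreducible complex characters of a group `G`. -/
def Irr (G : Type) [Group G] : Set (G → ℂ) :=
  {χ | ∃ V : FDRep ℂ G, Simple V ∧ V.character = χ}

/-- The irreducible characters of `G` that do not vanish at `g`. -/
def IrrX (G : Type) [Group G] (g : G) : Set (G → ℂ) :=
  {χ | χ ∈ Irr G ∧ χ g ≠ 0}

/-- The irreducible characters of `G` of degree not divisible by `p`. -/
def IrrP' (p : ℕ) (G : Type) [Group G] : Set (G → ℂ) :=
  {χ | ∃ V : FDRep ℂ G, Simple V ∧ V.character = χ ∧ ¬ (p ∣ Module.finrank ℂ V)}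

/-- The degree of a character, recovered from its value at `1`. -/
def charDeg {G : Type} [Group G] (χ : G → ℂ) : ℕ := ⌊(χ 1).re⌋₊

/-- The `p`-part of a natural number. -/
def pPart (p m : ℕ) : ℕ := p ^ (m.factorization p)

/-- `x` is a picky `p`-element: a `p`-element lying in a unique Sylow `p`-subgroup. -/
def IsPicky (p : ℕ) {G : Type*} [Group G] (x : G) : Prop :=
  (∃ k, orderOf x = p ^ k) ∧ ∃! Q : Sylow p G, x ∈ Q

/-- `H` is a normal subgroup of `K` (both subgroups of an ambient group `G`). -/
def NormalIn {G : Type*} [Group G] (H K : Subgroup G) : Prop :=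
  H ≤ K ∧ ∀ k ∈ K, ∀ h ∈ H, k * h * k⁻¹ ∈ H

/-- `H` is subnormal in `K`: there is a finite chain of subgroups from `H` to `K`,
each normal in the next. -/
def IsSubnormalIn {G : Type*} [Group G] (H K : Subgroup G) : Prop :=
  Relation.ReflTransGen NormalIn H K

/-- The subnormalizer of `x` in `G`: the subgroup generated by all `g` such that
`⟨x⟩` is subnormal in `⟨x, g⟩`. -/
def subnormalizer {G : Type*} [Group G] (x : G) : Subgroup G :=
  Subgroup.closure {g | IsSubnormalIn (Subgroup.zpowers x) (Subgroup.closure {x, g})}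

lemma mem_subnormalizer_self {G : Type*} [Group G] (x : G) : x ∈ subnormalizer x :=
  Subgroup.subset_closure (by
    show IsSubnormalIn (Subgroup.zpowers x) (Subgroup.closure {x, x})
    rw [Set.pair_eq_singleton, ← Subgroup.zpowers_eq_closure]
    exact Relation.ReflTransGen.refl)

/-- The full cycle type of a permutation of `Fin n`: the multiset of the lengths of
all its cycles, with fixed points counted as cycles of length `1`. -/
def fullCycleType {n : ℕ} (x : Equiv.Perm (Fin n)) : Multiset ℕ :=
  x.cycleType + Multiset.replicate (n - x.support.card) 1

/-- The multiset of cycle lengths of a `p`-adic element of `S_n`: `a_i` cycles of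
length `p ^ i`, where `n = Σ a_i p ^ i` is the `p`-adic expansion of `n`. -/
def padicCycleMultiset (p n : ℕ) : Multiset ℕ :=
  ∑ i ∈ Finset.range (Nat.digits p n).length,
    Multiset.replicate ((Nat.digits p n).getD i 0) (p ^ i)

/-- A `p`-adic element of `S_n`. -/
def IsPAdic (p : ℕ) {n : ℕ} (x : Equiv.Perm (Fin n)) : Prop :=
  fullCycleType x = padicCycleMultiset p n

/-- A picky element of Type II: a `2`-adic element on `n - 2` points together with
two fixed points. -/
def IsTypeII {n : ℕ} (x : Equiv.Perm (Fin n)) : Prop :=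
  fullCycleType x = padicCycleMultiset 2 (n - 2) + Multiset.replicate 2 1

/-- A picky element of Type III: a `3`-adic element on `n - 3` points together with
three fixed points. -/
def IsTypeIII {n : ℕ} (x : Equiv.Perm (Fin n)) : Prop :=
  fullCycleType x = padicCycleMultiset 3 (n - 3) + Multiset.replicate 3 1

section CharacterTheory

variable {G : Type} [Group G]

/-- Characters of finite-dimensional complex representations. -/
def IsCh (χ : G → ℂ) : Prop := ∃ V : FDRep ℂ G, V.character = χ

lemma Irr.isCh {χ : G → ℂ} (h : χ ∈ Irr G) : IsCh χ := by
  obtain ⟨V, -, hV⟩ := h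
  exact ⟨V, hV⟩

lemma isCh_rep {V : Type} [AddCommGroup V] [Module ℂ V] [FiniteDimensional ℂ V]
    (ρ : Representation ℂ G V) : IsCh ρ.character :=
  ⟨FDRep.of ρ, rfl⟩

lemma isCh_matrix {n : Type} [Fintype n] [DecidableEq n] (ρ : G →* Matrix n n ℂ) :
    IsCh fun g => (ρ g).trace := by
  convert isCh_rep ((Matrix.toLinAlgEquiv' : Matrix n n ℂ ≃ₐ[ℂ] _).toRingEquiv.toMonoidHom.comp ρ :
    Representation ℂ G (n → ℂ)) using 1
  ext g
  simp only [Representation.character]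
  exact (Matrix.trace_toLin'_eq _).symm

lemma IsCh.exists_matrix {χ : G → ℂ} (h : IsCh χ) :
    ∃ (d : ℕ) (ρ : G →* Matrix (Fin d) (Fin d) ℂ), χ = fun g => (ρ g).trace := by
  obtain ⟨V, rfl⟩ := h
  let b := Module.finBasis ℂ V
  refine ⟨_, (LinearMap.toMatrixAlgEquiv b).toRingEquiv.toMonoidHom.comp V.ρ, ?_⟩
  ext g
  exact LinearMap.trace_eq_matrix_trace ℂ b _

lemma IsCh.comp {H : Type} [Group H] {χ : G → ℂ} (h : IsCh χ) (f : H →* G) :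
    IsCh fun g => χ (f g) := by
  obtain ⟨d, ρ, rfl⟩ := h.exists_matrix
  exact isCh_matrix (ρ.comp f)

lemma IsCh.conj {χ : G → ℂ} (h : IsCh χ) (g k : G) : χ (k * g * k⁻¹) = χ g := by
  obtain ⟨V, rfl⟩ := h
  exact V.char_conj g k

lemma IsCh.isConj {χ : G → ℂ} (h : IsCh χ) {g k : G} (hgk : IsConj g k) : χ g = χ k := by
  obtain ⟨c, rfl⟩ := isConj_iff.1 hgk
  exact (h.conj g c).symm

lemma IsCh.one {χ : G → ℂ} (h : IsCh χ) : χ 1 = charDeg χ := by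
  obtain ⟨V, rfl⟩ := h
  simp [charDeg, V.char_one]

lemma irrP'_charDeg {p : ℕ} {χ : G → ℂ} (h : χ ∈ IrrP' p G) : ¬ p ∣ charDeg χ := by
  obtain ⟨V, -, rfl, hV⟩ := h
  simpa [charDeg, V.char_one] using hV

variable [Fintype G]

/-- The unnormalised inner product of class functions. -/
def cip (χ ψ : G → ℂ) : ℂ := ∑ g, χ g * ψ g⁻¹

lemma cip_comm (χ ψ : G → ℂ) : cip χ ψ = cip ψ χ := by
  unfold cip
  rw [← Equiv.sum_comp (Equiv.inv G)]
  simp [mul_comm]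

lemma irr_iff {χ : G → ℂ} : χ ∈ Irr G ↔ IsCh χ ∧ cip χ χ = Fintype.card G := by
  constructor
  · rintro ⟨V, hV, rfl⟩
    refine ⟨⟨V, rfl⟩, ?_⟩
    have := (FDRep.simple_iff_char_is_norm_one V).1 hV
    rw [cip, this, Nat.card_eq_fintype_card]
  · rintro ⟨⟨V, rfl⟩, h⟩
    refine ⟨V, (FDRep.simple_iff_char_is_norm_one V).2 ?_, rfl⟩
    rw [Nat.card_eq_fintype_card]
    exact h

instance invertible_natCard : Invertible (Nat.card G : ℂ) :=
  invertibleOfNonzero (by exact_mod_cast Nat.card_pos.ne')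

lemma cip_irr_ne {χ ψ : G → ℂ} (hχ : χ ∈ Irr G) (hψ : ψ ∈ Irr G) (h : χ ≠ ψ) :
    cip χ ψ = 0 := by
  obtain ⟨V, hV, rfl⟩ := hχ
  obtain ⟨W, hW, rfl⟩ := hψ
  have := FDRep.char_orthonormal V W
  rw [if_neg (fun ⟨i⟩ => h (FDRep.char_iso i))] at this
  simpa [cip] using this

open scoped Classical in
lemma cip_irr {χ ψ : G → ℂ} (hχ : χ ∈ Irr G) (hψ : ψ ∈ Irr G) :
    cip χ ψ = if χ = ψ then (Fintype.card G : ℂ) else 0 := by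
  split_ifs with h
  · subst h; exact (irr_iff.1 hχ).2
  · exact cip_irr_ne hχ hψ h

lemma cip_isCh {χ ψ : G → ℂ} (hχ : IsCh χ) (hψ : IsCh ψ) :
    ∃ n : ℕ, cip χ ψ = n * Fintype.card G := by
  obtain ⟨V, rfl⟩ := hχ
  obtain ⟨W, rfl⟩ := hψ
  refine ⟨Module.finrank ℂ (W ⟶ V), ?_⟩
  rw [← FDRep.scalar_product_char_eq_finrank_equivariant, Nat.card_eq_fintype_card, cip]
  have : (Fintype.card G : ℂ) ≠ 0 := by exact_mod_cast Fintype.card_ne_zero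
  field_simp

lemma irr_of_irreducible {V : Type} [AddCommGroup V] [Module ℂ V] [FiniteDimensional ℂ V]
    (ρ : Representation ℂ G V) [ρ.IsIrreducible] : ρ.character ∈ Irr G := by
  refine irr_iff.2 ⟨isCh_rep ρ, ?_⟩
  have := Representation.char_orthonormal ρ ρ
  rw [if_pos ⟨Representation.Equiv.refl ρ⟩] at this
  have h0 : (Nat.card G : ℂ) ≠ 0 := by exact_mod_cast Nat.card_pos.ne'
  rw [inv_mul_eq_iff_eq_mul₀ h0, mul_one, Nat.card_eq_fintype_card] at this
  exact this

lemma sum_smul_irreducible_eq_zero {V : Type} [AddCommGroup V] [Module ℂ V]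
    [FiniteDimensional ℂ V] (ρ : Representation ℂ G V) [ρ.IsIrreducible] (f : G → ℂ)
    (hf : ∀ g k, f (k * g * k⁻¹) = f g) (h0 : ∑ g, f g * ρ.character g = 0) :
    ∑ g, f g • ρ g = 0 := by
  let T : Representation.IntertwiningMap ρ ρ :=
    { toLinearMap := ∑ g, f g • ρ g
      isIntertwining' := by
        intro k
        ext v
        simp only [LinearMap.comp_apply, LinearMap.sum_apply, LinearMap.smul_apply, map_sum,
          map_smul]
        refine Fintype.sum_equiv (MulAut.conj k⁻¹).toEquiv _ _ fun g => ?_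
        have : (MulAut.conj k⁻¹).toEquiv g = k⁻¹ * g * k := by simp
        rw [this, ← Module.End.mul_apply, ← Module.End.mul_apply, ← map_mul, ← map_mul]
        have h2 := hf g k⁻¹
        rw [inv_inv] at h2
        rw [h2]
        group }
  obtain ⟨c, hc⟩ :=
    (Representation.IsIrreducible.algebraMap_intertwiningMap_bijective_of_isAlgClosed
      (ρ := ρ)).2 T
  have hT : ∑ g, f g • ρ g = c • (1 : V →ₗ[ℂ] V) := by
    have : T.toLinearMap = ∑ g, f g • ρ g := rfl
    rw [← this, ← hc]
    ext v
    rfl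
  have htr : c * Module.finrank ℂ V = 0 := by
    have := congrArg (LinearMap.trace ℂ V) hT
    simp only [map_sum, map_smul, LinearMap.trace_one, smul_eq_mul] at this
    rw [← this]
    exact h0
  rcases mul_eq_zero.1 htr with h | h
  · rw [hT, h, zero_smul]
  · have h' : Module.finrank ℂ V = 0 := by exact_mod_cast h
    have := Module.finrank_zero_iff.1 h'
    exact Subsingleton.elim _ _

lemma smul_eq_zero_of_isSimpleModule {M : Type} [AddCommGroup M] [Module ℂ M]
    [Module (MonoidAlgebra ℂ G) M] [IsScalarTower ℂ (MonoidAlgebra ℂ G) M]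
    [IsSimpleModule (MonoidAlgebra ℂ G) M] (f : G → ℂ) (hf : ∀ g k, f (k * g * k⁻¹) = f g)
    (h : ∀ χ ∈ Irr G, ∑ g, f g * χ g = 0) (v : M) :
    (∑ g, MonoidAlgebra.single g (f g) : MonoidAlgebra ℂ G) • v = 0 := by
  let ρ : Representation ℂ G M := Representation.ofModule' M
  have hρ (r : MonoidAlgebra ℂ G) (v : M) : ρ.asAlgebraHom r v = r • v := by
    have : ρ.asAlgebraHom = Algebra.lsmul ℂ ℂ M :=
      (MonoidAlgebra.lift ℂ (M →ₗ[ℂ] M) G).apply_symm_apply _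
    rw [this, Algebra.lsmul_coe]
  let e : ρ.asModule ≃ₗ[MonoidAlgebra ℂ G] M :=
    { ρ.asModuleEquiv.toAddEquiv with
      map_smul' := fun r v => (ρ.asModuleEquiv_map_smul r v).trans (hρ r _) }
  have hi : ρ.IsIrreducible :=
    (Representation.irreducible_iff_isSimpleModule_asModule ρ).2 (IsSimpleModule.congr e)
  have : FiniteDimensional ℂ M := Module.Finite.trans (MonoidAlgebra ℂ G) _
  rw [← hρ]
  simp only [map_sum, Representation.asAlgebraHom_single]
  rw [sum_smul_irreducible_eq_zero ρ f hf (h _ (irr_of_irreducible _)), LinearMap.zero_apply]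

lemma classFun_eq_zero (f : G → ℂ) (hf : ∀ g k, f (k * g * k⁻¹) = f g)
    (h : ∀ χ ∈ Irr G, ∑ g, f g * χ g = 0) : f = 0 := by
  let z : MonoidAlgebra ℂ G := ∑ g, MonoidAlgebra.single g (f g)
  have hz : z = 0 := by
    have h1 : z ∈ Ring.jacobson (MonoidAlgebra ℂ G) := by
      rw [Ring.jacobson, Module.jacobson, Submodule.mem_sInf]
      intro m hm
      have hs : IsSimpleModule (MonoidAlgebra ℂ G) (MonoidAlgebra ℂ G ⧸ m) :=
        isSimpleModule_iff_isCoatom.2 hm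
      have h4 := smul_eq_zero_of_isSimpleModule f hf h (Submodule.Quotient.mk (p := m) 1)
      rw [← Submodule.Quotient.mk_smul] at h4
      simpa using h4
    rw [IsSemisimpleRing.jacobson_eq_bot] at h1
    exact h1
  ext g
  classical
  have := congrArg (fun a : MonoidAlgebra ℂ G => a.coeff g) hz
  simpa [z, MonoidAlgebra.coeff_sum, Finsupp.single_apply] using this

lemma irr_linearIndependent : LinearIndependent ℂ (fun χ : Irr G => χ.1) := by
  rw [linearIndependent_iff']
  intro s a ha χ hχ
  have h1 : cip (∑ ψ ∈ s, a ψ • ψ.1) χ.1 = 0 := by rw [ha]; simp [cip]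
  have h2 : cip (∑ ψ ∈ s, a ψ • ψ.1) χ.1 = ∑ ψ ∈ s, a ψ * cip ψ.1 χ.1 := by
    simp only [cip, Finset.sum_apply, Pi.smul_apply, smul_eq_mul, Finset.sum_mul, Finset.mul_sum]
    rw [Finset.sum_comm]
    simp only [mul_assoc]
  rw [h2, Finset.sum_eq_single χ, (irr_iff.1 χ.2).2] at h1
  · have h0 : (Fintype.card G : ℂ) ≠ 0 := by exact_mod_cast Fintype.card_ne_zero
    exact (mul_eq_zero.1 h1).resolve_right h0
  · intro ψ _ hψ
    rw [cip_irr_ne ψ.2 χ.2 (fun h => hψ (Subtype.ext h)), mul_zero]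
  · exact fun h => absurd hχ h

instance : Finite (Irr G) := irr_linearIndependent.finite

instance : Fintype (Irr G) := Fintype.ofFinite _

lemma classFun_expand (f : G → ℂ) (hf : ∀ g k, f (k * g * k⁻¹) = f g) (g : G) :
    Fintype.card G * f g = ∑ χ : Irr G, cip f χ.1 * χ.1 g := by
  have key : (fun g => Fintype.card G * f g - ∑ χ : Irr G, cip f χ.1 * χ.1 g) = 0 := by
    refine classFun_eq_zero _ (fun g k => ?_) (fun χ hχ => ?_)
    · rw [hf]
      congr 1
      exact Finset.sum_congr rfl fun χ _ => by rw [(Irr.isCh χ.2).conj]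
    · have hχ' : (fun g => χ g⁻¹) ∈ Irr G := by
        obtain ⟨V, hV, rfl⟩ := id hχ
        refine irr_iff.2 ⟨⟨FDRep.of (Representation.dual V.ρ), ?_⟩, ?_⟩
        · ext g; exact V.char_dual g
        · rw [← (irr_iff.1 hχ).2, cip_comm, cip, cip, ← Equiv.sum_comp (Equiv.inv G)]
          simp
      have e : ∀ h : G → ℂ, ∑ g, h g * χ g = cip h (fun g => χ g⁻¹) := by
        intro h; simp [cip]
      have e2 : cip (fun g => Fintype.card G * f g - ∑ χ : Irr G, cip f χ.1 * χ.1 g)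
          (fun g => χ g⁻¹) = Fintype.card G * cip f (fun g => χ g⁻¹) -
          ∑ ψ : Irr G, cip f ψ.1 * cip ψ.1 (fun g => χ g⁻¹) := by
        simp only [cip, sub_mul, Finset.sum_sub_distrib, Finset.mul_sum, Finset.sum_mul, mul_assoc]
        congr 1
        rw [Finset.sum_comm]
      rw [e, e2, Finset.sum_eq_single ⟨_, hχ'⟩, (irr_iff.1 hχ').2]
      · ring
      · intro ψ _ hψ
        rw [cip_irr_ne ψ.2 hχ' (fun h => hψ (Subtype.ext h)), mul_zero]
      · simp
  exact sub_eq_zero.1 (congrFun key g)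

open scoped Classical in
lemma sum_irr_mul_inv (g h : G) :
    ∑ χ : Irr G, χ.1 g * χ.1 h⁻¹ = (Finset.univ.filter fun a : G => a * h * a⁻¹ = g).card := by
  let f : G → ℂ := fun k => (Finset.univ.filter fun a : G => a * h * a⁻¹ = k).card
  have hf : ∀ k c, f (c * k * c⁻¹) = f k := by
    intro k c
    simp only [f]
    congr 1
    refine Finset.card_bij' (fun a _ => c⁻¹ * a) (fun a _ => c * a) ?_ ?_ ?_ ?_
    · intro a ha
      simp only [Finset.mem_filter, Finset.mem_univ, true_and] at ha ⊢
      have : c⁻¹ * a * h * (c⁻¹ * a)⁻¹ = c⁻¹ * (a * h * a⁻¹) * c := by group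
      rw [this, ha]; group
    · intro a ha
      simp only [Finset.mem_filter, Finset.mem_univ, true_and] at ha ⊢
      rw [← ha]; group
    · intro a _; group
    · intro a _; group
  have hc : ∀ χ : Irr G, cip f χ.1 = Fintype.card G * χ.1 h⁻¹ := by
    intro χ
    have : ∀ k, f k * χ.1 k⁻¹ = ∑ a : G, if a * h * a⁻¹ = k then χ.1 h⁻¹ else 0 := by
      intro k
      rw [← Finset.sum_filter]
      simp only [Finset.sum_const, f, nsmul_eq_mul]
      by_cases hk : ∃ a, a * h * a⁻¹ = k
      · obtain ⟨a, rfl⟩ := hk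
        congr 1
        have : (a * h * a⁻¹)⁻¹ = a * h⁻¹ * a⁻¹ := by group
        rw [this, (Irr.isCh χ.2).conj]
      · push Not at hk
        simp [hk]
    simp only [cip, this]
    rw [Finset.sum_comm]
    simp
  have := classFun_expand f hf g
  simp only [hc, mul_assoc, ← Finset.mul_sum] at this
  have h0 : (Fintype.card G : ℂ) ≠ 0 := by exact_mod_cast Fintype.card_ne_zero
  rw [mul_right_inj' h0] at this
  simp only [f] at this
  rw [this]
  exact Finset.sum_congr rfl fun _ _ => mul_comm _ _

open scoped ComplexOrder Matrix in
lemma IsCh.inv {χ : G → ℂ} (h : IsCh χ) (g : G) : χ g⁻¹ = (starRingEnd ℂ) (χ g) := by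
  classical
  obtain ⟨d, ρ, rfl⟩ := h.exists_matrix
  let P : Matrix (Fin d) (Fin d) ℂ := ∑ k, (ρ k)ᴴ * ρ k
  have hP : P.PosDef := by
    have : P = (ρ 1)ᴴ * ρ 1 + ∑ k ∈ Finset.univ.erase 1, (ρ k)ᴴ * ρ k :=
      (Finset.add_sum_erase _ _ (Finset.mem_univ _)).symm
    rw [this, map_one, Matrix.conjTranspose_one, mul_one]
    refine Matrix.PosDef.one.add_posSemidef ?_
    exact Matrix.posSemidef_sum _ fun k _ => Matrix.posSemidef_conjTranspose_mul_self _
  have hu : IsUnit P.det := (Matrix.isUnit_iff_isUnit_det _).1 hP.isUnit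
  have h1 : (ρ g)ᴴ * P * ρ g = P := by
    simp only [P, Finset.mul_sum, Finset.sum_mul]
    refine Fintype.sum_equiv (Equiv.mulRight g) _ _ fun k => ?_
    simp only [Equiv.coe_mulRight, map_mul, Matrix.conjTranspose_mul, mul_assoc]
  have h2 : (ρ g)ᴴ * P = P * ρ g⁻¹ := by
    rw [← h1, mul_assoc _ (ρ g), ← map_mul, mul_inv_cancel, map_one, mul_one, h1]
  have h3 : ρ g⁻¹ = P⁻¹ * (ρ g)ᴴ * P := by
    rw [mul_assoc, h2, ← mul_assoc, Matrix.nonsing_inv_mul _ hu, one_mul]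
  simp only
  rw [h3, Matrix.trace_mul_comm, ← mul_assoc, Matrix.mul_nonsing_inv _ hu, one_mul,
    Matrix.trace_conjTranspose]
  rfl

open scoped Classical in
lemma sum_normSq_irr (g : G) :
    ∑ χ : Irr G, Complex.normSq (χ.1 g) = (Finset.univ.filter fun a : G => a * g = g * a).card := by
  have := sum_irr_mul_inv g g
  have e : (Finset.univ.filter fun a : G => a * g * a⁻¹ = g) =
      Finset.univ.filter fun a : G => a * g = g * a := by
    ext a; simp [mul_inv_eq_iff_eq_mul]
  rw [e] at this
  have h2 : ∀ χ : Irr G, χ.1 g * χ.1 g⁻¹ = (Complex.normSq (χ.1 g) : ℂ) := fun χ => by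
    rw [(Irr.isCh χ.2).inv, Complex.mul_conj]
  simp only [h2] at this
  exact_mod_cast this

omit [Fintype G] in
/-- Irreducible characters transport along group isomorphisms. -/
lemma irr_comp_mulEquiv {H : Type} [Group H] [Finite H] (e : G ≃* H) {χ : H → ℂ} (h : χ ∈ Irr H) :
    (fun g => χ (e g)) ∈ Irr G := by
  have : Fintype H := Fintype.ofFinite H
  have : Fintype G := Fintype.ofEquiv H e.symm.toEquiv
  refine irr_iff.2 ⟨(Irr.isCh h).comp e.toMonoidHom, ?_⟩
  rw [Fintype.card_congr e.toEquiv, ← (irr_iff.1 h).2, cip, cip, ← Equiv.sum_comp e.toEquiv]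
  simp

end CharacterTheory

section WreathProduct

/-- The wreath product of `H` with a group of order two: elements of `H × H`, followed by the
swap of the two factors when `s` is true. -/
@[ext]
structure Wr (H : Type) where
  a : H
  b : H
  s : Bool

variable {H : Type} [Group H]

namespace Wr

instance : Mul (Wr H) :=
  ⟨fun p q => ⟨p.a * cond p.s q.b q.a, p.b * cond p.s q.a q.b, xor p.s q.s⟩⟩

instance : One (Wr H) := ⟨⟨1, 1, false⟩⟩

instance : Inv (Wr H) := ⟨fun p => ⟨cond p.s p.b⁻¹ p.a⁻¹, cond p.s p.a⁻¹ p.b⁻¹, p.s⟩⟩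

lemma mul_def (p q : Wr H) :
    p * q = ⟨p.a * cond p.s q.b q.a, p.b * cond p.s q.a q.b, xor p.s q.s⟩ := rfl

lemma one_def : (1 : Wr H) = ⟨1, 1, false⟩ := rfl

lemma inv_def (p : Wr H) : p⁻¹ = ⟨cond p.s p.b⁻¹ p.a⁻¹, cond p.s p.a⁻¹ p.b⁻¹, p.s⟩ := rfl

instance : Group (Wr H) :=
  Group.ofLeftAxioms
    (by
      rintro ⟨a, b, _ | _⟩ ⟨a', b', _ | _⟩ ⟨a'', b'', _ | _⟩ <;> simp [mul_def, mul_assoc])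
    (by rintro ⟨a, b, _ | _⟩ <;> simp [mul_def, one_def])
    (by rintro ⟨a, b, _ | _⟩ <;> simp [mul_def, one_def, inv_def])

/-- The underlying triple. -/
def equivProd : Wr H ≃ Bool × H × H where
  toFun p := (p.s, p.a, p.b)
  invFun p := ⟨p.2.1, p.2.2, p.1⟩
  left_inv _ := rfl
  right_inv _ := rfl

instance [Fintype H] : Fintype (Wr H) := Fintype.ofEquiv _ equivProd.symm

omit [Group H] in
lemma card_eq [Fintype H] : Fintype.card (Wr H) = 2 * Fintype.card H ^ 2 := by
  rw [Fintype.card_congr equivProd]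
  simp [sq]

omit [Group H] in
lemma sum_eq [Fintype H] (f : Wr H → ℂ) :
    ∑ p, f p = ∑ a, ∑ b, f ⟨a, b, false⟩ + ∑ a, ∑ b, f ⟨a, b, true⟩ := by
  rw [← Equiv.sum_comp equivProd.symm, Fintype.sum_prod_type, Fintype.sum_bool, add_comm,
    Fintype.sum_prod_type, Fintype.sum_prod_type]
  rfl

/-- The extension of `ψ ⊗ ψ` with sign `ε`. -/
def chExt (ε : ℂ) (ψ : H → ℂ) : Wr H → ℂ :=
  fun p => cond p.s (ε * ψ (p.a * p.b)) (ψ p.a * ψ p.b)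

/-- The character induced from `ψ ⊗ φ`. -/
def chInd (ψ φ : H → ℂ) : Wr H → ℂ :=
  fun p => cond p.s 0 (ψ p.a * φ p.b + ψ p.b * φ p.a)

omit [Group H] in
lemma ind_comm (ψ φ : H → ℂ) : chInd ψ φ = chInd φ ψ := by
  funext p; unfold chInd; congr 1; ring

section Matrices

open scoped Kronecker

variable {n m : Type} [Fintype n] [DecidableEq n] [Fintype m] [DecidableEq m]

/-- A matrix representation affording `chExt ε ψ`. -/
def extRep (ε : ℂ) (hε : ε * ε = 1) (ρ : H →* Matrix n n ℂ) :
    Wr H →* Matrix (n × n) (n × n) ℂ where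
  toFun p := cond p.s (ε • (ρ p.a ⊗ₖ ρ p.b).submatrix id Prod.swap) (ρ p.a ⊗ₖ ρ p.b)
  map_one' := by simp [one_def]
  map_mul' := by
    have swp : ∀ A B : Matrix n n ℂ, (A ⊗ₖ B).submatrix Prod.swap Prod.swap = B ⊗ₖ A := by
      intro A B; ext ⟨i, j⟩ ⟨k, l⟩; simp [mul_comm]
    have key : ∀ X Y : Matrix (n × n) (n × n) ℂ,
        X.submatrix id Prod.swap * Y = (X * Y.submatrix Prod.swap id) := by
      intro X Y
      ext i j
      simp only [Matrix.mul_apply, Matrix.submatrix_apply, id]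
      exact Fintype.sum_equiv (Equiv.prodComm n n) _ _ fun k => by simp
    rintro ⟨a, b, _ | _⟩ ⟨a', b', _ | _⟩
    · simp [mul_def, Matrix.mul_kronecker_mul]
    · simp only [mul_def, cond_false, cond_true, Bool.false_xor, map_mul,
        Matrix.mul_kronecker_mul, Matrix.mul_smul]
      congr 1
    · simp only [mul_def, cond_false, cond_true, Bool.xor_false, map_mul,
        Matrix.mul_kronecker_mul, Matrix.smul_mul]
      congr 1
      rw [key, ← swp (ρ b') (ρ a')]
      ext i j
      simp only [Matrix.mul_apply, Matrix.submatrix_apply, id]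
      exact Finset.sum_congr rfl fun k _ => by rw [Prod.swap_swap]
    · simp only [mul_def, cond_false, cond_true, Bool.xor_true, Bool.not_true, map_mul,
        Matrix.mul_kronecker_mul, Matrix.smul_mul, Matrix.mul_smul, smul_smul, hε, one_smul]
      rw [key, ← swp (ρ a') (ρ b'), Matrix.submatrix_submatrix]
      rfl

lemma trace_extRep (ε : ℂ) (hε : ε * ε = 1) (ρ : H →* Matrix n n ℂ) (p : Wr H) :
    (extRep ε hε ρ p).trace = chExt ε (fun g => (ρ g).trace) p := by
  obtain ⟨a, b, _ | _⟩ := p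
  · simp [extRep, chExt, Matrix.trace_kronecker]
  · simp only [extRep, MonoidHom.coe_mk, OneHom.coe_mk, cond_true, Matrix.trace_smul, smul_eq_mul,
      chExt, map_mul]
    congr 1
    simp [Matrix.trace, Matrix.mul_apply, Fintype.sum_prod_type]

/-- A matrix representation affording `chInd ψ φ`. -/
def indRep (ρ : H →* Matrix n n ℂ) (τ : H →* Matrix m m ℂ) :
    Wr H →* Matrix ((n × m) ⊕ (n × m)) ((n × m) ⊕ (n × m)) ℂ where
  toFun p := cond p.s (Matrix.fromBlocks 0 (ρ p.a ⊗ₖ τ p.b) (ρ p.b ⊗ₖ τ p.a) 0)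
    (Matrix.fromBlocks (ρ p.a ⊗ₖ τ p.b) 0 0 (ρ p.b ⊗ₖ τ p.a))
  map_one' := by simp [one_def]
  map_mul' := by
    rintro ⟨a, b, _ | _⟩ ⟨a', b', _ | _⟩ <;>
    simp [mul_def, Matrix.mul_kronecker_mul, Matrix.fromBlocks_multiply]

lemma trace_indRep (ρ : H →* Matrix n n ℂ) (τ : H →* Matrix m m ℂ) (p : Wr H) :
    (indRep ρ τ p).trace = chInd (fun g => (ρ g).trace) (fun g => (τ g).trace) p := by
  obtain ⟨a, b, _ | _⟩ := p <;>
  simp [indRep, chInd, Matrix.trace, Fintype.sum_sum_type,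
    Fintype.sum_prod_type, Finset.sum_mul_sum]

end Matrices

lemma isCh_ext {ε : ℂ} (hε : ε * ε = 1) {ψ : H → ℂ} (h : IsCh ψ) : IsCh (chExt ε ψ) := by
  obtain ⟨d, ρ, rfl⟩ := h.exists_matrix
  convert isCh_matrix (extRep ε hε ρ) using 1
  funext p
  rw [trace_extRep]

lemma isCh_ind {ψ φ : H → ℂ} (h : IsCh ψ) (h' : IsCh φ) : IsCh (chInd ψ φ) := by
  obtain ⟨d, ρ, rfl⟩ := h.exists_matrix
  obtain ⟨d', τ, rfl⟩ := h'.exists_matrix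
  convert isCh_matrix (indRep ρ τ) using 1
  funext p
  rw [trace_indRep]

variable [Fintype H]

lemma cip_ext {ε ε' : ℂ} (ψ ψ' : H → ℂ) :
    cip (chExt ε ψ) (chExt ε' ψ') = cip ψ ψ' ^ 2 + ε * ε' * (Fintype.card H * cip ψ ψ') := by
  rw [cip, sum_eq]
  congr 1
  · simp only [chExt, inv_def, cond_false, cip, sq, Finset.sum_mul_sum]
    exact Finset.sum_congr rfl fun a _ => Finset.sum_congr rfl fun b _ => by ring
  · simp only [chExt, inv_def, cond_true]
    have : ∀ a : H, ∑ b : H, ε * ψ (a * b) * (ε' * ψ' (b⁻¹ * a⁻¹)) = ε * ε' * cip ψ ψ' := by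
      intro a
      rw [cip, Finset.mul_sum]
      refine Fintype.sum_equiv (Equiv.mulLeft a) _ _ fun b => ?_
      simp only [Equiv.coe_mulLeft, mul_inv_rev]
      ring
    simp only [this, Finset.sum_const, Finset.card_univ, nsmul_eq_mul]
    ring

lemma cip_ind (ψ φ ψ' φ' : H → ℂ) :
    cip (chInd ψ φ) (chInd ψ' φ') = 2 * (cip ψ ψ' * cip φ φ' + cip ψ φ' * cip φ ψ') := by
  rw [cip, sum_eq]
  simp only [chInd, inv_def, cond_false, cond_true, zero_mul, Finset.sum_const_zero, add_zero]
  have e : ∀ a b : H, (ψ a * φ b + ψ b * φ a) * (ψ' a⁻¹ * φ' b⁻¹ + ψ' b⁻¹ * φ' a⁻¹) =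
      (ψ a * ψ' a⁻¹) * (φ b * φ' b⁻¹) + (ψ a * φ' a⁻¹) * (φ b * ψ' b⁻¹) +
      (φ a * ψ' a⁻¹) * (ψ b * φ' b⁻¹) + (φ a * φ' a⁻¹) * (ψ b * ψ' b⁻¹) := by
    intro a b; ring
  simp only [e, Finset.sum_add_distrib, ← Finset.sum_mul_sum]
  simp only [cip]
  ring

lemma irr_ext {ε : ℂ} (hε : ε * ε = 1) {ψ : H → ℂ} (h : ψ ∈ Irr H) : chExt ε ψ ∈ Irr (Wr H) := by
  refine irr_iff.2 ⟨isCh_ext hε (Irr.isCh h), ?_⟩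
  rw [cip_ext, hε, (irr_iff.1 h).2, card_eq]
  push_cast; ring

lemma irr_ind {ψ φ : H → ℂ} (h : ψ ∈ Irr H) (h' : φ ∈ Irr H) (hne : ψ ≠ φ) :
    chInd ψ φ ∈ Irr (Wr H) := by
  refine irr_iff.2 ⟨isCh_ind (Irr.isCh h) (Irr.isCh h'), ?_⟩
  rw [cip_ind, (irr_iff.1 h).2, (irr_iff.1 h').2, cip_irr_ne h h' hne, card_eq]
  push_cast; ring

end Wr

lemma irr_inv {G : Type} [Group G] [Fintype G] {χ : G → ℂ} (hχ : χ ∈ Irr G) :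
    (fun g => χ g⁻¹) ∈ Irr G := by
  obtain ⟨V, hV, rfl⟩ := id hχ
  refine irr_iff.2 ⟨⟨FDRep.of (Representation.dual V.ρ), ?_⟩, ?_⟩
  · ext g; exact V.char_dual g
  · rw [← (irr_iff.1 hχ).2, cip_comm, cip, cip, ← Equiv.sum_comp (Equiv.inv G)]
    simp

lemma irr_one_ne {G : Type} [Group G] [Fintype G] {χ : G → ℂ} (hχ : χ ∈ Irr G) : χ 1 ≠ 0 := by
  intro h0
  obtain ⟨V, hV, rfl⟩ := id hχ
  have h := (irr_iff.1 hχ).2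
  rw [V.char_one] at h0
  have h' : Module.finrank ℂ V = 0 := by exact_mod_cast h0
  have hs := Module.finrank_zero_iff.1 h'
  have : V.character = 0 := by
    funext g
    have : V.ρ g = 0 := Subsingleton.elim _ _
    simp [FDRep.character, this]
  rw [this] at h
  have h0 : (Fintype.card G : ℂ) ≠ 0 := by exact_mod_cast Fintype.card_ne_zero
  exact h0 (by rw [← h]; simp [cip])

lemma classFun_one_eq_zero {G : Type} [Group G] [Fintype G] (f : G → ℂ)
    (hf : ∀ g k, f (k * g * k⁻¹) = f g) (h : ∀ χ ∈ Irr G, ∑ g, f g * χ g⁻¹ = 0) : f 1 = 0 := by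
  have := classFun_eq_zero f hf fun χ hχ => by
    have := h _ (irr_inv hχ)
    simpa using this
  rw [this]; rfl

namespace Wr

variable [Fintype H]

lemma irr_cases {χ : Wr H → ℂ} (hχ : χ ∈ Irr (Wr H)) :
    (∃ ψ ∈ Irr H, χ = chExt 1 ψ ∨ χ = chExt (-1) ψ) ∨
      ∃ ψ ∈ Irr H, ∃ φ ∈ Irr H, ψ ≠ φ ∧ χ = chInd ψ φ := by
  by_contra hcon
  push Not at hcon
  obtain ⟨h1, h2⟩ := hcon
  have hc := (Irr.isCh hχ).conj
  have hsw : ∀ a b, χ ⟨b, a, false⟩ = χ ⟨a, b, false⟩ := by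
    intro a b
    have := hc ⟨a, b, false⟩ ⟨1, 1, true⟩
    simpa [mul_def, inv_def] using this
  have key : ∀ ψ ∈ Irr H, ∀ φ ∈ Irr H, ∑ b, (∑ a, χ ⟨a, b, false⟩ * ψ a⁻¹) * φ b⁻¹ = 0 := by
    intro ψ hψ φ hφ
    simp only [Finset.sum_mul]
    rw [Finset.sum_comm]
    by_cases hne : ψ = φ
    · subst hne
      have e1 := cip_irr_ne hχ (irr_ext (by norm_num) hψ) (h1 ψ hψ).1
      have e2 := cip_irr_ne hχ (irr_ext (by norm_num) hψ) (h1 ψ hψ).2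
      rw [cip, sum_eq] at e1 e2
      simp only [chExt, inv_def, cond_false, cond_true, one_mul, neg_mul, mul_neg,
        Finset.sum_neg_distrib] at e1 e2
      have e3 := congrArg₂ (· + ·) e1 e2
      simp only [add_zero] at e3
      have e4 : ∑ a, ∑ b, χ ⟨a, b, false⟩ * (ψ a⁻¹ * ψ b⁻¹) = 0 := by linear_combination e3 / 2
      simpa [mul_assoc] using e4
    · have e1 := cip_irr_ne hχ (irr_ind hψ hφ hne) (h2 ψ hψ φ hφ hne)
      rw [cip, sum_eq] at e1
      simp only [chInd, inv_def, cond_false, cond_true, mul_zero, Finset.sum_const_zero, add_zero,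
        mul_add, Finset.sum_add_distrib] at e1
      have e2 : ∑ a, ∑ b, χ ⟨a, b, false⟩ * (ψ b⁻¹ * φ a⁻¹) =
          ∑ a, ∑ b, χ ⟨a, b, false⟩ * (ψ a⁻¹ * φ b⁻¹) := by
        rw [Finset.sum_comm]
        exact Finset.sum_congr rfl fun a _ => Finset.sum_congr rfl fun b _ => by rw [hsw]
      rw [e2] at e1
      have e4 : ∑ a, ∑ b, χ ⟨a, b, false⟩ * (ψ a⁻¹ * φ b⁻¹) = 0 := by linear_combination e1 / 2
      simpa [mul_assoc] using e4
  have key2 : ∀ ψ ∈ Irr H, ∑ a, χ ⟨a, 1, false⟩ * ψ a⁻¹ = 0 := by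
    intro ψ hψ
    refine classFun_one_eq_zero (fun b => ∑ a, χ ⟨a, b, false⟩ * ψ a⁻¹) ?_ (key ψ hψ)
    intro b k
    refine Finset.sum_congr rfl fun a _ => ?_
    have := hc ⟨a, b, false⟩ ⟨1, k, false⟩
    simp only [mul_def, inv_def, cond_false, inv_one, mul_one, one_mul, Bool.xor_false] at this
    rw [this]
  have := classFun_one_eq_zero (fun a => χ ⟨a, 1, false⟩) (fun a k => by
    have := hc ⟨a, 1, false⟩ ⟨k, 1, false⟩
    simpa [mul_def, inv_def] using this) key2
  exact irr_one_ne hχ this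

lemma ext_ne_ind {ε : ℂ} (hε : ε * ε = 1) {ψ : H → ℂ} (h : ψ ∈ Irr H) (ψ' φ' : H → ℂ) :
    chExt ε ψ ≠ chInd ψ' φ' := by
  intro he
  have := congrFun he ⟨1, 1, true⟩
  simp only [chExt, chInd, cond_true, mul_one, mul_eq_zero] at this
  rcases this with h0 | h0
  · simp [h0] at hε
  · exact irr_one_ne h h0

lemma ext_inj {ε ε' : ℂ} (hε : ε = 1 ∨ ε = -1) (hε' : ε' = 1 ∨ ε' = -1) {ψ ψ' : H → ℂ}
    (h : ψ ∈ Irr H) (h' : ψ' ∈ Irr H) (he : chExt ε ψ = chExt ε' ψ') : ε = ε' ∧ ψ = ψ' := by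
  have h0 : (Fintype.card H : ℂ) ≠ 0 := by exact_mod_cast Fintype.card_ne_zero
  have hsq : ε * ε = 1 := by rcases hε with rfl | rfl <;> norm_num
  have h1 := (irr_iff.1 (irr_ext hsq h)).2
  have hψ : ψ = ψ' := by
    by_contra hne
    nth_rw 2 [he] at h1
    rw [cip_ext, cip_irr_ne h h' hne, card_eq] at h1
    push_cast at h1
    apply pow_ne_zero 2 h0
    linear_combination -h1 / 2
  subst hψ
  refine ⟨?_, rfl⟩
  nth_rw 2 [he] at h1
  rw [cip_ext, (irr_iff.1 h).2, card_eq] at h1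
  push_cast at h1
  have : (ε * ε' - 1) * (Fintype.card H : ℂ) ^ 2 = 0 := by linear_combination h1
  have := (mul_eq_zero.1 this).resolve_right (pow_ne_zero 2 h0)
  rcases hε with rfl | rfl <;> rcases hε' with rfl | rfl <;>
    first | rfl | (norm_num at this)

lemma ind_inj {ψ φ ψ' φ' : H → ℂ} (h1 : ψ ∈ Irr H) (h2 : φ ∈ Irr H) (h3 : ψ' ∈ Irr H)
    (h4 : φ' ∈ Irr H) (hne : ψ ≠ φ) (he : chInd ψ φ = chInd ψ' φ') :
    (ψ = ψ' ∧ φ = φ') ∨ (ψ = φ' ∧ φ = ψ') := by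
  have h0 : (Fintype.card (Wr H) : ℂ) ≠ 0 := by exact_mod_cast Fintype.card_ne_zero
  have h := (irr_iff.1 (irr_ind h1 h2 hne)).2
  nth_rw 2 [he] at h
  by_contra hcon
  push Not at hcon
  apply h0
  rw [← h, cip_ind]
  have e1 : cip ψ ψ' * cip φ φ' = 0 := by
    by_cases hc : ψ = ψ'
    · rw [cip_irr_ne h2 h4 (hcon.1 hc), mul_zero]
    · rw [cip_irr_ne h1 h3 hc, zero_mul]
  have e2 : cip ψ φ' * cip φ ψ' = 0 := by
    by_cases hc : ψ = φ'
    · rw [cip_irr_ne h2 h3 (hcon.2 hc), mul_zero]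
    · rw [cip_irr_ne h1 h4 hc, zero_mul]
  rw [e1, e2]; ring

end Wr

end WreathProduct

section Correspondence

lemma charDeg_eq {G : Type} [Group G] {χ : G → ℂ} {n : ℕ} (h : χ 1 = n) : charDeg χ = n := by
  simp [charDeg, h]

lemma pPart_of_odd {m : ℕ} (h : ¬ 2 ∣ m) : pPart 2 m = 1 := by
  simp [pPart, Nat.factorization_eq_zero_of_not_dvd h]

lemma pPart_two_mul {m : ℕ} (hm : m ≠ 0) : pPart 2 (2 * m) = 2 * pPart 2 m := by
  simp [pPart, Nat.factorization_mul two_ne_zero hm, pow_add, Nat.prime_two.factorization]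

lemma pPart_mul_odd {m n : ℕ} (hm : m ≠ 0) (hn : ¬ 2 ∣ n) : pPart 2 (m * n) = pPart 2 m := by
  have hn0 : n ≠ 0 := by rintro rfl; simp at hn
  simp [pPart, Nat.factorization_mul hm hn0, Nat.factorization_eq_zero_of_not_dvd hn]

lemma charDeg_ne_zero {G : Type} [Group G] [Finite G] {χ : G → ℂ} (h : χ ∈ Irr G) :
    charDeg χ ≠ 0 := by
  have := Fintype.ofFinite G
  intro h0
  apply irr_one_ne h
  rw [(Irr.isCh h).one, h0, Nat.cast_zero]

lemma mem_irrP'_iff {p : ℕ} {G : Type} [Group G] {χ : G → ℂ} :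
    χ ∈ IrrP' p G ↔ χ ∈ Irr G ∧ ¬ p ∣ charDeg χ := by
  constructor
  · intro h
    obtain ⟨V, h1, h2, -⟩ := id h
    exact ⟨⟨V, h1, h2⟩, irrP'_charDeg h⟩
  · rintro ⟨⟨V, h1, rfl⟩, h2⟩
    refine ⟨V, h1, rfl, ?_⟩
    simpa [charDeg, V.char_one] using h2

/-- There is a bijection between the irreducible characters of `G` not vanishing at `x` and those
of `K` not vanishing at `x'`, preserving the `2`-parts of degrees, the values up to sign, and the
simultaneous values at `g` and `g'` for characters of odd degree. -/
def Corr (G K : Type) [Group G] [Group K] (x g : G) (x' g' : K) : Prop :=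
  ∃ Γ : IrrX G x ≃ IrrX K x',
    (∀ χ, pPart 2 (charDeg (Γ χ).1) = pPart 2 (charDeg χ.1)) ∧
    (∀ χ, (Γ χ).1 x' = χ.1 x ∨ (Γ χ).1 x' = - χ.1 x) ∧
    (∀ χ, χ.1 ∈ IrrP' 2 G → ∃ ε : ℂ, (ε = 1 ∨ ε = -1) ∧
      (Γ χ).1 x' = ε * χ.1 x ∧ (Γ χ).1 g' = ε * χ.1 g)

/-- Pulling back characters along an isomorphism. -/
def irrXEquiv {G H : Type} [Group G] [Finite G] [Group H] (e : G ≃* H) (x : G) :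
    IrrX H (e x) ≃ IrrX G x where
  toFun χ := ⟨fun g => χ.1 (e g), by
    have : Finite H := Finite.of_equiv _ e.toEquiv
    exact ⟨irr_comp_mulEquiv e χ.2.1, χ.2.2⟩⟩
  invFun χ := ⟨fun h => χ.1 (e.symm h), irr_comp_mulEquiv e.symm χ.2.1, by
    simpa using χ.2.2⟩
  left_inv χ := by ext h; simp
  right_inv χ := by ext h; simp

lemma charDeg_comp_mulEquiv {G H : Type} [Group G] [Group H] (e : G ≃* H) (χ : H → ℂ) :
    charDeg (fun g => χ (e g)) = charDeg χ := by
  simp [charDeg]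

lemma irrP'_comp_mulEquiv {G H : Type} [Group G] [Group H] [Finite H] (e : G ≃* H) {χ : H → ℂ}
    (h : χ ∈ IrrP' 2 H) : (fun g => χ (e g)) ∈ IrrP' 2 G := by
  rw [mem_irrP'_iff] at h ⊢
  exact ⟨irr_comp_mulEquiv e h.1, by rw [charDeg_comp_mulEquiv]; exact h.2⟩

lemma Corr.right {G K K' : Type} [Group G] [Group K] [Finite K] [Group K'] (e : K ≃* K')
    {x g : G} {x' g' : K} (h : Corr G K' x g (e x') (e g')) : Corr G K x g x' g' := by
  obtain ⟨Γ, h1, h2, h3⟩ := h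
  refine ⟨Γ.trans (irrXEquiv e x'), fun χ => ?_, h2, h3⟩
  rw [← h1]
  exact congrArg _ (charDeg_comp_mulEquiv e _)

lemma Corr.left {G G' K : Type} [Group G] [Group K] [Finite G] [Group G'] (e : G ≃* G')
    {x g : G} {x' g' : K} (h : Corr G' K (e x) (e g) x' g') : Corr G K x g x' g' := by
  obtain ⟨Γ, h1, h2, h3⟩ := h
  have hval : ∀ (χ : IrrX G x) (k : G), ((irrXEquiv e x).symm χ).1 (e k) = χ.1 k := by
    intro χ k
    simp [irrXEquiv]
  refine ⟨(irrXEquiv e x).symm.trans Γ, fun χ => ?_, fun χ => ?_, fun χ hχ => ?_⟩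
  · refine (h1 _).trans (congrArg _ ?_)
    exact charDeg_comp_mulEquiv e.symm _
  · rw [← hval]; exact h2 _
  · rw [← hval, ← hval]
    exact h3 _ (irrP'_comp_mulEquiv e.symm hχ)

lemma Corr.isConj {G K : Type} [Group G] [Group K] {x g : G} {x' g' g'' : K}
    (hc : IsConj g' g'') (h : Corr G K x g x' g') : Corr G K x g x' g'' := by
  obtain ⟨Γ, h1, h2, h3⟩ := h
  refine ⟨Γ, h1, h2, fun χ hχ => ?_⟩
  obtain ⟨ε, hε, e1, e2⟩ := h3 χ hχ
  exact ⟨ε, hε, e1, by rw [← e2]; exact ((Irr.isCh (Γ χ).2.1).isConj hc).symm⟩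

/-- Irreducible characters not vanishing at `c` have value `±1` there, and odd degree. -/
def OddAt (H : Type) [Group H] (c : H) : Prop :=
  ∀ ψ ∈ Irr H, ψ c ≠ 0 → (ψ c = 1 ∨ ψ c = -1) ∧ ¬ 2 ∣ charDeg ψ

lemma OddAt.mulEquiv {H K : Type} [Group H] [Group K] [Finite H] (e : H ≃* K) {c : H}
    (h : OddAt H c) : OddAt K (e c) := by
  intro ψ hψ h0
  have : Finite K := Finite.of_equiv _ e.toEquiv
  have := h _ (irr_comp_mulEquiv e hψ) h0
  rwa [charDeg_comp_mulEquiv] at this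

lemma OddAt.isConj {H : Type} [Group H] {c c' : H} (h : OddAt H c) (hc : IsConj c c') :
    OddAt H c' := by
  intro ψ hψ h0
  rw [← (Irr.isCh hψ).isConj hc] at h0 ⊢
  exact h ψ hψ h0

/-- The characters of `H` not vanishing at `c`. -/
abbrev OSet (H : Type) [Group H] (c : H) : Type := {ψ : H → ℂ // ψ ∈ Irr H ∧ ψ c ≠ 0}

/-- The value at `(c, y)` of the character induced from a pair of characters. -/
def pairVal {H : Type} (c y : H) (ψ φ : H → ℂ) : ℂ := ψ c * φ y + φ c * ψ y

/-- The irreducible characters of `G` not vanishing at `x` are described in terms of those of `H`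
as for a wreath product `H ≀ C₂`, at the elements `x = (c, y)` and `g = (c, 1)σ`. -/
def WrModel (G : Type) [Group G] (x g : G) (H : Type) [Group H] (c y : H) : Prop :=
  ∀ (N : ℕ) (o : Fin N ≃ OSet H c),
    ∃ F : ({ψ : IrrX H y // ψ.1 c = 0} × Fin N) ⊕
        ({p : Fin N × Fin N // p.1 < p.2 ∧ pairVal c y (o p.1).1 (o p.2).1 ≠ 0} ⊕
          (Fin N × Bool)) ≃ IrrX G x,
      (∀ ψ i, ((F (.inl (ψ, i))).1 x = ψ.1.1 y ∨ (F (.inl (ψ, i))).1 x = - ψ.1.1 y) ∧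
        pPart 2 (charDeg (F (.inl (ψ, i))).1) = 2 * pPart 2 (charDeg ψ.1.1)) ∧
      (∀ p, ((F (.inr (.inl p))).1 x = pairVal c y (o p.1.1).1 (o p.1.2).1 ∨
        (F (.inr (.inl p))).1 x = - pairVal c y (o p.1.1).1 (o p.1.2).1) ∧
        pPart 2 (charDeg (F (.inr (.inl p))).1) = 2) ∧
      (∀ i b, ((F (.inr (.inr (i, b)))).1 x = (o i).1 y ∨
          (F (.inr (.inr (i, b)))).1 x = - (o i).1 y) ∧
        (F (.inr (.inr (i, b)))).1 x * (F (.inr (.inr (i, b)))).1 g =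
          (if b then 1 else -1) * ((o i).1 y * (o i).1 c) ∧
        pPart 2 (charDeg (F (.inr (.inr (i, b)))).1) = 1)

theorem corr_of_wrModel {G S K H : Type} [Group G] [Group S] [Group K] [Group H]
    [Finite G] [Finite S] [Finite K] [Finite H] {x g : G} {c y : S} {x' g' : K} {c' y' : H}
    (hS : WrModel G x g S c y) (hK : WrModel K x' g' H c' y') (hΓ : Corr S H y c y' c')
    (hO : ∀ ψ ∈ Irr S, ψ c ≠ 0 → ¬ 2 ∣ charDeg ψ ∧ ψ y ≠ 0)
    (hcard : Nat.card (OSet H c') ≤ Nat.card (OSet S c)) : Corr G K x g x' g' := by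
  have := Fintype.ofFinite S
  have := Fintype.ofFinite H
  have := Fintype.ofFinite G
  obtain ⟨Γ, h1, h2, h3⟩ := hΓ
  have h3' : ∀ ψ : OSet S c, ∃ ε : ℂ, (ε = 1 ∨ ε = -1) ∧
      (Γ ⟨ψ.1, ψ.2.1, (hO _ ψ.2.1 ψ.2.2).2⟩).1 y' = ε * ψ.1 y ∧
      (Γ ⟨ψ.1, ψ.2.1, (hO _ ψ.2.1 ψ.2.2).2⟩).1 c' = ε * ψ.1 c := fun ψ =>
    h3 ⟨ψ.1, ψ.2.1, (hO _ ψ.2.1 ψ.2.2).2⟩ (mem_irrP'_iff.2 ⟨ψ.2.1, (hO _ ψ.2.1 ψ.2.2).1⟩)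
  let f : OSet S c → OSet H c' := fun ψ =>
    ⟨(Γ ⟨ψ.1, ψ.2.1, (hO _ ψ.2.1 ψ.2.2).2⟩).1, (Γ _).2.1, by
      obtain ⟨ε, hε, -, e⟩ := h3' ψ
      rw [e]
      refine mul_ne_zero ?_ ψ.2.2
      rcases hε with rfl | rfl <;> norm_num⟩
  have hfinH : Finite (OSet H c') := Finite.Set.subset (Irr H) (fun _ h => h.1)
  have hfinS : Finite (OSet S c) := Finite.Set.subset (Irr S) (fun _ h => h.1)
  have hinj : Function.Injective f := by
    intro ψ φ h
    have h' := Γ.injective (Subtype.ext (congrArg (fun t : OSet H c' => t.1) h))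
    exact Subtype.ext (congrArg (fun t : IrrX S y => t.1) h')
  have hbij : Function.Bijective f := by
    have := Fintype.ofFinite (OSet H c')
    have := Fintype.ofFinite (OSet S c)
    rw [Fintype.bijective_iff_injective_and_card]
    refine ⟨hinj, le_antisymm (Fintype.card_le_of_injective f hinj) ?_⟩
    simpa [Nat.card_eq_fintype_card] using hcard
  let fe := Equiv.ofBijective f hbij
  have hE : ∀ ψ : IrrX S y, ψ.1 c = 0 ↔ (Γ ψ).1 c' = 0 := by
    intro ψ
    constructor
    · intro h0
      by_contra hne
      obtain ⟨φ, hφ⟩ := hbij.2 ⟨(Γ ψ).1, (Γ ψ).2.1, hne⟩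
      have h' := Γ.injective (Subtype.ext (congrArg (fun t : OSet H c' => t.1) hφ))
      apply φ.2.2
      have h'' := congrArg (fun t : IrrX S y => t.1 c) h'
      exact h''.trans h0
    · intro h0
      by_contra hne
      exact (f ⟨ψ.1, ψ.2.1, hne⟩).2.2 h0
  obtain ⟨N, ⟨oe⟩⟩ := Finite.exists_equiv_fin (OSet S c)
  let o := oe.symm
  obtain ⟨F, Fa, Fb, Fc⟩ := hS N o
  obtain ⟨F', Fa', Fb', Fc'⟩ := hK N (o.trans fe)
  have hv : ∀ i, ∃ ε : ℂ, (ε = 1 ∨ ε = -1) ∧ ((o.trans fe) i).1 y' = ε * (o i).1 y ∧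
      ((o.trans fe) i).1 c' = ε * (o i).1 c := fun i => h3' (o i)
  have hp : ∀ i j, pairVal c' y' ((o.trans fe) i).1 ((o.trans fe) j).1 =
        pairVal c y (o i).1 (o j).1 ∨
      pairVal c' y' ((o.trans fe) i).1 ((o.trans fe) j).1 = - pairVal c y (o i).1 (o j).1 := by
    intro i j
    obtain ⟨ε, hε, e1, e2⟩ := hv i
    obtain ⟨δ, hδ, e3, e4⟩ := hv j
    unfold pairVal
    rw [e1, e2, e3, e4]
    rcases hε with rfl | rfl <;> rcases hδ with rfl | rfl
    · left; ring
    · right; ring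
    · right; ring
    · left; ring
  let T := Equiv.sumCongr
    (Equiv.prodCongr (Equiv.subtypeEquiv (p := fun ψ : IrrX S y => ψ.1 c = 0)
      (q := fun ψ : IrrX H y' => ψ.1 c' = 0) Γ hE) (Equiv.refl (Fin N)))
    (Equiv.sumCongr (Equiv.subtypeEquivRight (p := fun p : Fin N × Fin N => p.1 < p.2 ∧
        pairVal c y (o p.1).1 (o p.2).1 ≠ 0) (q := fun p : Fin N × Fin N => p.1 < p.2 ∧
        pairVal c' y' ((o.trans fe) p.1).1 ((o.trans fe) p.2).1 ≠ 0) (fun p => by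
          rcases hp p.1 p.2 with h | h <;> rw [h]
          rw [neg_ne_zero]))
      (Equiv.refl (Fin N × Bool)))
  have hodd : ∀ χ : IrrX G x, χ.1 ∈ IrrP' 2 G → ∀ t, F t = χ → ∃ i b, t = .inr (.inr (i, b)) := by
    intro χ hχ t ht
    have h1 := pPart_of_odd (mem_irrP'_iff.1 hχ).2
    rcases t with ⟨ψ, i⟩ | p | ⟨i, b⟩
    · have := (Fa ψ i).2
      rw [ht, h1] at this
      omega
    · have := (Fb p).2
      rw [ht, h1] at this
      omega
    · exact ⟨i, b, rfl⟩
  have key : ∀ i b, (F' (.inr (.inr (i, b)))).1 x' = (F (.inr (.inr (i, b)))).1 x ∨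
      (F' (.inr (.inr (i, b)))).1 x' = - (F (.inr (.inr (i, b)))).1 x := by
    intro i b
    have a1 := (Fc i b).1
    have a2 := (Fc' i b).1
    obtain ⟨ε, hε, e1, e2⟩ := hv i
    rw [e1] at a2
    rcases a1 with a1 | a1 <;> rcases a2 with a2 | a2 <;> rcases hε with rfl | rfl <;>
      rw [a1, a2] <;> simp
  have hT1 : ∀ ψ i, T (.inl (ψ, i)) = .inl (⟨Γ ψ.1, (hE _).1 ψ.2⟩, i) := fun _ _ => rfl
  have hT2 : ∀ p, ∃ h, T (.inr (.inl p)) = .inr (.inl ⟨p.1, h⟩) := fun p => ⟨_, rfl⟩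
  have hT3 : ∀ i b, T (.inr (.inr (i, b))) = .inr (.inr (i, b)) := fun _ _ => rfl
  clear_value T
  let Φ := (F.symm.trans T).trans F'
  have hΦ : ∀ t, Φ (F t) = F' (T t) := by
    intro t
    change F' (T (F.symm (F t))) = _
    rw [Equiv.symm_apply_apply]
  clear_value Φ
  refine ⟨Φ, fun χ => ?_, fun χ => ?_, fun χ hχ => ?_⟩
  · obtain ⟨t, rfl⟩ := F.surjective χ
    rw [hΦ]
    rcases t with ⟨ψ, i⟩ | p | ⟨i, b⟩
    · rw [hT1, (Fa ψ i).2, (Fa' _ _).2, h1]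
    · obtain ⟨_, e⟩ := hT2 p
      rw [e, (Fb p).2, (Fb' _).2]
    · rw [hT3, (Fc i b).2.2, (Fc' i b).2.2]
  · obtain ⟨t, rfl⟩ := F.surjective χ
    rw [hΦ]
    rcases t with ⟨ψ, i⟩ | p | ⟨i, b⟩
    · have a1 := (Fa ψ i).1
      have a2 := (Fa' ⟨Γ ψ.1, (hE _).1 ψ.2⟩ i).1
      have a3 := h2 ψ.1
      rw [hT1]
      rcases a1 with a1 | a1 <;> rcases a2 with a2 | a2 <;> rcases a3 with a3 | a3 <;>
        rw [a1, a2, a3] <;> simp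
    · obtain ⟨hh, e⟩ := hT2 p
      have a1 := (Fb p).1
      have a2 := (Fb' ⟨p.1, hh⟩).1
      have a3 := hp p.1.1 p.1.2
      rw [e]
      rcases a1 with a1 | a1 <;> rcases a2 with a2 | a2 <;> rcases a3 with a3 | a3 <;>
        rw [a1, a2, a3] <;> simp
    · rw [hT3]
      exact key i b
  · obtain ⟨t, rfl⟩ := F.surjective χ
    obtain ⟨i, b, rfl⟩ := hodd _ hχ t rfl
    rw [hΦ, hT3]
    have b1 := (Fc i b).2.1
    have b2 := (Fc' i b).2.1
    have hne := (F (.inr (.inr (i, b)))).2.2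
    obtain ⟨ε, hε, e1, e2⟩ := hv i
    have e3 : (F' (.inr (.inr (i, b)))).1 x' * (F' (.inr (.inr (i, b)))).1 g' =
        (F (.inr (.inr (i, b)))).1 x * (F (.inr (.inr (i, b)))).1 g := by
      rw [b1, b2, e1, e2]
      rcases hε with rfl | rfl <;> ring
    rcases key i b with hk | hk
    · refine ⟨1, Or.inl rfl, by rw [hk, one_mul], ?_⟩
      rw [hk] at e3
      rw [one_mul]
      exact mul_left_cancel₀ hne e3
    · refine ⟨-1, Or.inr rfl, by rw [hk]; ring, ?_⟩
      rw [hk] at e3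
      apply mul_left_cancel₀ hne
      linear_combination -e3

namespace Wr

variable {H : Type} [Group H]

lemma charDeg_chExt {ψ : H → ℂ} (h : IsCh ψ) (ε : ℂ) :
    charDeg (chExt ε ψ) = charDeg ψ * charDeg ψ :=
  charDeg_eq (by simp only [chExt, one_def, cond_false]; rw [h.one]; push_cast; rfl)

lemma charDeg_chInd {ψ φ : H → ℂ} (h : IsCh ψ) (h' : IsCh φ) :
    charDeg (chInd ψ φ) = 2 * (charDeg ψ * charDeg φ) :=
  charDeg_eq (by simp only [chInd, one_def, cond_false]; rw [h.one, h'.one]; push_cast; ring)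

lemma oddAt [Finite H] {c : H} (h : OddAt H c) : OddAt (Wr H) ⟨c, 1, true⟩ := by
  have := Fintype.ofFinite H
  intro χ hχ h0
  rcases irr_cases hχ with ⟨ψ, hψ, hh⟩ | ⟨ψ, -, φ, -, -, rfl⟩
  · have hψc : ψ c ≠ 0 := by
      intro hc
      rcases hh with rfl | rfl <;> simp [chExt, hc] at h0
    obtain ⟨h1, h2⟩ := h ψ hψ hψc
    have h3 : ¬ 2 ∣ charDeg ψ * charDeg ψ := by
      rw [Nat.prime_two.dvd_mul]; tauto
    rcases hh with rfl | rfl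
    · rw [charDeg_chExt (Irr.isCh hψ)]
      refine ⟨?_, h3⟩
      rcases h1 with h1 | h1 <;> simp [chExt, h1]
    · rw [charDeg_chExt (Irr.isCh hψ)]
      refine ⟨?_, h3⟩
      rcases h1 with h1 | h1 <;> simp [chExt, h1]
  · simp [chInd] at h0

theorem wrModel [Finite H] {c y : H} (h : OddAt H c) (hy : ∀ ψ ∈ Irr H, ψ c ≠ 0 → ψ y ≠ 0) :
    WrModel (Wr H) ⟨c, y, false⟩ ⟨c, 1, true⟩ H c y := by
  have := Fintype.ofFinite H
  intro N o
  let sg : Bool → ℂ := fun b => if b then 1 else -1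
  have hsg : ∀ b, sg b = 1 ∨ sg b = -1 := by intro b; cases b <;> simp [sg]
  have hsg2 : ∀ b, sg b * sg b = 1 := by intro b; cases b <;> simp [sg]
  let F : ({ψ : IrrX H y // ψ.1 c = 0} × Fin N) ⊕
        ({p : Fin N × Fin N // p.1 < p.2 ∧ pairVal c y (o p.1).1 (o p.2).1 ≠ 0} ⊕
          (Fin N × Bool)) → (Wr H → ℂ) := fun t =>
    match t with
    | .inl (ψ, i) => chInd ψ.1.1 (o i).1
    | .inr (.inl p) => chInd (o p.1.1).1 (o p.1.2).1
    | .inr (.inr (i, b)) => chExt (sg b * (o i).1 c) (o i).1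
  have hoc : ∀ i, (o i).1 c * (o i).1 c = 1 := by
    intro i
    rcases (h _ (o i).2.1 (o i).2.2).1 with h1 | h1 <;> rw [h1] <;> norm_num
  have hsoc : ∀ i b, (sg b * (o i).1 c) * (sg b * (o i).1 c) = 1 := by
    intro i b
    linear_combination hsg2 b * (o i).1 c * (o i).1 c + hoc i
  have hsoc' : ∀ i b, sg b * (o i).1 c = 1 ∨ sg b * (o i).1 c = -1 := fun i b =>
    mul_self_eq_one_iff.1 (hsoc i b)
  have hEO : ∀ (ψ : {ψ : IrrX H y // ψ.1 c = 0}) (φ : OSet H c), ψ.1.1 ≠ φ.1 := by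
    intro ψ φ he
    exact φ.2.2 (by rw [← he]; exact ψ.2)
  have hne : ∀ {i j}, i < j → (o i).1 ≠ (o j).1 := fun hij he =>
    hij.ne (o.injective (Subtype.ext he))
  have v1 : ∀ ψ i, F (.inl (ψ, i)) ⟨c, y, false⟩ = ψ.1.1 y * (o i).1 c := by
    intro ψ i
    simp [F, chInd, ψ.2]
  have v2 : ∀ p, F (.inr (.inl p)) ⟨c, y, false⟩ = pairVal c y (o p.1.1).1 (o p.1.2).1 := by
    intro p
    simp only [F, chInd, pairVal, cond_false]
    ring
  have v3 : ∀ i b, F (.inr (.inr (i, b))) ⟨c, y, false⟩ = (o i).1 c * (o i).1 y := by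
    intro i b
    simp [F, chExt]
  have hF : ∀ t, F t ∈ IrrX (Wr H) ⟨c, y, false⟩ := by
    rintro (⟨ψ, i⟩ | p | ⟨i, b⟩)
    · exact ⟨irr_ind ψ.1.2.1 (o i).2.1 (hEO _ _), by
        rw [v1]; exact mul_ne_zero ψ.1.2.2 (o i).2.2⟩
    · exact ⟨irr_ind (o _).2.1 (o _).2.1 (hne p.2.1), by rw [v2]; exact p.2.2⟩
    · exact ⟨irr_ext (hsoc i b) (o i).2.1, by
        rw [v3]; exact mul_ne_zero (o i).2.2 (hy _ (o i).2.1 (o i).2.2)⟩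
  have hinj : Function.Injective F := by
    rintro (⟨ψ, i⟩ | p | ⟨i, b⟩) (⟨ψ', i'⟩ | p' | ⟨i', b'⟩) he
    · rcases ind_inj ψ.1.2.1 (o i).2.1 ψ'.1.2.1 (o i').2.1 (hEO _ _) he with ⟨h1, h2⟩ | ⟨h1, -⟩
      · have e1 : ψ = ψ' := Subtype.ext (Subtype.ext h1)
        have e2 : i = i' := o.injective (Subtype.ext h2)
        rw [e1, e2]
      · exact absurd h1 (hEO _ _)
    · rcases ind_inj ψ.1.2.1 (o i).2.1 (o _).2.1 (o _).2.1 (hEO _ _) he with ⟨h1, h2⟩ | ⟨h1, -⟩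
      · exact absurd h1 (hEO _ _)
      · exact absurd h1 (hEO _ _)
    · exact absurd he.symm (ext_ne_ind (hsoc i' b') (o i').2.1 _ _)
    · rcases ind_inj ψ'.1.2.1 (o i').2.1 (o _).2.1 (o _).2.1 (hEO _ _) he.symm with
        ⟨h1, h2⟩ | ⟨h1, -⟩
      · exact absurd h1 (hEO _ _)
      · exact absurd h1 (hEO _ _)
    · rcases ind_inj (o _).2.1 (o _).2.1 (o _).2.1 (o _).2.1 (hne p.2.1) he with
        ⟨h1, h2⟩ | ⟨h1, h2⟩
      · have e1 := o.injective (Subtype.ext h1)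
        have e2 := o.injective (Subtype.ext h2)
        have : p = p' := Subtype.ext (Prod.ext e1 e2)
        rw [this]
      · have e1 := o.injective (Subtype.ext h1)
        have e2 := o.injective (Subtype.ext h2)
        have h3 := p.2.1
        rw [e1, e2] at h3
        exact absurd h3 p'.2.1.asymm
    · exact absurd he.symm (ext_ne_ind (hsoc i' b') (o i').2.1 _ _)
    · exact absurd he (ext_ne_ind (hsoc i b) (o i).2.1 _ _)
    · exact absurd he (ext_ne_ind (hsoc i b) (o i).2.1 _ _)
    · obtain ⟨e1, e2⟩ := ext_inj (hsoc' i b) (hsoc' i' b') (o i).2.1 (o i').2.1 he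
      have e3 := o.injective (Subtype.ext e2)
      rw [← e3] at e1
      replace e1 := mul_right_cancel₀ (o i).2.2 e1
      have e4 : b = b' := by
        cases b <;> cases b' <;> first | rfl | (norm_num [sg] at e1)
      rw [e3, e4]
  have hsurj : ∀ χ ∈ IrrX (Wr H) ⟨c, y, false⟩, ∃ t, F t = χ := by
    rintro χ ⟨hχ, h0⟩
    have hext : ∀ ψ ∈ Irr H, ∀ b, χ = chExt (sg b) ψ → ∃ t, F t = χ := by
      rintro ψ hψ b rfl
      have hc : ψ c ≠ 0 := by
        intro hc; simp [chExt, hc] at h0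
      have hb : ∃ b', sg b' * ψ c = sg b := by
        rcases (h _ hψ hc).1 with h1 | h1
        · exact ⟨b, by rw [h1, mul_one]⟩
        · exact ⟨!b, by rw [h1]; cases b <;> simp [sg]⟩
      obtain ⟨b', hb'⟩ := hb
      exact ⟨.inr (.inr (o.symm ⟨ψ, hψ, hc⟩, b')), by simp [F, hb']⟩
    have hEI : ∀ ψ ∈ Irr H, ∀ φ ∈ Irr H, ψ c = 0 → χ = chInd ψ φ → ∃ t, F t = χ := by
      rintro ψ hψ φ hφ hψc rfl
      have hv : ψ y ≠ 0 ∧ φ c ≠ 0 := by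
        simpa [chInd, hψc] using h0
      exact ⟨.inl (⟨⟨ψ, hψ, hv.1⟩, hψc⟩, o.symm ⟨φ, hφ, hv.2⟩), by simp [F]⟩
    rcases irr_cases hχ with ⟨ψ, hψ, hh | hh⟩ | ⟨ψ, hψ, φ, hφ, hne, hh⟩
    · exact hext ψ hψ true hh
    · exact hext ψ hψ false hh
    · by_cases h1 : ψ c = 0
      · exact hEI ψ hψ φ hφ h1 hh
      by_cases h2 : φ c = 0
      · exact hEI φ hφ ψ hψ h2 (by rw [hh, ind_comm])
      have hpv : pairVal c y ψ φ ≠ 0 := by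
        rw [hh] at h0
        convert h0 using 1
        simp only [pairVal, chInd, cond_false]; ring
      have hpc : pairVal c y φ ψ = pairVal c y ψ φ := by unfold pairVal; ring
      rcases lt_trichotomy (o.symm ⟨ψ, hψ, h1⟩) (o.symm ⟨φ, hφ, h2⟩) with hlt | heq | hlt
      · exact ⟨.inr (.inl ⟨(_, _), hlt, by simpa using hpv⟩), by simp [F, hh]⟩
      · exact absurd (Subtype.ext_iff.1 (o.symm.injective heq)) hne
      · exact ⟨.inr (.inl ⟨(_, _), hlt, by simpa [hpc] using hpv⟩), by
          rw [hh, ind_comm ψ φ]; simp [F]⟩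
  let F' : _ → IrrX (Wr H) ⟨c, y, false⟩ := fun t => ⟨F t, hF t⟩
  have hbij : Function.Bijective F' :=
    ⟨fun a b hab => hinj (Subtype.ext_iff.1 hab), fun χ => by
      obtain ⟨t, ht⟩ := hsurj χ.1 χ.2
      exact ⟨t, Subtype.ext ht⟩⟩
  have hmul : ∀ i (z : ℂ), z * (o i).1 c = z ∨ z * (o i).1 c = -z := by
    intro i z
    rcases (h _ (o i).2.1 (o i).2.2).1 with h1 | h1 <;> simp [h1]
  have hE1 : ∀ t, (Equiv.ofBijective F' hbij t).1 = F t := fun _ => rfl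
  refine ⟨Equiv.ofBijective F' hbij, fun ψ i => ⟨?_, ?_⟩, fun p => ⟨?_, ?_⟩, fun i b =>
    ⟨?_, ?_, ?_⟩⟩
  · rw [hE1, v1]; exact hmul i _
  · change pPart 2 (charDeg (chInd ψ.1.1 (o i).1)) = _
    rw [charDeg_chInd (Irr.isCh ψ.1.2.1) (Irr.isCh (o i).2.1), pPart_two_mul, pPart_mul_odd]
    · exact charDeg_ne_zero ψ.1.2.1
    · exact (h _ (o i).2.1 (o i).2.2).2
    · exact mul_ne_zero (charDeg_ne_zero ψ.1.2.1) (charDeg_ne_zero (o i).2.1)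
  · left
    exact v2 p
  · change pPart 2 (charDeg (chInd (o p.1.1).1 (o p.1.2).1)) = _
    rw [charDeg_chInd (Irr.isCh (o _).2.1) (Irr.isCh (o _).2.1), pPart_two_mul, pPart_mul_odd,
      pPart_of_odd]
    · exact (h _ (o _).2.1 (o _).2.2).2
    · exact charDeg_ne_zero (o _).2.1
    · exact (h _ (o _).2.1 (o _).2.2).2
    · exact mul_ne_zero (charDeg_ne_zero (o _).2.1) (charDeg_ne_zero (o _).2.1)
  · rw [hE1, v3, mul_comm]; exact hmul i _
  · rw [hE1, v3]
    simp only [F, chExt, cond_true, mul_one]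
    rcases (h _ (o i).2.1 (o i).2.2).1 with h1 | h1 <;> simp only [h1, sg] <;> ring
  · change pPart 2 (charDeg (chExt (sg b * (o i).1 c) (o i).1)) = _
    rw [charDeg_chExt (Irr.isCh (o i).2.1), pPart_of_odd]
    rw [Nat.prime_two.dvd_mul]
    have := (h _ (o i).2.1 (o i).2.2).2
    tauto

end Wr

end Correspondence

section Beads

variable {M : ℕ}

/-- The group ring of `ℤ^M`. -/
abbrev BA (M : ℕ) : Type := AddMonoidAlgebra ℤ (Fin M → ℤ)

namespace BA

/-- The power sum `∑ Xᵢ ^ r`. -/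
def pw (r : ℤ) : BA M := ∑ i, AddMonoidAlgebra.single (Pi.single i r) 1

/-- The alternant of the staircase. -/
def dl : BA M :=
  ∑ w : Equiv.Perm (Fin M), AddMonoidAlgebra.single (fun i => ((w i : ℕ) : ℤ))
    (Equiv.Perm.sign w : ℤ)

/-- The product of power sums and of the alternant of the staircase. -/
def Fm (S : Multiset ℕ) : BA M := (S.map fun r : ℕ => pw (r : ℤ)).prod * dl

lemma Fm_zero : (Fm 0 : BA M) = dl := by simp [Fm]

lemma Fm_cons (r : ℕ) (S : Multiset ℕ) : (Fm (r ::ₘ S) : BA M) = pw (r : ℤ) * Fm S := by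
  simp [Fm, mul_assoc]

lemma coeff_single_mul' (v : Fin M → ℤ) (f : BA M) (b : Fin M → ℤ) :
    (AddMonoidAlgebra.single v 1 * f).coeff b = f.coeff (b - v) := by
  rw [AddMonoidAlgebra.coeff_single_mul_eq_mul_coeff (b - v), one_mul]
  intro m _
  rw [eq_sub_iff_add_eq, add_comm]

lemma coeff_pw_mul (r : ℤ) (f : BA M) (b : Fin M → ℤ) :
    (pw r * f).coeff b = ∑ i, f.coeff (b - Pi.single i r) := by
  simp only [pw, Finset.sum_mul, AddMonoidAlgebra.coeff_sum, Finset.sum_apply', coeff_single_mul']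

lemma coeff_dl (b : Fin M → ℤ) : (dl : BA M).coeff b =
    ∑ w : Equiv.Perm (Fin M), if (fun i => ((w i : ℕ) : ℤ)) = b then (Equiv.Perm.sign w : ℤ) else 0 := by
  simp only [dl, AddMonoidAlgebra.coeff_sum, Finset.sum_apply']
  refine Finset.sum_congr rfl fun w _ => ?_
  rw [AddMonoidAlgebra.coeff_single, Finsupp.single_apply]

/-- Alternating elements. -/
def Alt (f : BA M) : Prop :=
  ∀ (b : Fin M → ℤ) (τ : Equiv.Perm (Fin M)), f.coeff (b ∘ τ) = Equiv.Perm.sign τ * f.coeff b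

lemma alt_dl : Alt (dl : BA M) := by
  intro b τ
  rw [coeff_dl, coeff_dl, Finset.mul_sum, ← Equiv.sum_comp (Equiv.mulRight τ)]
  refine Finset.sum_congr rfl fun w _ => ?_
  have : ((fun i => (((Equiv.mulRight τ w) i : ℕ) : ℤ)) = b ∘ τ) ↔
      (fun i => ((w i : ℕ) : ℤ)) = b := by
    constructor
    · intro h
      funext i
      have := congrFun h (τ⁻¹ i)
      simpa using this
    · intro h
      rw [← h]; rfl
  rw [if_congr this rfl rfl]
  split_ifs
  · simp [mul_comm]
  · simp

lemma Alt.pw_mul {f : BA M} (h : Alt f) (r : ℤ) : Alt (pw r * f) := by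
  intro b τ
  rw [coeff_pw_mul, coeff_pw_mul, Finset.mul_sum,
    ← Equiv.sum_comp τ (fun i => (Equiv.Perm.sign τ : ℤ) * f.coeff (b - (Pi.single i r : Fin M → ℤ)))]
  refine Finset.sum_congr rfl fun i _ => ?_
  rw [← h]
  congr 1
  funext j
  simp [Pi.single_apply]

lemma alt_Fm (S : Multiset ℕ) : Alt (Fm S : BA M) := by
  induction S using Multiset.induction_on with
  | empty => rw [Fm_zero]; exact alt_dl
  | cons r S ih => rw [Fm_cons]; exact ih.pw_mul _

lemma Alt.injective {f : BA M} (h : Alt f) {b : Fin M → ℤ} (hb : f.coeff b ≠ 0) :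
    Function.Injective b := by
  intro p q hpq
  by_contra hne
  have h1 := h b (Equiv.swap p q)
  have h2 : b ∘ Equiv.swap p q = b := by
    funext i
    simp only [Function.comp, Equiv.swap_apply_def]
    split_ifs with h3 h4
    · rw [h3, hpq]
    · rw [h4, hpq]
    · rfl
  rw [h2, Equiv.Perm.sign_swap hne] at h1
  push_cast at h1
  omega

/-- The sum of the entries of the staircase. -/
def Z (M : ℕ) : ℤ := ∑ i : Fin M, ((i : ℕ) : ℤ)

lemma supp_dl {b : Fin M → ℤ} (hb : (dl : BA M).coeff b ≠ 0) :
    ∃ w : Equiv.Perm (Fin M), b = fun i => ((w i : ℕ) : ℤ) := by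
  rw [coeff_dl] at hb
  obtain ⟨w, -, hw⟩ := Finset.exists_ne_zero_of_sum_ne_zero hb
  refine ⟨w, ?_⟩
  by_contra h
  exact hw (if_neg fun h' => h h'.symm)

lemma coeff_dl_perm (w : Equiv.Perm (Fin M)) :
    (dl : BA M).coeff (fun i => ((w i : ℕ) : ℤ)) = Equiv.Perm.sign w := by
  rw [coeff_dl, Finset.sum_eq_single w]
  · simp
  · intro w' _ hne
    refine if_neg fun h => hne (Equiv.ext fun i => Fin.ext ?_)
    exact_mod_cast congrFun h i
  · simp

lemma sum_sub_single (b : Fin M → ℤ) (i : Fin M) (r : ℤ) :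
    ∑ j, (b - Pi.single i r : Fin M → ℤ) j = ∑ j, b j - r := by
  simp [Finset.sum_sub_distrib]

lemma supp_Fm {S : Multiset ℕ} {b : Fin M → ℤ} (hb : (Fm S : BA M).coeff b ≠ 0) :
    (∀ i, 0 ≤ b i) ∧ ∑ i, b i = S.sum + Z M := by
  induction S using Multiset.induction_on generalizing b with
  | empty =>
    rw [Fm_zero] at hb
    obtain ⟨w, rfl⟩ := supp_dl hb
    refine ⟨fun i => by positivity, ?_⟩
    simp only [Multiset.sum_zero, Nat.cast_zero, zero_add, Z]
    exact Equiv.sum_comp w (fun i : Fin M => ((i : ℕ) : ℤ))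
  | cons r S ih =>
    rw [Fm_cons, coeff_pw_mul] at hb
    obtain ⟨i, -, hi⟩ := Finset.exists_ne_zero_of_sum_ne_zero hb
    obtain ⟨h1, h2⟩ := ih hi
    rw [sum_sub_single] at h2
    refine ⟨fun j => ?_, by rw [Multiset.sum_cons, Nat.cast_add]; linarith⟩
    have h3 := h1 j
    simp only [Pi.sub_apply, Pi.single_apply] at h3
    split_ifs at h3 <;> omega

/-! ### Injective configurations -/

lemma Z_eq : Z M = ∑ n ∈ Finset.range M, (n : ℤ) := by
  rw [Z, Finset.sum_range]

lemma Z_le {b : Fin M → ℤ} (hb : Function.Injective b) (h0 : ∀ i, 0 ≤ b i) : Z M ≤ ∑ i, b i := by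
  have := Finset.sum_range_le_sum (s := Finset.univ.image b) (c := 0) (by simpa using h0)
  rw [Finset.card_image_of_injective _ hb, Finset.sum_image (fun _ _ _ _ h => hb h)] at this
  simpa [Z_eq] using this

lemma exists_eq {b : Fin M → ℤ} (hb : Function.Injective b) (h0 : ∀ i, 0 ≤ b i) {m t : ℤ}
    (hm : ∑ i, b i ≤ m + Z M) (ht0 : 0 ≤ t) (ht : t < M - m) : ∃ i, b i = t := by
  by_contra hne
  push Not at hne
  let φ : Fin M → ℤ := fun i => if b i < t then b i else b i - 1
  have hφ : Function.Injective φ := by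
    intro i j hij
    apply hb
    have h1 := hne i
    have h2 := hne j
    simp only [φ] at hij
    split_ifs at hij <;> omega
  have hφ0 : ∀ i, 0 ≤ φ i := by
    intro i
    have h1 := hne i
    have h2 := h0 i
    simp only [φ]
    split_ifs <;> omega
  have h1 := Z_le hφ hφ0
  have h2 : ∑ i, b i = ∑ i, φ i + ∑ i, (if b i < t then (0 : ℤ) else 1) := by
    rw [← Finset.sum_add_distrib]
    refine Finset.sum_congr rfl fun i _ => ?_
    simp only [φ]
    split_ifs <;> ring
  have h3 : ∑ i, (if b i < t then (0 : ℤ) else 1) = M - (Finset.univ.filter fun i => b i < t).card := by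
    have : ∀ i, (if b i < t then (0 : ℤ) else 1) = 1 - if b i < t then 1 else 0 := by
      intro i; split_ifs <;> rfl
    simp only [this, Finset.sum_sub_distrib]
    simp
  have h4 : ((Finset.univ.filter fun i => b i < t).card : ℤ) ≤ t := by
    have : (Finset.univ.filter fun i => b i < t).card ≤ (Finset.Ico 0 t).card := by
      refine Finset.card_le_card_of_injOn b ?_ hb.injOn
      intro i hi
      have hi' : b i < t := by simpa using hi
      simp [h0 i, hi']
    rw [Int.card_Ico] at this
    omega
  omega

lemma coeff_dl_ne_zero {b : Fin M → ℤ} (hb : Function.Injective b) (h0 : ∀ i, 0 ≤ b i)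
    (hs : ∑ i, b i = Z M) : (dl : BA M).coeff b ≠ 0 := by
  have h1 : ∀ t : Fin M, ∃ i, b i = (t : ℕ) := fun t =>
    exists_eq hb h0 (m := 0) (by omega) (by positivity) (by have := t.2; omega)
  choose f hf using h1
  have hinj : Function.Injective f := by
    intro s t hst
    have := hf s
    rw [hst, hf t] at this
    exact Fin.ext (by exact_mod_cast this.symm)
  let e := Equiv.ofBijective f (Finite.injective_iff_bijective.1 hinj)
  have : b = fun i => (((e.symm i : Fin M) : ℕ) : ℤ) := by
    funext i
    have := hf (e.symm i)
    rw [← this]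
    congr 1
    exact (e.apply_symm_apply i).symm
  rw [this, coeff_dl_perm]
  simp

end BA
end Beads

section Pairing

variable {M : ℕ}

namespace BA

lemma card_lt {b : Fin M → ℤ} (hb : Function.Injective b) (h0 : ∀ i, 0 ≤ b i) {m : ℤ} {s : ℕ}
    (hm : ∑ i, b i ≤ m + Z M) (hs : s ≤ M - m) :
    (Finset.univ.filter fun i => b i < (s : ℤ)).card = s := by
  have h1 : (Finset.univ.filter fun i => b i < (s : ℤ)).image b = Finset.Ico 0 (s : ℤ) := by
    ext t
    simp only [Finset.mem_image, Finset.mem_filter, Finset.mem_univ, true_and, Finset.mem_Ico]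
    constructor
    · rintro ⟨i, hi, rfl⟩
      exact ⟨h0 i, hi⟩
    · rintro ⟨h2, h3⟩
      obtain ⟨i, rfl⟩ := exists_eq hb h0 hm h2 (by omega)
      exact ⟨i, h3, rfl⟩
  rw [← Finset.card_image_of_injective _ hb, h1, Int.card_Ico]
  omega

lemma supp_pw_neg {r : ℕ} {S : Multiset ℕ} {b : Fin M → ℤ} (h0 : ∀ i, 0 ≤ b i)
    (h : (pw (-(r : ℤ)) * Fm S : BA M).coeff b ≠ 0) :
    Function.Injective b ∧ ∑ i, b i = S.sum - r + Z M ∧ r ≤ S.sum := by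
  have hinj := ((alt_Fm S).pw_mul (-(r : ℤ))).injective h
  rw [coeff_pw_mul] at h
  obtain ⟨i, -, hi⟩ := Finset.exists_ne_zero_of_sum_ne_zero h
  have h2 := (supp_Fm hi).2
  rw [sum_sub_single] at h2
  have h3 := Z_le hinj h0
  exact ⟨hinj, by omega, by omega⟩

lemma sum_erase_add {r : ℕ} {S : Multiset ℕ} (h : r ∈ S) : (S.erase r).sum + r = S.sum := by
  conv_rhs => rw [← Multiset.cons_erase h, Multiset.sum_cons]
  omega

/-- The adjoint of the multiplication by a power sum acts as a derivation. -/
theorem coeff_pw_neg_mul {r : ℕ} (hr : 1 ≤ r) (S : Multiset ℕ) (hM : 2 * S.sum ≤ M)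
    {b : Fin M → ℤ} (h0 : ∀ i, 0 ≤ b i) :
    (pw (-(r : ℤ)) * Fm S : BA M).coeff b = r * S.count r * (Fm (S.erase r) : BA M).coeff b := by
  induction S using Multiset.induction_on generalizing b with
  | empty =>
    rw [Multiset.count_zero, Nat.cast_zero, mul_zero, zero_mul]
    by_contra h
    have := (supp_pw_neg h0 h).2.2
    rw [Multiset.sum_zero] at this
    omega
  | cons s S ih =>
    rw [Multiset.sum_cons] at hM
    by_cases hgood : Function.Injective b ∧ ∑ i, b i = (s ::ₘ S).sum - r + Z M ∧ r ≤ (s ::ₘ S).sum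
    swap
    · have h1 : (pw (-(r : ℤ)) * Fm (s ::ₘ S) : BA M).coeff b = 0 := by
        by_contra h
        exact hgood (supp_pw_neg h0 h)
      rw [h1]
      symm
      by_contra h
      have h2 := left_ne_zero_of_mul h
      have h3 := right_ne_zero_of_mul h
      have h4 : r ∈ s ::ₘ S := Multiset.count_ne_zero.1 fun h5 => by rw [h5] at h2; simp at h2
      have h5 := sum_erase_add h4
      have h6 := (supp_Fm h3).2
      exact hgood ⟨(alt_Fm _).injective h3, by omega, by omega⟩
    obtain ⟨hinj, hsum, hle⟩ := hgood
    rw [Multiset.sum_cons] at hsum hle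
    have hterm : ∀ j, (pw (-(r : ℤ)) * Fm S : BA M).coeff (b - Pi.single j (s : ℤ)) =
        r * S.count r * (Fm (S.erase r) : BA M).coeff (b - Pi.single j (s : ℤ)) +
          if b j < s then (if r = s then (Fm S : BA M).coeff b else 0) else 0 := by
      intro j
      split_ifs with hj hrs
      · have h1 : (Fm (S.erase r) : BA M).coeff (b - Pi.single j (s : ℤ)) = 0 := by
          by_contra h
          have := (supp_Fm h).1 j
          simp at this
          omega
        rw [h1, mul_zero, zero_add, coeff_pw_mul, Finset.sum_eq_single j]
        · rw [hrs, sub_sub, ← Pi.single_add]; simp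
        · intro i _ hij
          by_contra h
          have := (supp_Fm h).1 j
          simp [hij.symm] at this
          omega
        · simp
      · have h1 : (Fm (S.erase r) : BA M).coeff (b - Pi.single j (s : ℤ)) = 0 := by
          by_contra h
          have := (supp_Fm h).1 j
          simp at this
          omega
        rw [h1, mul_zero, zero_add, coeff_pw_mul, Finset.sum_eq_single j]
        · by_contra h
          have h2 := (supp_Fm h).1 j
          simp only [Pi.sub_apply, Pi.single_eq_same] at h2
          obtain ⟨i, hi⟩ := exists_eq hinj h0 (m := (s + S.sum : ℕ) - r) (t := b j + r - s)
            (by rw [hsum]) (by omega) (by omega)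
          have hij : i ≠ j := by
            rintro rfl
            omega
          apply hij
          apply (alt_Fm _).injective h
          simp only [Pi.sub_apply, Pi.single_eq_same, Pi.single_eq_of_ne hij]
          omega
        · intro i _ hij
          by_contra h
          have := (supp_Fm h).1 j
          simp [hij.symm] at this
          omega
        · simp
      · rw [add_zero]
        refine ih (by omega) fun i => ?_
        have := h0 i
        simp only [Pi.sub_apply, Pi.single_apply]
        split_ifs with hi
        · subst hi; omega
        · omega
    have hmain : (pw (-(r : ℤ)) * Fm (s ::ₘ S) : BA M).coeff b =
        r * S.count r * (Fm (s ::ₘ S.erase r) : BA M).coeff b +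
          if r = s then s * (Fm S : BA M).coeff b else 0 := by
      rw [Fm_cons, mul_left_comm, coeff_pw_mul]
      simp only [hterm]
      rw [Finset.sum_add_distrib, ← Finset.mul_sum, ← coeff_pw_mul, ← Fm_cons]
      congr 1
      rw [← Finset.sum_filter, Finset.sum_const,
        card_lt hinj h0 (m := (s + S.sum : ℕ) - r) (by rw [hsum]) (by omega)]
      split_ifs <;> simp
    rw [hmain]
    by_cases hrs : r = s
    · subst hrs
      rw [if_pos rfl, Multiset.count_cons_self, Multiset.erase_cons_head]
      by_cases hm : r ∈ S
      · rw [Multiset.cons_erase hm]; push_cast; ring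
      · rw [Multiset.count_eq_zero_of_notMem hm]; push_cast; ring
    · rw [if_neg hrs, add_zero, Multiset.count_cons_of_ne hrs]
      rw [Multiset.erase_cons_tail _ (Ne.symm hrs)]

/-- The pairing for which the monomials form an orthonormal basis. -/
def pr (f g : BA M) : ℤ := f.coeff.sum fun b z => z * g.coeff b

lemma pr_single (v : Fin M → ℤ) (z : ℤ) (g : BA M) :
    pr (AddMonoidAlgebra.single v z) g = z * g.coeff v := by
  rw [pr, AddMonoidAlgebra.coeff_single, Finsupp.sum_single_index]
  simp

lemma pr_add (f f' g : BA M) : pr (f + f') g = pr f g + pr f' g := by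
  unfold pr
  rw [AddMonoidAlgebra.coeff_add, Finsupp.sum_add_index']
  · simp
  · intros; ring

lemma pr_zero (g : BA M) : pr 0 g = 0 := by
  simp [pr]

lemma pr_sum {ι : Type*} (s : Finset ι) (f : ι → BA M) (g : BA M) :
    pr (∑ i ∈ s, f i) g = ∑ i ∈ s, pr (f i) g := by
  classical
  induction s using Finset.induction_on with
  | empty => simp [pr_zero]
  | insert a s ha ih => rw [Finset.sum_insert ha, Finset.sum_insert ha, pr_add, ih]

lemma pr_pw_mul (r : ℤ) (f g : BA M) : pr (pw r * f) g = pr f (pw (-r) * g) := by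
  induction f using AddMonoidAlgebra.induction_linear with
  | zero => simp [pr_zero]
  | add f f' h h' => rw [mul_add, pr_add, pr_add, h, h']
  | single v z =>
    rw [pr_single, coeff_pw_mul, pw, Finset.sum_mul, pr_sum, Finset.mul_sum]
    refine Finset.sum_congr rfl fun i _ => ?_
    rw [AddMonoidAlgebra.single_mul_single, pr_single, one_mul, Pi.single_neg, sub_neg_eq_add,
      add_comm]

lemma pr_dl (g : BA M) : pr dl g =
    ∑ w : Equiv.Perm (Fin M), (Equiv.Perm.sign w : ℤ) * g.coeff (fun i => ((w i : ℕ) : ℤ)) := by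
  rw [dl, pr_sum]
  simp only [pr_single]

/-- The centralizer order attached to a multiset of cycle lengths. -/
def zz (R : Multiset ℕ) : ℕ := R.prod * ∏ n ∈ R.toFinset, (R.count n).factorial

lemma zz_zero : zz 0 = 1 := by simp [zz]

lemma zz_cons (r : ℕ) (R : Multiset ℕ) : zz (r ::ₘ R) = r * (R.count r + 1) * zz R := by
  have h1 : ∏ n ∈ (r ::ₘ R).toFinset, ((r ::ₘ R).count n).factorial =
      (R.count r + 1) * ∏ n ∈ R.toFinset, (R.count n).factorial := by
    have h2 : ∏ n ∈ R.toFinset, (R.count n).factorial =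
        ∏ n ∈ (r ::ₘ R).toFinset, (R.count n).factorial := by
      refine Finset.prod_subset ?_ ?_
      · intro n hn
        simp at hn ⊢
        exact Or.inr hn
      · intro n _ hn
        rw [Multiset.count_eq_zero_of_notMem (by simpa using hn), Nat.factorial_zero]
    have hr : r ∈ (r ::ₘ R).toFinset := by simp
    rw [h2, ← Finset.mul_prod_erase _ _ hr, ← Finset.mul_prod_erase _ _ hr,
      Multiset.count_cons_self, Nat.factorial_succ, mul_assoc]
    congr 2
    refine Finset.prod_congr rfl fun n hn => ?_
    rw [Multiset.count_cons_of_ne (Finset.ne_of_mem_erase hn)]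
  rw [zz, zz, h1, Multiset.prod_cons]
  ring

theorem pr_Fm (R S : Multiset ℕ) (hR : ∀ r ∈ R, 1 ≤ r) (hS : ∀ r ∈ S, 1 ≤ r)
    (hM : 2 * S.sum ≤ M) :
    pr (Fm R : BA M) (Fm S) = if R = S then (M.factorial * zz R : ℤ) else 0 := by
  induction R using Multiset.induction_on generalizing S with
  | empty =>
    rw [Fm_zero, pr_dl]
    split_ifs with h
    · subst h
      rw [Fm_zero, zz_zero]
      simp only [coeff_dl_perm]
      have : ∀ w : Equiv.Perm (Fin M),
          (Equiv.Perm.sign w : ℤ) * (Equiv.Perm.sign w : ℤ) = 1 := fun w => by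
        rcases Int.units_eq_one_or (Equiv.Perm.sign w) with h | h <;> rw [h] <;> rfl
      simp only [this]
      simp [Fintype.card_perm]
    · refine Finset.sum_eq_zero fun w _ => ?_
      refine mul_eq_zero_of_right _ ?_
      by_contra h1
      have h2 := (supp_Fm h1).2
      have h3 : ∑ i, (((w i : Fin M) : ℕ) : ℤ) = Z M :=
        Equiv.sum_comp w (fun i : Fin M => ((i : ℕ) : ℤ))
      rw [h3] at h2
      obtain ⟨s, hs⟩ := Multiset.exists_mem_of_ne_zero (Ne.symm h)
      have h4 := hS s hs
      have h5 := Multiset.le_sum_of_mem hs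
      omega
  | cons r R ih =>
    have hr := hR r (Multiset.mem_cons_self _ _)
    have h1 : pr (Fm (r ::ₘ R) : BA M) (Fm S) = r * S.count r * pr (Fm R : BA M) (Fm (S.erase r)) := by
      rw [Fm_cons, pr_pw_mul, pr, pr, Finsupp.mul_sum]
      refine Finsupp.sum_congr fun b hb => ?_
      rw [coeff_pw_neg_mul hr S hM (supp_Fm (Finsupp.mem_support_iff.1 hb)).1]
      ring
    rw [h1]
    by_cases hrS : r ∈ S
    · rw [ih _ (fun s hs => hR s (Multiset.mem_cons_of_mem hs))
        (fun s hs => hS s (Multiset.mem_of_mem_erase hs))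
        (by have := sum_erase_add hrS; omega)]
      have h2 : R = S.erase r ↔ r ::ₘ R = S := by
        constructor
        · rintro rfl
          exact Multiset.cons_erase hrS
        · rintro rfl
          rw [Multiset.erase_cons_head]
      rw [if_congr h2 rfl rfl]
      split_ifs with h
      · subst h
        rw [zz_cons, Multiset.count_cons_self]
        push_cast; ring
      · ring
    · rw [Multiset.count_eq_zero_of_notMem hrS, if_neg]
      · simp
      · rintro rfl
        exact hrS (Multiset.mem_cons_self _ _)

end BA
end Pairing

section Parts

open Equiv Equiv.Perm

/-- All points lie on the same cycle. -/
def FullCyc {α : Type} (c : Equiv.Perm α) : Prop := ∀ p q, c.SameCycle p q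

/-- A permutation preserving a predicate splits. -/
lemma permCongr_sumCompl {α : Type} (p : α → Prop) [DecidablePred p] (σ : Perm α)
    (h : ∀ a, p (σ a) ↔ p a) :
    (Equiv.sumCompl p).permCongr
      (Equiv.Perm.sumCongr (σ.subtypePerm h) (σ.subtypePerm fun a => not_congr (h a))) = σ := by
  ext a
  rw [Equiv.permCongr_apply]
  by_cases ha : p a
  · rw [Equiv.sumCompl_symm_apply_of_pos ha]
    simp
  · rw [Equiv.sumCompl_symm_apply_of_neg ha]
    simp

lemma FullCyc.permCongr {α β : Type} (e : α ≃ β) {c : Perm α} (h : FullCyc c) :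
    FullCyc (e.permCongr c) := by
  intro p q
  obtain ⟨i, hi⟩ := h (e.symm p) (e.symm q)
  refine ⟨i, ?_⟩
  have : (e.permCongr c) ^ i = e.permCongr (c ^ i) := (map_zpow e.permCongrHom c i).symm
  rw [this, Equiv.permCongr_apply, hi, Equiv.apply_symm_apply]

variable {α β : Type} [Fintype α] [DecidableEq α] [Fintype β] [DecidableEq β]

/-- The cycle type, fixed points included. -/
def pt (σ : Perm α) : Multiset ℕ := σ.partition.parts

lemma pt_eq (σ : Perm α) :
    pt σ = σ.cycleType + Multiset.replicate (Fintype.card α - σ.support.card) 1 :=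
  parts_partition

lemma pt_sum (σ : Perm α) : (pt σ).sum = Fintype.card α := σ.partition.parts_sum

lemma pt_pos (σ : Perm α) : ∀ r ∈ pt σ, 1 ≤ r := fun _ hr => σ.partition.parts_pos hr

lemma pt_eq_iff {σ τ : Perm α} : pt σ = pt τ ↔ IsConj σ τ := by
  rw [partition_eq_of_isConj]
  exact (Nat.Partition.ext_iff).symm

lemma pt_inv (σ : Perm α) : pt σ⁻¹ = pt σ := by
  rw [pt_eq, pt_eq, cycleType_inv, support_inv]

lemma pt_one : pt (1 : Perm α) = Multiset.replicate (Fintype.card α) 1 := by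
  rw [pt_eq]; simp

lemma cycleType_permCongr (e : α ≃ β) (σ : Perm α) : (e.permCongr σ).cycleType = σ.cycleType := by
  have := cycleType_extendDomain (p := fun _ : β => True) (g := σ)
    (e.trans (Equiv.subtypeUnivEquiv fun _ => trivial).symm)
  rw [← this]
  congr 1

lemma card_support_eq (σ : Perm α) : σ.support.card = σ.cycleType.sum := (sum_cycleType σ).symm

lemma pt_permCongr (e : α ≃ β) (σ : Perm α) : pt (e.permCongr σ) = pt σ := by
  rw [pt_eq, pt_eq, card_support_eq, card_support_eq, cycleType_permCongr, Fintype.card_congr e]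

lemma cycleType_sumCongr (c : Perm α) (y : Perm β) :
    (Equiv.Perm.sumCongr c y).cycleType = c.cycleType + y.cycleType := by
  classical
  have h1 : (Equiv.Perm.sumCongr c (1 : Perm β)).cycleType = c.cycleType := by
    have := cycleType_extendDomain (p := fun s : α ⊕ β => s ∈ Set.range Sum.inl) (g := c)
      (Equiv.ofInjective _ Sum.inl_injective)
    rw [← this]
    congr 1
    ext s
    rcases s with a | b
    · exact (extendDomain_apply_image c (Equiv.ofInjective (Sum.inl : α → α ⊕ β) Sum.inl_injective)
        a).symm
    · rw [extendDomain_apply_not_subtype _ _ (by simp)]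
      rfl
  have h2 : (Equiv.Perm.sumCongr (1 : Perm α) y).cycleType = y.cycleType := by
    have := cycleType_extendDomain (p := fun s : α ⊕ β => s ∈ Set.range Sum.inr) (g := y)
      (Equiv.ofInjective _ Sum.inr_injective)
    rw [← this]
    congr 1
    ext s
    rcases s with a | b
    · rw [extendDomain_apply_not_subtype _ _ (by simp)]
      rfl
    · exact (extendDomain_apply_image y (Equiv.ofInjective (Sum.inr : β → α ⊕ β) Sum.inr_injective)
        b).symm
  have h3 : Equiv.Perm.sumCongr c y = Equiv.Perm.sumCongr c (1 : Perm β) * Equiv.Perm.sumCongr (1 : Perm α) y := by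
    rw [sumCongr_mul, mul_one, one_mul]
  rw [h3, Disjoint.cycleType_mul, h1, h2]
  rintro (a | b)
  · exact Or.inr rfl
  · exact Or.inl rfl

lemma pt_sumCongr (c : Perm α) (y : Perm β) : pt (Equiv.Perm.sumCongr c y) = pt c + pt y := by
  have h1 := card_support_eq c ▸ c.support.card_le_univ
  have h2 := card_support_eq y ▸ y.support.card_le_univ
  rw [pt_eq, pt_eq, pt_eq, card_support_eq, card_support_eq, card_support_eq, cycleType_sumCongr,
    Multiset.sum_add, Fintype.card_sum,
    show Fintype.card α + Fintype.card β - (c.cycleType.sum + y.cycleType.sum) =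
      (Fintype.card α - c.cycleType.sum) + (Fintype.card β - y.cycleType.sum) by omega,
    Multiset.replicate_add]
  abel

lemma FullCyc.pt [Nonempty α] {c : Perm α} (h : FullCyc c) : pt c = {Fintype.card α} := by
  rcases subsingleton_or_nontrivial α with hs | hn
  · have : c = 1 := Subsingleton.elim _ _
    rw [this, pt_one, Fintype.card_eq_one_iff_nonempty_unique.2 ⟨⟨⟨Classical.arbitrary α⟩, fun _ => Subsingleton.elim _ _⟩⟩]
    rfl
  · have hfix : ∀ a, c a ≠ a := by
      intro a ha
      obtain ⟨b, hb⟩ := exists_ne a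
      exact hb ((h a b).eq_of_left ha).symm
    have hc : c.IsCycle := ⟨Classical.arbitrary α, hfix _, fun b _ => h _ b⟩
    have hs : c.support = Finset.univ := by
      ext a; simpa using hfix a
    rw [pt_eq, hc.cycleType, hs]
    simp

lemma fullCyc_of_cycleType {c : Perm α} (h : c.cycleType = {Fintype.card α}) : FullCyc c := by
  have hc : c.IsCycle := by rw [← card_cycleType_eq_one, h]; rfl
  have hs : c.support = Finset.univ := by
    apply Finset.eq_univ_of_card
    rw [card_support_eq, h, Multiset.sum_singleton]
  intro p q
  exact hc.sameCycle (by rw [← mem_support, hs]; exact Finset.mem_univ _)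
    (by rw [← mem_support, hs]; exact Finset.mem_univ _)

open BA in
lemma zz_add_replicate_one {S : Multiset ℕ} (hS : 1 ∉ S) (n : ℕ) :
    zz (S + Multiset.replicate n 1) = zz S * n.factorial := by
  induction n with
  | zero => simp
  | succ n ih =>
    rw [Multiset.replicate_succ, Multiset.add_cons, zz_cons, ih, Nat.factorial_succ,
      Multiset.count_add, Multiset.count_replicate_self, Multiset.count_eq_zero_of_notMem hS]
    ring

open Classical in
theorem card_conj_eq (g h : Perm α) :
    (Finset.univ.filter fun a => a * h * a⁻¹ = g).card = if pt g = pt h then BA.zz (pt g) else 0 := by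
  split_ifs with hgh
  · obtain ⟨t, ht⟩ := isConj_iff.1 (pt_eq_iff.1 hgh.symm)
    have h1 : (Finset.univ.filter fun a => a * h * a⁻¹ = g).card =
        Nat.card (Subgroup.centralizer {g}) := by
      rw [Nat.card_eq_fintype_card, Fintype.card_subtype]
      refine Finset.card_bij (fun a _ => a * t⁻¹) ?_ ?_ ?_
      · intro a ha
        rw [Finset.mem_filter] at ha ⊢
        refine ⟨Finset.mem_univ _, ?_⟩
        rw [Subgroup.mem_centralizer_singleton_iff]
        rw [← mul_inv_eq_iff_eq_mul]
        have : h = t⁻¹ * g * t := by rw [← ht]; group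
        conv_rhs => rw [← ha.2, this]
        group
      · intro a _ b _ hab
        exact mul_right_cancel hab
      · intro b hb
        refine ⟨b * t, ?_, by group⟩
        rw [Finset.mem_filter] at hb ⊢
        refine ⟨Finset.mem_univ _, ?_⟩
        have h2 := Subgroup.mem_centralizer_singleton_iff.1 hb.2
        calc b * t * h * (b * t)⁻¹ = b * (t * h * t⁻¹) * b⁻¹ := by group
          _ = g := by rw [ht, h2]; group
    rw [h1, nat_card_centralizer, pt_eq, zz_add_replicate_one, card_support_eq, BA.zz]
    · ring
    · intro h2
      exact absurd (two_le_of_mem_cycleType h2) (by norm_num)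
  · rw [Finset.card_eq_zero, Finset.filter_eq_empty_iff]
    intro a _ ha
    exact hgh (pt_eq_iff.2 (isConj_iff.2 ⟨a, ha⟩)).symm

end Parts

section Content

open Equiv

variable {M : ℕ}

/-- The content of a map to `Fin M`. -/
def ctt {α : Type} [Fintype α] (f : α → Fin M) : Fin M → ℤ := ∑ a, Pi.single (f a) (1 : ℤ)

/-- The generating function of the maps fixed by a permutation. -/
def PP (M : ℕ) {α : Type} [Fintype α] [DecidableEq α] (σ : Perm α) : BA M :=
  ∑ f : α → Fin M, if ∀ a, f (σ a) = f a then AddMonoidAlgebra.single (ctt f) 1 else 0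

lemma PP_permCongr {α β : Type} [Fintype α] [DecidableEq α] [Fintype β] [DecidableEq β] (e : α ≃ β) (σ : Perm α) :
    PP M (e.permCongr σ) = PP M σ := by
  classical
  unfold PP
  rw [← Equiv.sum_comp (e.arrowCongr (Equiv.refl (Fin M)))]
  refine Finset.sum_congr rfl fun f _ => ?_
  have h1 : ctt (e.arrowCongr (Equiv.refl (Fin M)) f) = ctt f := by
    unfold ctt
    rw [← Equiv.sum_comp e]
    simp [Equiv.arrowCongr_apply]
  rw [h1]
  congr 1
  refine propext ⟨fun h a => ?_, fun h b => ?_⟩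
  · simpa [Equiv.arrowCongr_apply, Equiv.permCongr_apply] using h (e a)
  · simpa [Equiv.arrowCongr_apply, Equiv.permCongr_apply] using h (e.symm b)

lemma PP_sumCongr {α β : Type} [Fintype α] [DecidableEq α] [Fintype β] [DecidableEq β] (c : Perm α) (y : Perm β) :
    PP M (Equiv.Perm.sumCongr c y) = PP M c * PP M y := by
  classical
  unfold PP
  rw [Finset.sum_mul_sum, ← Equiv.sum_comp (Equiv.sumArrowEquivProdArrow α β (Fin M)).symm,
    Fintype.sum_prod_type]
  refine Finset.sum_congr rfl fun f _ => Finset.sum_congr rfl fun f' _ => ?_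
  have h1 : ctt ((Equiv.sumArrowEquivProdArrow α β (Fin M)).symm (f, f')) = ctt f + ctt f' := by
    unfold ctt
    rw [Fintype.sum_sum_type]
    rfl
  have h2 : (∀ a, (Equiv.sumArrowEquivProdArrow α β (Fin M)).symm (f, f') (Equiv.Perm.sumCongr c y a) =
      (Equiv.sumArrowEquivProdArrow α β (Fin M)).symm (f, f') a) ↔
      (∀ a, f (c a) = f a) ∧ ∀ a, f' (y a) = f' a := by
    rw [Sum.forall]
    rfl
  rw [h1, if_congr h2 rfl rfl]
  by_cases hf : ∀ a, f (c a) = f a <;> by_cases hf' : ∀ a, f' (y a) = f' a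
  · rw [if_pos ⟨hf, hf'⟩, if_pos hf, if_pos hf', AddMonoidAlgebra.single_mul_single, one_mul]
  · rw [if_neg (fun h => hf' h.2), if_neg hf', mul_zero]
  · rw [if_neg (fun h => hf h.1), if_neg hf, zero_mul]
  · rw [if_neg (fun h => hf h.1), if_neg hf, zero_mul]

lemma PP_fullCyc {α : Type} [Fintype α] [DecidableEq α] [Nonempty α] {c : Perm α} (h : FullCyc c) :
    PP M c = BA.pw (Fintype.card α) := by
  classical
  unfold PP BA.pw
  rw [← Finset.sum_filter]
  symm
  refine Finset.sum_bij (fun i _ => fun _ => i) ?_ ?_ ?_ ?_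
  · intro i _
    simp
  · intro i _ j _ hij
    exact congrFun hij (Classical.arbitrary α)
  · intro f hf
    rw [Finset.mem_filter] at hf
    refine ⟨f (Classical.arbitrary α), Finset.mem_univ _, ?_⟩
    funext a
    obtain ⟨n, -, hn⟩ := (h (Classical.arbitrary α) a).exists_pow_eq'
    rw [← hn]
    have : ∀ (n : ℕ) (b : α), f ((c ^ n) b) = f b := by
      intro n
      induction n with
      | zero => intro b; rfl
      | succ n ih => intro b; rw [pow_succ', Equiv.Perm.mul_apply, hf.2, ih]
    exact (this n _).symm
  · intro i _
    congr 1
    unfold ctt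
    rw [Finset.sum_const, Finset.card_univ, ← Pi.single_smul]
    simp

lemma PP_eq {α : Type} [Fintype α] [DecidableEq α] (σ : Perm α) :
    PP M σ = ((pt σ).map fun r : ℕ => BA.pw (r : ℤ)).prod := by
  classical
  induction hn : Fintype.card α using Nat.strong_induction_on generalizing α with
  | _ n ih =>
  rcases isEmpty_or_nonempty α with he | ⟨⟨a⟩⟩
  · have h1 : σ = 1 := Subsingleton.elim _ _
    have h2 : pt σ = 0 := by rw [h1, pt_one, Fintype.card_eq_zero]; rfl
    rw [h2]
    simp only [PP, Multiset.map_zero, Multiset.prod_zero]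
    rw [Fintype.sum_unique, if_pos (fun a => he.elim a)]
    have : ctt (default : α → Fin M) = 0 := by unfold ctt; simp
    rw [this]; rfl
  · have hp : ∀ b, σ.SameCycle a (σ b) ↔ σ.SameCycle a b := fun b =>
      Equiv.Perm.sameCycle_apply_right
    have h0 := permCongr_sumCompl (fun b => σ.SameCycle a b) σ hp
    have hfull : FullCyc (σ.subtypePerm hp) := by
      rintro ⟨p, hp'⟩ ⟨q, hq⟩
      obtain ⟨i, hi⟩ := hp'.symm.trans hq
      refine ⟨i, Subtype.ext ?_⟩
      rw [Equiv.Perm.subtypePerm_zpow]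
      exact hi
    have : Nonempty {b // σ.SameCycle a b} := ⟨⟨a, Equiv.Perm.SameCycle.refl _ _⟩⟩
    have hlt : Fintype.card {b // ¬ σ.SameCycle a b} < n := by
      rw [← hn]
      exact Fintype.card_subtype_lt (x := a) (not_not.2 (Equiv.Perm.SameCycle.refl _ _))
    rw [← h0, PP_permCongr, pt_permCongr, PP_sumCongr, pt_sumCongr, hfull.pt, PP_fullCyc hfull,
      ih _ hlt _ rfl]
    simp

lemma Fm_pt {α : Type} [Fintype α] [DecidableEq α] (σ : Perm α) :
    (BA.Fm (pt σ) : BA M) = PP M σ * BA.dl := by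
  rw [PP_eq, BA.Fm]

lemma coeff_PP {α : Type} [Fintype α] [DecidableEq α] (σ : Perm α) (v : Fin M → ℤ) :
    (PP M σ).coeff v = ((Finset.univ.filter fun f : {f : α → Fin M // ctt f = v} =>
      ∀ a, f.1 (σ a) = f.1 a).card : ℤ) := by
  simp only [PP, AddMonoidAlgebra.coeff_sum, Finset.sum_apply']
  rw [Finset.card_filter, Nat.cast_sum,
    ← Finset.sum_subtype (Finset.univ.filter fun f : α → Fin M => ctt f = v) (by simp)
      (fun f => (((if ∀ a, f (σ a) = f a then 1 else 0 : ℕ)) : ℤ)), Finset.sum_filter]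
  refine Finset.sum_congr rfl fun f _ => ?_
  by_cases h : ∀ a, f (σ a) = f a
  · rw [if_pos h, if_pos h, AddMonoidAlgebra.coeff_single, Finsupp.single_apply]
    simp
  · rw [if_neg h, if_neg h]
    simp

lemma coeff_mul_dl (f : BA M) (b : Fin M → ℤ) :
    (f * BA.dl).coeff b = ∑ w : Perm (Fin M), (Perm.sign w : ℤ) *
      f.coeff (b - fun i => ((w i : ℕ) : ℤ)) := by
  rw [mul_comm, BA.dl, Finset.sum_mul, AddMonoidAlgebra.coeff_sum, Finset.sum_apply']
  refine Finset.sum_congr rfl fun w _ => ?_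
  rw [AddMonoidAlgebra.coeff_single_mul_eq_mul_coeff (b - fun i => ((w i : ℕ) : ℤ))]
  intro m _
  rw [eq_sub_iff_add_eq, add_comm]

open Classical in
/-- Permutation characters. -/
lemma isCh_perm {G X : Type} [Group G] [Fintype X] (φ : G →* Perm X) :
    IsCh fun g => ((Finset.univ.filter fun x => φ g x = x).card : ℂ) := by
  have := isCh_matrix (Matrix.permMatrixHom (n := X) (R := ℂ) |>.comp φ)
  convert this using 2 with g
  simp only [MonoidHom.comp_apply, Matrix.permMatrixHom_apply, Matrix.trace_permutation,
    Function.fixedPoints, Function.IsFixedPt]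
  rw [Set.ncard_eq_toFinset_card']
  congr 2
  ext x
  rw [Finset.mem_filter_univ, Set.mem_toFinset]
  exact ⟨fun h => by rw [Set.mem_ofPred, Equiv.Perm.inv_eq_iff_eq, h],
    fun h => by rw [Set.mem_ofPred, Equiv.Perm.inv_eq_iff_eq] at h; exact h.symm⟩

lemma isCh_content {α : Type} [Fintype α] [DecidableEq α] (v : Fin M → ℤ) :
    IsCh fun σ : Perm α => ((Finset.univ.filter fun f : {f : α → Fin M // ctt f = v} =>
      ∀ a, f.1 (σ a) = f.1 a).card : ℂ) := by
  have hct : ∀ (σ : Perm α) (f : α → Fin M), ctt (f ∘ σ) = ctt f := fun σ f =>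
    Equiv.sum_comp σ (fun a => (Pi.single (f a) (1 : ℤ) : Fin M → ℤ))
  let φ : Perm α →* Perm {f : α → Fin M // ctt f = v} := 
    { toFun := fun σ => 
        { toFun := fun f => ⟨f.1 ∘ ⇑σ⁻¹, (hct _ _).trans f.2⟩
          invFun := fun f => ⟨f.1 ∘ σ, (hct _ _).trans f.2⟩
          left_inv := fun f => by ext a; simp
          right_inv := fun f => by ext a; simp }
      map_one' := by ext f a; rfl
      map_mul' := fun σ τ => by ext f a; simp }
  convert isCh_perm φ using 5 with σ f
  rw [Subtype.ext_iff]
  constructor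
  · intro h
    funext a
    have := h (σ⁻¹ a)
    rw [show σ (σ⁻¹ a) = a from σ.apply_symm_apply a] at this
    exact this.symm
  · intro h a
    have := congrFun h (σ a)
    simpa [φ] using this.symm

end Content

section BeadChar

open Equiv

variable {M : ℕ} {α : Type} [Fintype α] [DecidableEq α]

/-- The class function attached to an exponent. -/
def Fv (b : Fin M → ℤ) (σ : Perm α) : ℂ := ((BA.Fm (pt σ) : BA M).coeff b : ℂ)

lemma Fv_eq_of_pt {b : Fin M → ℤ} {σ τ : Perm α} (h : pt σ = pt τ) : Fv b σ = Fv b τ := by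
  rw [Fv, Fv, h]

lemma Fv_conj (b : Fin M → ℤ) (σ τ : Perm α) : Fv b (τ * σ * τ⁻¹) = Fv b σ :=
  Fv_eq_of_pt (pt_eq_iff.2 (isConj_iff.2 ⟨τ⁻¹, by group⟩))

lemma cip_Fv (b : Fin M → ℤ) {χ : Perm α → ℂ} (hχ : IsCh χ) :
    ∃ m : ℤ, cip (Fv b) χ = m * Fintype.card (Perm α) := by
  choose n hn using fun w : Perm (Fin M) =>
    cip_isCh (isCh_content (α := α) (b - fun i => ((w i : ℕ) : ℤ))) hχ
  refine ⟨∑ w, (Perm.sign w : ℤ) * n w, ?_⟩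
  push_cast
  rw [Finset.sum_mul]
  simp only [mul_assoc, ← hn]
  unfold cip
  simp only [Finset.mul_sum]
  rw [Finset.sum_comm]
  refine Finset.sum_congr rfl fun σ _ => ?_
  rw [Fv, Fm_pt, coeff_mul_dl, Int.cast_sum, Finset.sum_mul]
  refine Finset.sum_congr rfl fun w _ => ?_
  rw [coeff_PP]
  push_cast
  ring

/-- The multiplicity of an irreducible character in the class function of an exponent. -/
def mm (b : Fin M → ℤ) (χ : Irr (Perm α)) : ℤ := (cip_Fv b (Irr.isCh χ.2)).choose

lemma mm_spec (b : Fin M → ℤ) (χ : Irr (Perm α)) :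
    cip (Fv b) χ.1 = mm b χ * Fintype.card (Perm α) := (cip_Fv b (Irr.isCh χ.2)).choose_spec

lemma card_perm_ne : (Fintype.card (Perm α) : ℂ) ≠ 0 := by
  exact_mod_cast Fintype.card_ne_zero

lemma Fv_expand (b : Fin M → ℤ) (σ : Perm α) : Fv b σ = ∑ χ : Irr (Perm α), mm b χ * χ.1 σ := by
  have := classFun_expand (Fv b) (fun g k => Fv_conj b g k) σ
  simp only [mm_spec] at this
  apply mul_left_cancel₀ (card_perm_ne (α := α))
  rw [this, Finset.mul_sum]
  exact Finset.sum_congr rfl fun χ _ => by ring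

lemma IsCh.perm_inv {χ : Perm α → ℂ} (h : IsCh χ) (σ : Perm α) : χ σ⁻¹ = χ σ :=
  h.isConj (pt_eq_iff.1 (pt_inv σ))

/-- The exponents with a nonzero class function. -/
def suppF (M : ℕ) (α : Type) [Fintype α] [DecidableEq α] : Finset (Fin M → ℤ) :=
  Finset.univ.biUnion fun σ : Perm α => (BA.Fm (pt σ) : BA M).coeff.support

lemma mem_suppF {b : Fin M → ℤ} : b ∈ suppF M α ↔ ∃ σ : Perm α, Fv b σ ≠ 0 := by
  simp [suppF, Fv]

lemma sum_Fv_mul (hM : 2 * Fintype.card α ≤ M) (σ τ : Perm α) :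
    ∑ b ∈ suppF M α, Fv b σ * Fv b τ =
      if pt σ = pt τ then (M.factorial * BA.zz (pt σ) : ℂ) else 0 := by
  have h := BA.pr_Fm (M := M) (pt σ) (pt τ) (pt_pos σ) (pt_pos τ) (by rw [pt_sum]; exact hM)
  have h2 : BA.pr (BA.Fm (pt σ) : BA M) (BA.Fm (pt τ)) = ∑ b ∈ suppF M α,
      (BA.Fm (pt σ) : BA M).coeff b * (BA.Fm (pt τ) : BA M).coeff b :=
    Finset.sum_subset (fun b hb => Finset.mem_biUnion.2 ⟨σ, Finset.mem_univ _, hb⟩)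
      (fun b _ hb => by beta_reduce; rw [Finsupp.notMem_support_iff.1 hb, zero_mul])
  have h3 := congrArg (Int.cast : ℤ → ℂ) (h2.symm.trans h)
  push_cast at h3
  exact h3

lemma sum_mm_mul (hM : 2 * Fintype.card α ≤ M) (χ ψ : Irr (Perm α)) :
    ∑ b ∈ suppF M α, mm b χ * mm b ψ = if χ = ψ then (M.factorial : ℤ) else 0 := by
  classical
  have key : (∑ b ∈ suppF M α, (mm b χ * mm b ψ : ℂ)) *
      (Fintype.card (Perm α) * Fintype.card (Perm α)) =
      M.factorial * (Fintype.card (Perm α) * cip χ.1 ψ.1) := by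
    calc _ = ∑ b ∈ suppF M α, cip (Fv b) χ.1 * cip (Fv b) ψ.1 := by
          rw [Finset.sum_mul]
          exact Finset.sum_congr rfl fun b _ => by rw [mm_spec, mm_spec]; ring
      _ = ∑ σ : Perm α, ∑ τ : Perm α, (∑ b ∈ suppF M α, Fv b σ * Fv b τ) * (χ.1 σ * ψ.1 τ) := by
          simp only [cip, Finset.sum_mul_sum, (Irr.isCh χ.2).perm_inv, (Irr.isCh ψ.2).perm_inv]
          rw [Finset.sum_comm]
          refine Finset.sum_congr rfl fun σ _ => ?_
          rw [Finset.sum_comm]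
          refine Finset.sum_congr rfl fun τ _ => ?_
          rw [Finset.sum_mul]
          exact Finset.sum_congr rfl fun b _ => by ring
      _ = ∑ σ : Perm α, ∑ τ : Perm α, ∑ a : Perm α,
            if a * τ * a⁻¹ = σ then M.factorial * (χ.1 σ * ψ.1 τ) else 0 := by
          refine Finset.sum_congr rfl fun σ _ => Finset.sum_congr rfl fun τ _ => ?_
          rw [sum_Fv_mul hM, ← Finset.sum_filter, Finset.sum_const, nsmul_eq_mul, card_conj_eq]
          split_ifs <;> push_cast <;> ring
      _ = ∑ σ : Perm α, ∑ a : Perm α, M.factorial * (χ.1 σ * ψ.1 σ) := by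
          refine Finset.sum_congr rfl fun σ _ => ?_
          rw [Finset.sum_comm]
          refine Finset.sum_congr rfl fun a _ => ?_
          rw [Finset.sum_eq_single (a⁻¹ * σ * a)]
          · rw [if_pos (by group)]
            have := (Irr.isCh ψ.2).conj σ a⁻¹
            rw [inv_inv] at this
            rw [this]
          · intro τ _ hτ
            rw [if_neg]
            rintro rfl
            exact hτ (by group)
          · simp
      _ = _ := by
          simp only [Finset.sum_const, nsmul_eq_mul, cip, (Irr.isCh ψ.2).perm_inv, Finset.card_univ,
            Finset.mul_sum]
          exact Finset.sum_congr rfl fun σ _ => by ring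
  rw [cip_irr χ.2 ψ.2] at key
  have h0 := card_perm_ne (α := α)
  have : (∑ b ∈ suppF M α, (mm b χ * mm b ψ : ℂ)) = if χ = ψ then (M.factorial : ℂ) else 0 := by
    apply mul_right_cancel₀ (mul_ne_zero h0 h0)
    rw [key]
    simp only [Subtype.ext_iff]
    split_ifs <;> ring
  exact_mod_cast this

lemma Fv_comp (b : Fin M → ℤ) (w : Perm (Fin M)) (σ : Perm α) :
    Fv (b ∘ w) σ = (Perm.sign w : ℤ) * Fv b σ := by
  rw [Fv, BA.alt_Fm, Fv]
  push_cast
  rfl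

lemma mm_comp (b : Fin M → ℤ) (w : Perm (Fin M)) (χ : Irr (Perm α)) :
    mm (b ∘ w) χ = (Perm.sign w : ℤ) * mm b χ := by
  have h := mm_spec (b ∘ w) χ
  have h2 : cip (Fv (b ∘ w)) χ.1 = (Perm.sign w : ℤ) * cip (Fv b) χ.1 := by
    simp only [cip, Fv_comp, Finset.mul_sum]
    exact Finset.sum_congr rfl fun σ _ => by ring
  rw [h2, mm_spec, ← mul_assoc] at h
  exact_mod_cast (mul_right_cancel₀ card_perm_ne h).symm

lemma Fv_injective {b : Fin M → ℤ} {σ : Perm α} (h : Fv b σ ≠ 0) : Function.Injective b :=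
  (BA.alt_Fm (pt σ)).injective (fun h0 => h (by rw [Fv, h0, Int.cast_zero]))

lemma exists_Fv_ne {b : Fin M → ℤ} {χ : Irr (Perm α)} (h : mm b χ ≠ 0) :
    ∃ σ : Perm α, Fv b σ ≠ 0 := by
  by_contra! h0
  have := mm_spec b χ
  simp only [cip, h0, zero_mul, Finset.sum_const_zero] at this
  rcases mul_eq_zero.1 this.symm with h1 | h1
  · exact h (by exact_mod_cast h1)
  · exact card_perm_ne h1

lemma mm_main (hM : 2 * Fintype.card α ≤ M) {b : Fin M → ℤ} {χ : Irr (Perm α)}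
    (h : mm b χ ≠ 0) : (mm b χ = 1 ∨ mm b χ = -1) ∧ (∀ ψ, ψ ≠ χ → mm b ψ = 0) ∧
      ∀ b', mm b' χ ≠ 0 → ∃ w : Perm (Fin M), b' = b ∘ w := by
  classical
  obtain ⟨σ, hσ⟩ := exists_Fv_ne h
  have hinj := Fv_injective hσ
  have hcomp : Function.Injective fun w : Perm (Fin M) => b ∘ w := fun w w' hw =>
    Equiv.ext fun i => hinj (congrFun hw i)
  let O : Finset (Fin M → ℤ) := Finset.univ.image fun w : Perm (Fin M) => b ∘ w
  have hO : O ⊆ suppF M α := by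
    intro b' hb'
    obtain ⟨w, -, rfl⟩ := Finset.mem_image.1 hb'
    refine mem_suppF.2 ⟨σ, ?_⟩
    rw [Fv_comp]
    exact mul_ne_zero (by exact_mod_cast (Perm.sign w).isUnit.ne_zero) hσ
  have hs : ∀ w : Perm (Fin M), ((Perm.sign w : ℤ)) * (Perm.sign w : ℤ) = 1 := fun w => by
    rcases Int.units_eq_one_or (Perm.sign w) with h | h <;> rw [h] <;> rfl
  have hsum : ∀ ψ : Irr (Perm α), ∑ b' ∈ O, mm b' χ * mm b' ψ = M.factorial * (mm b χ * mm b ψ) := by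
    intro ψ
    rw [Finset.sum_image fun _ _ _ _ h => hcomp h]
    have : ∀ w : Perm (Fin M), mm (b ∘ w) χ * mm (b ∘ w) ψ = mm b χ * mm b ψ := fun w => by
      rw [mm_comp, mm_comp]
      linear_combination (mm b χ * mm b ψ) * hs w
    simp only [this, Finset.sum_const, Finset.card_univ, Fintype.card_perm, Fintype.card_fin,
      nsmul_eq_mul]
  have htot := sum_mm_mul hM χ χ
  rw [if_pos rfl] at htot
  rw [← Finset.sum_sdiff hO, hsum] at htot
  have hnn : ∀ b' ∈ suppF M α \ O, 0 ≤ mm b' χ * mm b' χ := fun b' _ => mul_self_nonneg _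
  have hnn2 := Finset.sum_nonneg hnn
  have hfac : (0 : ℤ) < M.factorial := by exact_mod_cast M.factorial_pos
  have h1 : 1 ≤ mm b χ * mm b χ := by
    have := mul_self_pos.2 h
    omega
  have hle : mm b χ * mm b χ ≤ 1 := by
    by_contra! h2
    nlinarith
  have heq : mm b χ * mm b χ = 1 := le_antisymm hle h1
  have hrest : ∀ b' ∈ suppF M α \ O, mm b' χ = 0 := by
    intro b' hb'
    rw [heq, mul_one] at htot
    exact mul_self_eq_zero.1 ((Finset.sum_eq_zero_iff_of_nonneg hnn).1 (by omega) b' hb')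
  refine ⟨mul_self_eq_one_iff.1 heq, fun ψ hψ => ?_, fun b' hb' => ?_⟩
  · have h3 := sum_mm_mul hM χ ψ
    rw [if_neg hψ.symm, ← Finset.sum_sdiff hO, hsum,
      Finset.sum_eq_zero fun b' hb' => by rw [hrest b' hb', zero_mul], zero_add] at h3
    rcases mul_eq_zero.1 h3 with h4 | h4
    · omega
    · exact (mul_eq_zero.1 h4).resolve_left h
  · have : b' ∈ O := by
      by_contra h3
      exact hb' (hrest b' (Finset.mem_sdiff.2 ⟨mem_suppF.2 (exists_Fv_ne hb'), h3⟩))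
    obtain ⟨w, -, rfl⟩ := Finset.mem_image.1 this
    exact ⟨w, rfl⟩

lemma Fv_eq_mm (hM : 2 * Fintype.card α ≤ M) {b : Fin M → ℤ} {χ : Irr (Perm α)}
    (h : mm b χ ≠ 0) (σ : Perm α) : Fv b σ = mm b χ * χ.1 σ := by
  classical
  rw [Fv_expand, Finset.sum_eq_single χ]
  · intro ψ _ hψ
    rw [(mm_main hM h).2.1 ψ hψ, Int.cast_zero, zero_mul]
  · simp

lemma exists_bead (hM : 2 * Fintype.card α ≤ M) (h2 : 2 ≤ M) {χ : Perm α → ℂ}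
    (hχ : χ ∈ Irr (Perm α)) : ∃ b : Fin M → ℤ, Fv b = χ := by
  have h1 : ∃ b : Fin M → ℤ, mm b ⟨χ, hχ⟩ ≠ 0 := by
    by_contra! h0
    have := sum_mm_mul hM ⟨χ, hχ⟩ ⟨χ, hχ⟩
    simp only [h0, if_true, mul_zero, Finset.sum_const_zero] at this
    have h3 : (0 : ℤ) < M.factorial := by exact_mod_cast M.factorial_pos
    omega
  obtain ⟨b, hb⟩ := h1
  rcases (mm_main hM hb).1 with h3 | h3
  · refine ⟨b, funext fun τ => ?_⟩
    rw [Fv_eq_mm hM hb, h3, Int.cast_one, one_mul]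
  · refine ⟨b ∘ swap ⟨0, by omega⟩ ⟨1, by omega⟩, funext fun τ => ?_⟩
    rw [Fv_comp, Perm.sign_swap (by simp), Fv_eq_mm hM hb, h3]
    simp

/-- Column orthogonality. -/
lemma sum_irr_perm (σ τ : Perm α) : ∑ χ : Irr (Perm α), χ.1 σ * χ.1 τ =
    if pt σ = pt τ then (BA.zz (pt σ) : ℂ) else 0 := by
  classical
  have h := sum_irr_mul_inv σ τ
  have h2 := card_conj_eq σ τ
  have h3 : ∑ χ : Irr (Perm α), χ.1 σ * χ.1 τ⁻¹ = ∑ χ : Irr (Perm α), χ.1 σ * χ.1 τ :=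
    Finset.sum_congr rfl fun χ _ => by rw [(Irr.isCh χ.2).perm_inv]
  rw [← h3, h]
  refine Eq.trans ?_ ((congrArg (Nat.cast : ℕ → ℂ) h2).trans ?_)
  · congr!
  · split_ifs <;> simp

end BeadChar

section Parity

open Equiv

variable {M : ℕ} {α : Type} [Fintype α] [DecidableEq α]

namespace BA

lemma two_dvd_sum_sq {ι R : Type} [CommRing R] [DecidableEq ι] (s : Finset ι) (f : ι → R) :
    (2 : R) ∣ (∑ i ∈ s, f i) ^ 2 - ∑ i ∈ s, f i ^ 2 := by
  induction s using Finset.induction_on with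
  | empty => simp
  | insert a s ha ih =>
    rw [Finset.sum_insert ha, Finset.sum_insert ha]
    obtain ⟨c, hc⟩ := ih
    exact ⟨c + f a * ∑ i ∈ s, f i, by linear_combination hc⟩

lemma two_dvd_pw_sq (r : ℤ) : (2 : BA M) ∣ pw r ^ 2 - pw (2 * r) := by
  have h := two_dvd_sum_sq Finset.univ
    (fun i : Fin M => (AddMonoidAlgebra.single (Pi.single i r) (1 : ℤ) : BA M))
  have h2 : ∀ i : Fin M, (AddMonoidAlgebra.single (Pi.single i r) (1 : ℤ) : BA M) ^ 2 =
      AddMonoidAlgebra.single (Pi.single i (2 * r)) 1 := fun i => by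
    rw [sq, AddMonoidAlgebra.single_mul_single, one_mul, ← Pi.single_add, two_mul]
  simp only [h2] at h
  exact h

lemma two_dvd_pw_pow (j : ℕ) : (2 : BA M) ∣ pw ((2 ^ j : ℕ) : ℤ) - pw 1 ^ (2 ^ j) := by
  induction j with
  | zero => simp
  | succ j ih =>
    have h1 := two_dvd_pw_sq (M := M) ((2 ^ j : ℕ) : ℤ)
    obtain ⟨c, hc⟩ := h1
    obtain ⟨d, hd⟩ := ih
    rw [show ((2 ^ (j + 1) : ℕ) : ℤ) = 2 * ((2 ^ j : ℕ) : ℤ) by push_cast; ring,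
      pow_succ 2 j, pow_mul]
    refine ⟨-c + d * (pw ((2 ^ j : ℕ) : ℤ) + pw 1 ^ 2 ^ j), ?_⟩
    linear_combination -hc + hd * (pw ((2 ^ j : ℕ) : ℤ) + pw 1 ^ 2 ^ j)

lemma Fm_replicate (n : ℕ) : (Fm (Multiset.replicate n 1) : BA M) = pw 1 ^ n * dl := by
  simp [Fm]

lemma two_dvd_Fm {S : Multiset ℕ} (hS : ∀ r ∈ S, ∃ j, r = 2 ^ j) :
    (2 : BA M) ∣ Fm S - Fm (Multiset.replicate S.sum 1) := by
  have h : (2 : BA M) ∣ (S.map fun r : ℕ => (pw (r : ℤ) : BA M)).prod - pw 1 ^ S.sum := by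
    induction S using Multiset.induction_on with
    | empty => simp
    | cons r S ih =>
      obtain ⟨c, hc⟩ := ih fun s hs => hS s (Multiset.mem_cons_of_mem hs)
      obtain ⟨j, rfl⟩ := hS r (Multiset.mem_cons_self _ _)
      obtain ⟨d, hd⟩ := two_dvd_pw_pow (M := M) j
      rw [Multiset.map_cons, Multiset.prod_cons, Multiset.sum_cons, pow_add]
      exact ⟨pw ((2 ^ j : ℕ) : ℤ) * c + d * pw 1 ^ S.sum,
        by linear_combination pw ((2 ^ j : ℕ) : ℤ) * hc + hd * pw 1 ^ S.sum⟩
  obtain ⟨c, hc⟩ := h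
  rw [Fm_replicate, Fm]
  exact ⟨c * dl, by linear_combination hc * dl⟩

lemma four_dvd_Fm (j : ℕ) :
    (4 : BA M) ∣ Fm {2 ^ j, 2 ^ j} - Fm (Multiset.replicate (2 ^ j + 2 ^ j) 1) := by
  obtain ⟨d, hd⟩ := two_dvd_pw_pow (M := M) j
  rw [Fm_replicate, Fm, pow_add]
  have : (({2 ^ j, 2 ^ j} : Multiset ℕ).map fun r : ℕ => (pw (r : ℤ) : BA M)).prod =
    pw ((2 ^ j : ℕ) : ℤ) * pw ((2 ^ j : ℕ) : ℤ) := by simp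
  rw [this]
  refine ⟨(d ^ 2 + d * pw 1 ^ 2 ^ j) * dl, ?_⟩
  have h2 : pw ((2 ^ j : ℕ) : ℤ) = (pw 1 ^ 2 ^ j + 2 * d : BA M) := by linear_combination hd
  rw [h2]
  ring

lemma coeff_natCast_mul (n : ℕ) (f : BA M) (b : Fin M → ℤ) :
    ((n : BA M) * f).coeff b = n * f.coeff b := by
  rw [← nsmul_eq_mul, AddMonoidAlgebra.coeff_smul, Finsupp.smul_apply, nsmul_eq_mul]

end BA

lemma Fv_mod {b : Fin M → ℤ} {σ τ : Perm α} {n : ℕ}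
    (h : (n : BA M) ∣ BA.Fm (pt σ) - BA.Fm (pt τ)) : ∃ z : ℤ, Fv b σ = Fv b τ + n * z := by
  obtain ⟨c, hc⟩ := h
  have h1 : (BA.Fm (pt σ) : BA M) = BA.Fm (pt τ) + (n : BA M) * c := by linear_combination hc
  refine ⟨c.coeff b, ?_⟩
  rw [Fv, h1, AddMonoidAlgebra.coeff_add, Finsupp.add_apply, BA.coeff_natCast_mul, Fv]
  push_cast
  rfl

lemma pt_two {σ : Perm α} (h : ∃ m, orderOf σ = 2 ^ m) : ∀ r ∈ pt σ, ∃ j, r = 2 ^ j := by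
  obtain ⟨m, hm⟩ := h
  intro r hr
  rw [pt_eq, Multiset.mem_add] at hr
  rcases hr with hr | hr
  · obtain ⟨j, -, hj⟩ := (Nat.dvd_prime_pow Nat.prime_two).1 (hm ▸ Perm.dvd_of_mem_cycleType hr)
    exact ⟨j, hj⟩
  · exact ⟨0, Multiset.eq_of_mem_replicate hr⟩

/-- Values at `2`-elements are congruent to the degree modulo `2`. -/
lemma irr_parity {χ : Perm α → ℂ} (hχ : χ ∈ Irr (Perm α)) {σ : Perm α}
    (h : ∃ m, orderOf σ = 2 ^ m) : ∃ z : ℤ, χ σ = charDeg χ + 2 * z := by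
  rw [← (Irr.isCh hχ).one]
  obtain ⟨b, rfl⟩ := exists_bead (M := 2 * Fintype.card α + 2) (by omega) (by omega) hχ
  have := BA.two_dvd_Fm (M := 2 * Fintype.card α + 2) (pt_two h)
  rw [pt_sum, ← pt_one] at this
  exact Fv_mod (n := 2) this

lemma irr_mod_four {χ : Perm α → ℂ} (hχ : χ ∈ Irr (Perm α)) {σ : Perm α} {j : ℕ}
    (h : pt σ = {2 ^ j, 2 ^ j}) : ∃ z : ℤ, χ σ = charDeg χ + 4 * z := by
  rw [← (Irr.isCh hχ).one]
  obtain ⟨b, rfl⟩ := exists_bead (M := 2 * Fintype.card α + 2) (by omega) (by omega) hχ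
  have := BA.four_dvd_Fm (M := 2 * Fintype.card α + 2) j
  have h2 := pt_sum σ
  rw [h] at h2
  simp only [Multiset.insert_eq_cons, Multiset.sum_cons, Multiset.sum_singleton] at h2
  rw [h2, ← pt_one, ← h] at this
  exact Fv_mod (n := 4) this

end Parity

section Degree

open Equiv Polynomial

variable {M : ℕ}

namespace BA

/-- The determinant of falling factorials. -/
def Vd (b : Fin M → ℤ) : ℤ :=
  ∑ w : Perm (Fin M), (Perm.sign w : ℤ) * ∏ i, (descPochhammer ℤ (w i)).eval (b i)

lemma Vd_eq (b : Fin M → ℤ) : Vd b = ∏ i, ∏ j ∈ Finset.Ioi i, (b j - b i) := by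
  rw [← Matrix.det_vandermonde,
    Matrix.det_eval_matrixOfPolynomials_eq_det_vandermonde b (fun j => descPochhammer ℤ j)
      (fun i => by rw [descPochhammer_natDegree]) (fun i => monic_descPochhammer ℤ _),
    ← Matrix.det_transpose, Matrix.det_apply]
  refine Finset.sum_congr rfl fun w _ => ?_
  rw [Units.smul_def, zsmul_eq_mul]
  simp

lemma eval_desc (x : ℤ) (w : ℕ) : x * (descPochhammer ℤ w).eval (x - 1) =
    (x - w) * (descPochhammer ℤ w).eval x := by
  have h1 := congrArg (eval x) (descPochhammer_succ_left ℤ w)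
  have h2 := congrArg (eval x) (descPochhammer_succ_right ℤ w)
  simp at h1 h2
  linear_combination h2 - h1

lemma sum_Vd (b : Fin M → ℤ) :
    ∑ i, b i * Vd (b - Pi.single i 1) = (∑ i, b i - Z M) * Vd b := by
  unfold Vd
  simp only [Finset.mul_sum]
  rw [Finset.sum_comm]
  refine Finset.sum_congr rfl fun w _ => ?_
  have h : ∀ i, b i * ((Perm.sign w : ℤ) *
      ∏ j, (descPochhammer ℤ (w j)).eval ((b - Pi.single i 1 : Fin M → ℤ) j)) =
      (b i - (w i : ℕ)) * ((Perm.sign w : ℤ) * ∏ j, (descPochhammer ℤ (w j)).eval (b j)) := by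
    intro i
    rw [← Finset.mul_prod_erase _ _ (Finset.mem_univ i),
      ← Finset.mul_prod_erase _ (fun j => (descPochhammer ℤ (w j)).eval (b j)) (Finset.mem_univ i),
      Finset.prod_congr rfl fun j hj => by
        rw [Pi.sub_apply, Pi.single_eq_of_ne (Finset.ne_of_mem_erase hj), sub_zero]]
    rw [Pi.sub_apply, Pi.single_eq_same]
    have := eval_desc (b i) (w i)
    linear_combination ((Perm.sign w : ℤ) *
      ∏ j ∈ Finset.univ.erase i, (descPochhammer ℤ (w j)).eval (b j)) * this
  simp only [h]
  rw [← Finset.sum_mul, Finset.sum_sub_distrib]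
  congr 2
  exact Equiv.sum_comp w (fun i : Fin M => ((i : ℕ) : ℤ))

lemma eval_desc_nat (n k : ℕ) : (descPochhammer ℤ k).eval (n : ℤ) = n.descFactorial k := by
  rw [descPochhammer_eval_eq_descFactorial]

/-- The hook formula in terms of the exponent. -/
theorem coeff_ones (n : ℕ) (B : Fin M → ℕ) (hB : ∑ i, (B i : ℤ) = n + Z M) :
    (Fm (Multiset.replicate n 1) : BA M).coeff (fun i => (B i : ℤ)) * ∏ i, ((B i).factorial : ℤ) =
      n.factorial * Vd fun i => (B i : ℤ) := by
  induction n generalizing B with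
  | zero =>
    rw [Multiset.replicate_zero, Fm_zero, coeff_dl, Vd, Finset.sum_mul, Nat.factorial_zero,
      Nat.cast_one, one_mul]
    refine Finset.sum_congr rfl fun w _ => ?_
    by_cases hw : ∀ i, (w i : ℕ) = B i
    · rw [if_pos (by funext i; exact_mod_cast hw i)]
      congr 1
      refine Finset.prod_congr rfl fun i _ => ?_
      rw [eval_desc_nat, hw, Nat.descFactorial_self]
    · rw [if_neg (fun h => hw fun i => by exact_mod_cast congrFun h i), zero_mul]
      symm
      apply mul_eq_zero_of_right
      push Not at hw
      obtain ⟨i, hi⟩ := hw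
      have : ∃ j, B j < (w j : ℕ) := by
        by_contra! h
        have h1 : ∑ j, ((w j : ℕ) : ℤ) < ∑ j, (B j : ℤ) :=
          Finset.sum_lt_sum (fun j _ => by exact_mod_cast h j) ⟨i, Finset.mem_univ _, by
            have := h i; omega⟩
        have h2 : ∑ j, ((w j : ℕ) : ℤ) = Z M :=
          Equiv.sum_comp w (fun i : Fin M => ((i : ℕ) : ℤ))
        push_cast at hB
        omega
      obtain ⟨j, hj⟩ := this
      refine Finset.prod_eq_zero (Finset.mem_univ j) ?_
      rw [eval_desc_nat, Nat.descFactorial_of_lt hj, Nat.cast_zero]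
  | succ n ih =>
    rw [Multiset.replicate_succ, Fm_cons, coeff_pw_mul, Finset.sum_mul, Nat.factorial_succ]
    have h1 : ∀ i, (Fm (Multiset.replicate n 1) : BA M).coeff
        ((fun i => (B i : ℤ)) - Pi.single i ((1 : ℕ) : ℤ)) * ∏ i, ((B i).factorial : ℤ) =
        n.factorial * (B i * Vd ((fun i => (B i : ℤ)) - Pi.single i 1)) := by
      intro i
      by_cases hi : B i = 0
      · rw [hi, Nat.cast_zero, zero_mul, mul_zero]
        apply mul_eq_zero_of_left
        by_contra h
        have := (supp_Fm h).1 i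
        simp [hi] at this
      · obtain ⟨m, hm⟩ := Nat.exists_eq_succ_of_ne_zero hi
        have e : ((fun i => (B i : ℤ)) - Pi.single i ((1 : ℕ) : ℤ) : Fin M → ℤ) =
            fun k => ((Function.update B i m k : ℕ) : ℤ) := by
          funext k
          by_cases hk : k = i
          · subst hk; simp [hm]
          · simp [hk]
        have h2 := ih (Function.update B i m) (by
          have := sum_sub_single (fun i => (B i : ℤ)) i 1
          have e2 := congrArg (fun f : Fin M → ℤ => ∑ k, f k) e
          refine e2.symm.trans ?_
          push_cast at hB ⊢
          rw [this, hB]; ring)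
        have h3 : ∏ k, ((B k).factorial : ℤ) =
            B i * ∏ k, ((Function.update B i m k).factorial : ℤ) := by
          rw [← Finset.mul_prod_erase _ _ (Finset.mem_univ i),
            ← Finset.mul_prod_erase _ (fun k => ((Function.update B i m k).factorial : ℤ))
              (Finset.mem_univ i), Function.update_self,
            Finset.prod_congr rfl fun j hj => by
              rw [← Function.update_of_ne (Finset.ne_of_mem_erase hj) m B], hm, Nat.factorial_succ]
          push_cast
          ring
        rw [e, h3]
        have e' : ((fun i => (B i : ℤ)) - Pi.single i 1 : Fin M → ℤ) =
            fun k => ((Function.update B i m k : ℕ) : ℤ) := e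
        rw [e']
        linear_combination (B i : ℤ) * h2
    simp only [h1]
    rw [← Finset.mul_sum, sum_Vd, hB]
    push_cast
    ring

end BA
end Degree

section OddEquiv

/-- Equality up to odd factors. -/
def OE (a b : ℤ) : Prop := ∃ u w : ℤ, Odd u ∧ Odd w ∧ u * a = w * b

namespace OE

lemma refl (a : ℤ) : OE a a := ⟨1, 1, odd_one, odd_one, rfl⟩

lemma of_eq {a b : ℤ} (h : a = b) : OE a b := h ▸ refl a

lemma symm {a b : ℤ} : OE a b → OE b a := fun ⟨u, w, hu, hw, h⟩ => ⟨w, u, hw, hu, h.symm⟩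

lemma trans {a b c : ℤ} : OE a b → OE b c → OE a c := fun ⟨u, w, hu, hw, h⟩ ⟨u', w', hu', hw', h'⟩ =>
  ⟨u' * u, w * w', hu'.mul hu, hw.mul hw', by linear_combination u' * h + w * h'⟩

lemma mul {a b c d : ℤ} : OE a b → OE c d → OE (a * c) (b * d) :=
  fun ⟨u, w, hu, hw, h⟩ ⟨u', w', hu', hw', h'⟩ =>
    ⟨u * u', w * w', hu.mul hu', hw.mul hw', by linear_combination u' * c * h + w * b * h'⟩

lemma neg (a : ℤ) : OE (-a) a := ⟨-1, 1, odd_neg_one, odd_one, by ring⟩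

lemma prod {ι : Type*} (s : Finset ι) {f g : ι → ℤ} (h : ∀ i ∈ s, OE (f i) (g i)) :
    OE (∏ i ∈ s, f i) (∏ i ∈ s, g i) := by
  classical
  induction s using Finset.induction_on with
  | empty => exact refl _
  | insert a s ha ih =>
    rw [Finset.prod_insert ha, Finset.prod_insert ha]
    exact (h a (Finset.mem_insert_self _ _)).mul (ih fun i hi => h i (Finset.mem_insert_of_mem hi))

lemma cancel {a b c : ℤ} (hc : c ≠ 0) : OE (c * a) (c * b) → OE a b :=
  fun ⟨u, w, hu, hw, h⟩ => ⟨u, w, hu, hw, mul_left_cancel₀ hc (by linear_combination h)⟩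

lemma of_dvd_sub {j : ℕ} {x y : ℤ} (hx : ¬ (2 : ℤ) ^ j ∣ x) (h : (2 : ℤ) ^ j ∣ x - y) : OE x y := by
  have hx0 : x.natAbs ≠ 0 := fun h0 => hx (by rw [Int.natAbs_eq_zero.1 h0]; exact dvd_zero _)
  obtain ⟨i, m, hm, hi⟩ := Nat.exists_eq_two_pow_mul_odd hx0
  obtain ⟨u, hu, hxu⟩ : ∃ u : ℤ, Odd u ∧ x = 2 ^ i * u := by
    rcases Int.natAbs_eq x with h1 | h1
    · exact ⟨m, by exact_mod_cast hm, by rw [h1, hi]; push_cast; ring⟩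
    · exact ⟨-m, by rw [odd_neg]; exact_mod_cast hm, by rw [h1, hi]; push_cast; ring⟩
  have hij : i < j := by
    by_contra! hji
    exact hx (hxu ▸ Dvd.dvd.mul_right (pow_dvd_pow 2 hji) u)
  obtain ⟨z, hz⟩ := h
  obtain ⟨d, rfl⟩ := Nat.exists_eq_add_of_lt hij
  refine ⟨u - 2 ^ (d + 1) * z, u, hu.sub_even ?_, hu, ?_⟩
  · rw [pow_succ]
    exact ⟨2 ^ d * z, by ring⟩
  · have : y = 2 ^ i * (u - 2 ^ (d + 1) * z) := by
      have : (2 : ℤ) ^ (i + d + 1) = 2 ^ i * 2 ^ (d + 1) := by ring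
      rw [this] at hz
      linear_combination hxu - hz
    rw [this, hxu]; ring

lemma descFactorial (j : ℕ) {m : ℕ} (hm : 1 ≤ m) {ρ : ℕ} (hρ : ρ < 2 ^ j) :
    OE (((m * 2 ^ j + ρ).descFactorial (2 ^ j) : ℕ) : ℤ) (m * (2 ^ j).factorial) := by
  induction ρ with
  | zero =>
    obtain ⟨N, hN⟩ := Nat.exists_eq_succ_of_ne_zero (pow_ne_zero j (two_ne_zero (α := ℕ)))
    rw [add_zero, ← Nat.descFactorial_self, Nat.descFactorial_eq_prod_range,
      Nat.descFactorial_eq_prod_range,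
      show Finset.range (2 ^ j) = Finset.range (N + 1) by rw [hN], Finset.prod_range_succ',
      Finset.prod_range_succ', Nat.sub_zero, Nat.sub_zero]
    push_cast
    have h1 : OE (∏ k ∈ Finset.range N, ((m * 2 ^ j - (k + 1) : ℕ) : ℤ))
        (∏ k ∈ Finset.range N, ((2 ^ j - (k + 1) : ℕ) : ℤ)) := by
      refine prod _ fun k hk => ?_
      have hk := Finset.mem_range.1 hk
      have h2 : 2 ^ j ≤ m * 2 ^ j := Nat.le_mul_of_pos_left _ hm
      rw [Nat.cast_sub (by omega), Nat.cast_sub (by omega)]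
      push_cast
      refine (of_dvd_sub (j := j) (fun h => ?_) ⟨1 - m, by ring⟩).symm
      have h3 : ((2 : ℤ) ^ j) ∣ k + 1 := by
        exact (dvd_sub_right (dvd_refl _)).1 h
      have h4 := Int.le_of_dvd (by omega) h3
      have h5 : ((2 : ℤ) ^ j) = N + 1 := by exact_mod_cast hN
      omega
    have := (refl ((m * 2 ^ j : ℕ) : ℤ)).mul h1
    refine (of_eq ?_).trans (this.trans (of_eq ?_)) <;> push_cast <;> ring
  | succ ρ ih =>
    have h := ih (by omega)
    have h2 := Nat.succ_descFactorial (m * 2 ^ j + ρ) (2 ^ j)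
    have h3 : 2 ^ j ≤ m * 2 ^ j := Nat.le_mul_of_pos_left _ hm
    have h3' := congrArg (Nat.cast : ℕ → ℤ) h2
    rw [Nat.cast_mul, Nat.cast_mul, Nat.cast_sub (by omega)] at h3'
    have h4 : ¬ (2 : ℤ) ^ j ∣ (m * 2 ^ j + ρ + 1 : ℤ) := by
      intro h5
      have : (2 : ℤ) ^ j ∣ ((ρ + 1 : ℕ) : ℤ) := by
        have := dvd_sub h5 (Dvd.intro_left (m : ℤ) rfl : (2 : ℤ) ^ j ∣ m * 2 ^ j)
        rw [show ((m : ℤ) * 2 ^ j + ρ + 1) - m * 2 ^ j = ((ρ + 1 : ℕ) : ℤ) by push_cast; ring] at this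
        exact this
      have h6 := Nat.le_of_dvd (by omega) (by exact_mod_cast this : 2 ^ j ∣ ρ + 1)
      omega
    have h5 : OE (m * 2 ^ j + ρ + 1 : ℤ) (m * 2 ^ j + ρ + 1 - 2 ^ j : ℤ) :=
      of_dvd_sub h4 ⟨1, by ring⟩
    have h6 : (m * 2 ^ j + ρ + 1 : ℤ) ≠ 0 := fun h0 => h4 (h0 ▸ dvd_zero _)
    refine cancel h6 ?_
    have h7 := h5.mul (refl (((m * 2 ^ j + (ρ + 1)).descFactorial (2 ^ j) : ℕ) : ℤ))
    refine h7.trans ?_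
    refine (of_eq ?_).trans ((refl (m * 2 ^ j + ρ + 1 : ℤ)).mul h)
    push_cast at h3'
    exact_mod_cast h3'

end OE

end OddEquiv

section HookDegree

open Equiv

variable {M : ℕ}

namespace BA

/-- The Vandermonde product without the factors involving `i`. -/
def Wd (b : Fin M → ℤ) (i : Fin M) : ℤ :=
  ∏ p, ∏ q ∈ Finset.Ioi p, if q = i ∨ p = i then 1 else b q - b p

lemma Vd_oe (b : Fin M → ℤ) (i : Fin M) :
    OE (Vd b) (Wd b i * ∏ k ∈ Finset.univ.erase i, (b i - b k)) := by
  have h1 : Vd b = Wd b i * ∏ p, ∏ q ∈ Finset.Ioi p, if q = i ∨ p = i then b q - b p else 1 := by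
    rw [Vd_eq, Wd, ← Finset.prod_mul_distrib]
    refine Finset.prod_congr rfl fun p _ => ?_
    rw [← Finset.prod_mul_distrib]
    refine Finset.prod_congr rfl fun q _ => ?_
    split_ifs <;> ring
  rw [h1]
  refine (OE.refl _).mul ?_
  rw [← Finset.mul_prod_erase _ _ (Finset.mem_univ i)]
  have h2 : ∀ p ∈ Finset.univ.erase i,
      (∏ q ∈ Finset.Ioi p, if q = i ∨ p = i then b q - b p else 1) =
        if p < i then b i - b p else 1 := by
    intro p hp
    have hp := Finset.ne_of_mem_erase hp
    simp only [hp, or_false, Finset.prod_ite_eq', Finset.mem_Ioi]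
  rw [Finset.prod_congr rfl h2]
  have h3 : ∏ k ∈ Finset.univ.erase i, (b i - b k) =
      (∏ k ∈ Finset.Ioi i, (b i - b k)) *
        ∏ p ∈ Finset.univ.erase i, if p < i then b i - b p else 1 := by
    rw [← Finset.prod_filter, ← Finset.prod_union]
    · refine Finset.prod_congr ?_ fun _ _ => rfl
      ext k
      simp only [Finset.mem_erase, Finset.mem_univ, and_true, Finset.mem_union, Finset.mem_Ioi,
        Finset.mem_filter]
      constructor
      · intro h; rcases lt_or_gt_of_ne h with h' | h'
        · exact Or.inr ⟨h, h'⟩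
        · exact Or.inl h'
      · rintro (h | h)
        · exact h.ne'
        · exact h.1
    · rw [Finset.disjoint_left]
      intro k hk hk'
      exact absurd (Finset.mem_Ioi.1 hk) (not_lt.2 (Finset.mem_filter.1 hk').2.le)
  rw [h3]
  refine OE.mul (OE.prod _ fun k _ => ?_) (OE.refl _)
  rw [if_pos (Or.inr rfl)]
  exact (OE.of_eq (by ring)).trans (OE.neg (b i - b k))

end BA
end HookDegree

section HookDouble

open Equiv

variable {M : ℕ}

namespace BA

lemma mul_prod_range_sub (m : ℕ) (N : ℤ) :
    ((m : ℤ) + 1) * ∏ t ∈ Finset.range m, ((m : ℤ) - t) * N =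
      ∏ t ∈ Finset.range m, ((m : ℤ) + 1 - t) * N := by
  rw [Finset.prod_mul_distrib, Finset.prod_mul_distrib, ← mul_assoc]
  congr 1
  have h1 := Finset.prod_range_succ (fun t : ℕ => ((m : ℤ) + 1 - t)) m
  rw [Finset.prod_range_succ'] at h1
  push_cast at h1
  simp only [sub_zero, add_sub_add_right_eq_sub, add_sub_cancel_left, mul_one] at h1
  rw [← h1, mul_comm]

/-- Descent of beads on the runners of a core. -/
lemma runner_descent {N : ℕ} {b : Fin M → ℤ} (h0 : ∀ k, 0 ≤ b k)
    (hs : ∑ k, b k = N + Z M) (hinj : Function.Injective b)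
    (hcore : ∀ k, (dl : BA M).coeff (b - Pi.single k (N : ℤ)) = 0) {k : Fin M} (hk : (N : ℤ) ≤ b k) :
    ∃ l, b l = b k - N := by
  by_contra! hne
  refine coeff_dl_ne_zero (b := b - Pi.single k (N : ℤ)) ?_ ?_ ?_ (hcore k)
  · intro p q hpq
    simp only [Pi.sub_apply, Pi.single_apply] at hpq
    have h1 := hne p
    have h2 := hne q
    split_ifs at hpq with h3 h4 h4
    · rw [h3, h4]
    · rw [h3] at hpq; omega
    · rw [h4] at hpq; omega
    · exact hinj (by omega)
  · intro p
    have := h0 p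
    simp only [Pi.sub_apply, Pi.single_apply]
    split_ifs with h
    · rw [h]; omega
    · omega
  · rw [sum_sub_single, hs]; ring

lemma runner_descent' {N : ℕ} {b : Fin M → ℤ} (h0 : ∀ k, 0 ≤ b k)
    (hs : ∑ k, b k = N + Z M) (hinj : Function.Injective b)
    (hcore : ∀ k, (dl : BA M).coeff (b - Pi.single k (N : ℤ)) = 0) {ρ : ℤ} (hρ : 0 ≤ ρ) (s d : ℕ)
    (hk : ∃ k, b k = ρ + (s + d : ℕ) * N) : ∃ l, b l = ρ + s * N := by
  induction d with
  | zero => simpa using hk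
  | succ d ih =>
    refine ih ?_
    obtain ⟨k, hk⟩ := hk
    have h2 : (0 : ℤ) ≤ (s + d : ℕ) * N := by positivity
    obtain ⟨l, hl⟩ := runner_descent h0 hs hinj hcore (k := k) (by
      rw [hk, ← add_assoc]; push_cast at h2 ⊢; linarith)
    refine ⟨l, ?_⟩
    rw [hl, hk]; push_cast; ring

lemma runner_prod {j : ℕ} {b : Fin M → ℤ} (h0 : ∀ k, 0 ≤ b k) (hinj : Function.Injective b)
    (hs : ∑ k, b k = 2 * 2 ^ j + Z M) {i : Fin M} (m ρ : ℕ) (hρ : ρ < 2 ^ j)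
    (hi : b i = ρ + (m + 1) * 2 ^ j)
    (hinj' : Function.Injective (b - Pi.single i ((2 ^ j : ℕ) : ℤ)))
    (hcore : ∀ k, (dl : BA M).coeff (b - Pi.single i ((2 ^ j : ℕ) : ℤ) -
      Pi.single k ((2 ^ j : ℕ) : ℤ)) = 0) :
    OE ((m + 1) * ∏ k ∈ Finset.univ.erase i, (b i - 2 ^ j - b k))
      (∏ k ∈ Finset.univ.erase i, (b i - b k)) := by
  classical
  set N : ℕ := 2 ^ j with hN
  have hNpos : 0 < N := by positivity
  have hNz : ((2 : ℤ) ^ j) = N := by rw [hN]; push_cast; ring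
  rw [hNz] at hs hi ⊢
  set b' := b - Pi.single i (N : ℤ) with hb'
  have hb'i : b' i = ρ + m * N := by simp [hb', hi]; ring
  have hb'k : ∀ k, k ≠ i → b' k = b k := fun k hk => by simp [hb', hk]
  have h0' : ∀ k, 0 ≤ b' k := by
    intro k
    by_cases hk : k = i
    · rw [hk, hb'i]; positivity
    · rw [hb'k k hk]; exact h0 k
  have hs' : ∑ k, b' k = N + Z M := by rw [hb', sum_sub_single, hs]; ring
  set K := (Finset.univ.erase i).filter fun k => (N : ℤ) ∣ b i - b k with hK
  have hsplit : ∀ f : Fin M → ℤ, ∏ k ∈ Finset.univ.erase i, f k =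
      (∏ k ∈ K, f k) * ∏ k ∈ (Finset.univ.erase i).filter fun k => ¬ (N : ℤ) ∣ b i - b k, f k :=
    fun f => (Finset.prod_filter_mul_prod_filter_not _ _ _).symm
  rw [hsplit, hsplit, ← mul_assoc]
  refine OE.mul (OE.of_eq ?_) (OE.prod _ fun k hk => ?_)
  · have hKt : ∀ k ∈ K, ∃ t < m, b k = ρ + (t : ℕ) * N := by
      intro k hk
      obtain ⟨hk1, hk2⟩ := Finset.mem_filter.1 hk
      have hki := Finset.ne_of_mem_erase hk1
      obtain ⟨d, hd⟩ := hk2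
      have hbk : b k = ρ + (m + 1 - d) * N := by linear_combination -hd + hi
      have hnn : 0 ≤ (m + 1 - d) := by
        by_contra! hneg
        have h1 := h0 k
        have : (m + 1 - d) * (N : ℤ) ≤ -1 * N := by
          apply mul_le_mul_of_nonneg_right (by omega) (by positivity)
        omega
      obtain ⟨t, ht⟩ := Int.eq_ofNat_of_zero_le hnn
      rw [ht] at hbk
      refine ⟨t, ?_, hbk⟩
      by_contra! htm
      rcases Nat.eq_or_lt_of_le htm with h1 | h1
      · exact hki (hinj' (by rw [hb'k k hki, hb'i, hbk, h1]))
      · obtain ⟨d', rfl⟩ := Nat.exists_eq_add_of_lt h1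
        obtain ⟨l, hl⟩ := runner_descent' h0' hs' hinj' hcore (ρ := ρ) (by positivity) (m + 1) d'
          ⟨k, by rw [hb'k k hki, hbk]; push_cast; ring⟩
        by_cases hli : l = i
        · rw [hli, hb'i] at hl
          push_cast at hl
          have : (N : ℤ) = 0 := by linear_combination -hl
          omega
        · rw [hb'k l hli] at hl
          exact hli (hinj (by rw [hl, hi]; push_cast; ring))
    have hdiv : ∀ k ∈ K, b k = ρ + ((b k / N).toNat : ℤ) * N ∧ (b k / N).toNat < m := by
      intro k hk
      obtain ⟨t, ht, hbk⟩ := hKt k hk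
      have : b k / N = t := by
        rw [hbk, Int.add_mul_ediv_right _ _ (by omega), Int.ediv_eq_zero_of_lt (by omega) (by omega),
          zero_add]
      rw [this]
      exact ⟨by simpa using hbk, by simpa using ht⟩
    have himg : K.image (fun k => (b k / N).toNat) = Finset.range m := by
      ext t
      simp only [Finset.mem_image, Finset.mem_range]
      constructor
      · rintro ⟨k, hk, rfl⟩
        exact (hdiv k hk).2
      · intro ht
        obtain ⟨d, rfl⟩ := Nat.exists_eq_add_of_lt ht
        obtain ⟨l, hl⟩ := runner_descent' h0' hs' hinj' hcore (ρ := ρ) (by positivity) t (d + 1)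
          ⟨i, by rw [hb'i]; push_cast; ring⟩
        have hli : l ≠ i := by
          rintro rfl
          rw [hb'i] at hl
          push_cast at hl
          have h1 : ((d : ℤ) + 1) * N = 0 := by linear_combination hl
          have h2 : (0 : ℤ) < ((d : ℤ) + 1) * N := by positivity
          omega
        rw [hb'k l hli] at hl
        have hlK : l ∈ K := Finset.mem_filter.2 ⟨Finset.mem_erase.2 ⟨hli, Finset.mem_univ _⟩,
          (t + d + 1 : ℕ) + 1 - t, by rw [hi, hl]; push_cast; ring⟩
        refine ⟨l, hlK, ?_⟩
        rw [hl, Int.add_mul_ediv_right _ _ (by omega), Int.ediv_eq_zero_of_lt (by omega) (by omega),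
          zero_add]
        simp
    have hinjK : Set.InjOn (fun k => (b k / N).toNat) K := by
      intro p hp q hq hpq
      refine hinj ?_
      rw [(hdiv p hp).1, (hdiv q hq).1, show (b p / N).toNat = (b q / N).toNat from hpq]
    have hprod : ∀ f : ℕ → ℤ, ∏ t ∈ Finset.range m, f t = ∏ k ∈ K, f (b k / N).toNat := by
      intro f
      rw [← himg, Finset.prod_image hinjK]
    have h1 : ∏ k ∈ K, (b i - N - b k) = ∏ t ∈ Finset.range m, ((m : ℤ) - t) * N := by
      rw [hprod]
      refine Finset.prod_congr rfl fun k hk => ?_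
      linear_combination hi - (hdiv k hk).1
    have h2 : ∏ k ∈ K, (b i - b k) = ∏ t ∈ Finset.range m, ((m : ℤ) + 1 - t) * N := by
      rw [hprod]
      refine Finset.prod_congr rfl fun k hk => ?_
      linear_combination hi - (hdiv k hk).1
    rw [h1, h2, mul_prod_range_sub]
  · have h1 := (Finset.mem_filter.1 hk).2
    rw [← hNz] at h1
    exact (OE.of_dvd_sub h1 ⟨1, by rw [← hNz]; ring⟩).symm

lemma Wd_sub_single (b : Fin M → ℤ) (i : Fin M) (r : ℤ) : Wd (b - Pi.single i r) i = Wd b i := by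
  unfold Wd
  refine Finset.prod_congr rfl fun p _ => Finset.prod_congr rfl fun q _ => ?_
  split_ifs with h
  · rfl
  · push Not at h
    simp [h.1, h.2]

/-- Removing the only hook of maximal length halves the `2`-part of the degree. -/
theorem hook_double {j : ℕ} {b : Fin M → ℤ} (h0 : ∀ k, 0 ≤ b k) (hinj : Function.Injective b)
    (hs : ∑ k, b k = 2 * 2 ^ j + Z M) {i : Fin M} (hi : 2 ^ j ≤ b i)
    (hinj' : Function.Injective (b - Pi.single i ((2 ^ j : ℕ) : ℤ)))
    (hcore : ∀ k, (dl : BA M).coeff (b - Pi.single i ((2 ^ j : ℕ) : ℤ) -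
      Pi.single k ((2 ^ j : ℕ) : ℤ)) = 0) :
    OE ((Fm (Multiset.replicate (2 * 2 ^ j) 1) : BA M).coeff b)
      (2 * (Fm (Multiset.replicate (2 ^ j) 1) : BA M).coeff (b - Pi.single i ((2 ^ j : ℕ) : ℤ))) := by
  have hB : ∃ B : Fin M → ℕ, b = fun k => (B k : ℤ) :=
    ⟨fun k => (b k).toNat, funext fun k => (Int.toNat_of_nonneg (h0 k)).symm⟩
  obtain ⟨B, rfl⟩ := hB
  have hBi : 2 ^ j ≤ B i := by
    beta_reduce at hi
    exact_mod_cast hi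
  have hpos : 0 < 2 ^ j := by positivity
  obtain ⟨m, hm⟩ : ∃ m, B i / 2 ^ j = m + 1 :=
    Nat.exists_eq_succ_of_ne_zero (Nat.div_pos hBi hpos).ne'
  set ρ := B i % 2 ^ j with hρdef
  have hρ : ρ < 2 ^ j := Nat.mod_lt _ hpos
  have hBi' : B i = (m + 1) * 2 ^ j + ρ := by rw [← hm, mul_comm]; exact (Nat.div_add_mod _ _).symm
  have hP := runner_prod h0 hinj hs m ρ hρ (by rw [hBi']; push_cast; ring) hinj' hcore
  let B' : Fin M → ℕ := Function.update B i (B i - 2 ^ j)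
  have hb' : (fun k => (B k : ℤ)) - Pi.single i ((2 ^ j : ℕ) : ℤ) = fun k => (B' k : ℤ) := by
    funext k
    by_cases hk : k = i
    · subst hk
      simp only [Pi.sub_apply, Pi.single_eq_same, B', Function.update_self]
      rw [Nat.cast_sub hBi]
    · simp [B', hk]
  have e1 := coeff_ones (M := M) (2 * 2 ^ j) B (by rw [hs]; push_cast; ring)
  have e2 := coeff_ones (M := M) (2 ^ j) B' (by
    have := sum_sub_single (fun k => (B k : ℤ)) i ((2 ^ j : ℕ) : ℤ)
    rw [hb', hs] at this
    rw [this]; push_cast; ring)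
  rw [← hb'] at e2
  set C := (Fm (Multiset.replicate (2 * 2 ^ j) 1) : BA M).coeff fun k => (B k : ℤ)
  set C' := (Fm (Multiset.replicate (2 ^ j) 1) : BA M).coeff
    ((fun k => (B k : ℤ)) - Pi.single i ((2 ^ j : ℕ) : ℤ))
  set Q := ∏ k ∈ Finset.univ.erase i, ((B k).factorial : ℤ)
  have f1 : ∏ k, ((B k).factorial : ℤ) =
      ((B i - 2 ^ j).factorial * ((B i).descFactorial (2 ^ j) : ℕ)) * Q := by
    rw [← Finset.mul_prod_erase _ _ (Finset.mem_univ i)]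
    congr 1
    exact_mod_cast (Nat.factorial_mul_descFactorial hBi).symm
  have f2 : ∏ k, ((B' k).factorial : ℤ) = (B i - 2 ^ j).factorial * Q := by
    rw [← Finset.mul_prod_erase _ _ (Finset.mem_univ i)]
    congr 1
    · simp [B']
    · refine Finset.prod_congr rfl fun k hk => ?_
      simp [B', Finset.ne_of_mem_erase hk]
  have f3 : ((2 * 2 ^ j).factorial : ℤ) =
      (2 ^ j).factorial * ((2 * 2 ^ j).descFactorial (2 ^ j) : ℕ) := by
    have := Nat.factorial_mul_descFactorial (n := 2 * 2 ^ j) (k := 2 ^ j) (by omega)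
    rw [show 2 * 2 ^ j - 2 ^ j = 2 ^ j by omega] at this
    exact_mod_cast this.symm
  have d1 : OE ((B i).descFactorial (2 ^ j) : ℕ) ((m + 1 : ℕ) * (2 ^ j).factorial) := by
    conv_lhs => rw [hBi']
    exact OE.descFactorial j (by omega) hρ
  have d2 : OE ((2 * 2 ^ j).descFactorial (2 ^ j) : ℕ) ((2 : ℕ) * (2 ^ j).factorial) := by
    have := OE.descFactorial j (m := 2) (by omega) (ρ := 0) hpos
    rwa [add_zero] at this
  have v1 := Vd_oe (fun k => (B k : ℤ)) i
  have v2 := Vd_oe ((fun k => (B k : ℤ)) - Pi.single i ((2 ^ j : ℕ) : ℤ)) i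
  rw [Wd_sub_single] at v2
  have v3 : ∏ k ∈ Finset.univ.erase i, (((fun k => (B k : ℤ)) - Pi.single i ((2 ^ j : ℕ) : ℤ) : Fin M → ℤ) i -
      ((fun k => (B k : ℤ)) - Pi.single i ((2 ^ j : ℕ) : ℤ) : Fin M → ℤ) k) =
      ∏ k ∈ Finset.univ.erase i, ((B i : ℤ) - 2 ^ j - B k) := by
    refine Finset.prod_congr rfl fun k hk => ?_
    simp [Finset.ne_of_mem_erase hk]
  rw [v3] at v2
  set P1 := ∏ k ∈ Finset.univ.erase i, ((B i : ℤ) - 2 ^ j - B k)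
  set P2 := ∏ k ∈ Finset.univ.erase i, ((B i : ℤ) - B k)
  set W := Wd (fun k => (B k : ℤ)) i
  set V := Vd fun k => (B k : ℤ)
  generalize Vd ((fun k => (B k : ℤ)) - Pi.single i ((2 ^ j : ℕ) : ℤ)) = V' at v2 e2
  rw [f1, f3] at e1
  rw [f2] at e2
  set F := ((B i - 2 ^ j).factorial : ℤ) with hF
  set D := ((B i).descFactorial (2 ^ j) : ℕ) with hD
  set D2 := ((2 * 2 ^ j).descFactorial (2 ^ j) : ℕ)
  set n := ((2 ^ j).factorial : ℤ) with hn
  have hQ0 : Q ≠ 0 := Finset.prod_ne_zero_iff.2 fun k _ => by exact_mod_cast (B k).factorial_ne_zero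
  have hF0 : F ≠ 0 := by rw [hF]; exact_mod_cast Nat.factorial_ne_zero _
  have hn0 : n ≠ 0 := by rw [hn]; exact_mod_cast Nat.factorial_ne_zero _
  refine OE.cancel (c := F * Q * ((m + 1 : ℕ) * n))
    (mul_ne_zero (mul_ne_zero hF0 hQ0) (mul_ne_zero (by exact_mod_cast Nat.succ_ne_zero m) hn0)) ?_
  have s1 : OE (F * Q * ((m + 1 : ℕ) * n) * C) (n * D2 * V) :=
    (((OE.refl (F * Q)).mul d1.symm).mul (OE.refl C)).trans (OE.of_eq (by rw [← e1]; ring))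
  have s2 : OE (n * D2 * V) (n * ((2 : ℕ) * n) * (W * ((m + 1) * P1))) :=
    ((OE.refl n).mul d2).mul (v1.trans ((OE.refl W).mul hP.symm))
  have s3 : OE (n * ((2 : ℕ) * n) * (W * ((m + 1) * P1))) (F * Q * ((m + 1 : ℕ) * n) * (2 * C')) := by
    have := (OE.refl (n * ((2 : ℕ) * n) * (m + 1))).mul v2.symm
    refine (OE.of_eq (by ring)).trans (this.trans (OE.of_eq ?_))
    push_cast
    linear_combination (-2 * n * (m + 1)) * e2
  exact s1.trans (s2.trans s3)

end BA
end HookDouble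

section HookMatrix

open Equiv

variable {M : ℕ}

namespace BA

lemma coeff_dl_sign {b : Fin M → ℤ} (h : (dl : BA M).coeff b ≠ 0) :
    (dl : BA M).coeff b = 1 ∨ (dl : BA M).coeff b = -1 := by
  obtain ⟨w, rfl⟩ := supp_dl h
  rw [coeff_dl_perm]
  rcases Int.units_eq_one_or (Perm.sign w) with h | h <;> rw [h] <;> simp

lemma dl_unique {N : ℕ} (hN : 0 < N) {b : Fin M → ℤ} (hinj : Function.Injective b) {k l : Fin M}
    (hk : (dl : BA M).coeff (b - Pi.single k (N : ℤ)) ≠ 0)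
    (hl : (dl : BA M).coeff (b - Pi.single l (N : ℤ)) ≠ 0) : k = l := by
  by_contra hne
  obtain ⟨w, hw⟩ := supp_dl hk
  obtain ⟨v, hv⟩ := supp_dl hl
  have h1 : b k = (w k : ℕ) + N := by
    have := congrFun hw k
    simp only [Pi.sub_apply, Pi.single_eq_same] at this
    omega
  have h2 : b k = (v k : ℕ) := by
    have := congrFun hv k
    simpa [hne] using this
  obtain ⟨p, hp⟩ := w.surjective (v k)
  have hpk : p ≠ k := by
    rintro rfl
    rw [hp] at h1
    omega
  have h3 : b p = (w p : ℕ) := by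
    have := congrFun hw p
    simpa [hpk] using this
  exact hpk (hinj (by rw [h3, hp, h2]))

lemma sub_injective {N : ℤ} {b : Fin M → ℤ} (hinj : Function.Injective b)
    {I : Finset (Fin M)} (hI : ∀ i ∈ I, Function.Injective (b - Pi.single i N)) :
    Function.Injective fun p => b p - if p ∈ I then N else 0 := by
  have key : ∀ p ∈ I, ∀ q ∉ I, b p - N ≠ b q := by
    intro p hp q hq h
    have hpq : p ≠ q := by rintro rfl; exact hq hp
    refine hpq (hI p hp ?_)
    simp only [Pi.sub_apply, Pi.single_eq_same, Pi.single_eq_of_ne hpq.symm]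
    omega
  intro p q hpq
  simp only at hpq
  split_ifs at hpq with h1 h2 h2
  · exact hinj (by omega)
  · exact absurd (by omega) (key p h1 q h2)
  · exact absurd (by omega) (key q h2 p h1)
  · exact hinj (by omega)

lemma sum_sub_ite (N : ℤ) (b : Fin M → ℤ) (I : Finset (Fin M)) :
    ∑ p, (b p - if p ∈ I then N else 0) = ∑ p, b p - I.card * N := by
  rw [Finset.sum_sub_distrib, ← Finset.sum_filter]
  simp

end BA

variable {β : Type} [Fintype β] [DecidableEq β]

lemma Fv_fullCyc [Nonempty β] {c : Perm β} (hc : FullCyc c) (b : Fin M → ℤ) :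
    Fv b c = ((∑ k, (BA.dl : BA M).coeff (b - Pi.single k (Fintype.card β : ℤ)) : ℤ) : ℂ) := by
  rw [Fv, hc.pt, ← Multiset.cons_zero, BA.Fm_cons, BA.coeff_pw_mul, BA.Fm_zero]

lemma Fv_fullCyc_of_ne [Nonempty β] {c : Perm β} (hc : FullCyc c) {b : Fin M → ℤ}
    (hinj : Function.Injective b) {k : Fin M}
    (hk : (BA.dl : BA M).coeff (b - Pi.single k (Fintype.card β : ℤ)) ≠ 0) :
    Fv b c = ((BA.dl : BA M).coeff (b - Pi.single k (Fintype.card β : ℤ)) : ℤ) := by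
  rw [Fv_fullCyc hc, Finset.sum_eq_single k]
  · intro l _ hl
    by_contra h
    exact hl (BA.dl_unique Fintype.card_pos hinj h hk)
  · simp

lemma fullCyc_dichotomy [Nonempty β] {c : Perm β} (hc : FullCyc c) {b : Fin M → ℤ}
    (hinj : Function.Injective b) :
    (Fv b c = 0 ∧ ∀ k, (BA.dl : BA M).coeff (b - Pi.single k (Fintype.card β : ℤ)) = 0) ∨
      Fv b c = 1 ∨ Fv b c = -1 := by
  by_cases h : ∀ k, (BA.dl : BA M).coeff (b - Pi.single k (Fintype.card β : ℤ)) = 0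
  · left
    refine ⟨?_, h⟩
    rw [Fv_fullCyc hc]
    simp [h]
  · right
    push Not at h
    obtain ⟨k, hk⟩ := h
    rw [Fv_fullCyc_of_ne hc hinj hk]
    rcases BA.coeff_dl_sign hk with h | h <;> rw [h] <;> simp

lemma Fv_exists_ne {χ : Perm β → ℂ} (hχ : χ ∈ Irr (Perm β)) {b : Fin M → ℤ}
    (h : Fv b = χ ∨ Fv b = -χ) : Fv b (1 : Perm β) ≠ 0 := by
  rcases h with h | h <;> rw [h] <;> simpa using irr_one_ne hχ

lemma irr_fullCyc [Nonempty β] {c : Perm β} (hc : FullCyc c) {χ : Perm β → ℂ}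
    (hχ : χ ∈ Irr (Perm β)) : χ c = 0 ∨ χ c = 1 ∨ χ c = -1 := by
  obtain ⟨b, hb⟩ := exists_bead (M := 2 * Fintype.card β + 2) (by omega) (by omega) hχ
  rw [← hb]
  rcases fullCyc_dichotomy hc (Fv_injective (Fv_exists_ne hχ (Or.inl hb))) with h | h
  · exact Or.inl h.1
  · exact Or.inr h

lemma pPart_of_OE {m n : ℕ} (hm : m ≠ 0) (hn : n ≠ 0) (h : OE m n) : pPart 2 m = pPart 2 n := by
  obtain ⟨u, w, hu, hw, h⟩ := h
  have h1 : m * u.natAbs = n * w.natAbs := by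
    have := congrArg Int.natAbs h
    simp only [Int.natAbs_mul, Int.natAbs_natCast] at this
    linarith
  have hu' : ¬ 2 ∣ u.natAbs := by
    rw [← even_iff_two_dvd, Int.natAbs_even, Int.not_even_iff_odd]; exact hu
  have hw' : ¬ 2 ∣ w.natAbs := by
    rw [← even_iff_two_dvd, Int.natAbs_even, Int.not_even_iff_odd]; exact hw
  rw [← pPart_mul_odd hm hu', h1, pPart_mul_odd hn hw']

lemma pt_full_sum [Nonempty β] {c : Perm β} (hc : FullCyc c) (y : Perm β) :
    pt (Equiv.Perm.sumCongr c y) = Fintype.card β ::ₘ pt y := by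
  rw [pt_sumCongr, hc.pt, Multiset.singleton_add]

lemma Fv_sumCongr [Nonempty β] {c : Perm β} (hc : FullCyc c) (y : Perm β) (b : Fin M → ℤ) :
    Fv b (Equiv.Perm.sumCongr c y) = ∑ i, Fv (b - Pi.single i (Fintype.card β : ℤ)) y := by
  rw [Fv, pt_full_sum hc, BA.Fm_cons, BA.coeff_pw_mul, Int.cast_sum]
  rfl

lemma comp_sub_ne {N : ℤ} (hN : N ≠ 0) {b : Fin M → ℤ} (hinj : Function.Injective b) {i j : Fin M}
    (h : ∃ w : Perm (Fin M), b - Pi.single j N = (b - Pi.single i N) ∘ w) : i = j := by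
  obtain ⟨w, hw⟩ := h
  have key : ∀ i : Fin M, ∑ p, (b - Pi.single i N : Fin M → ℤ) p ^ 2 =
      ∑ p, b p ^ 2 - 2 * N * b i + N ^ 2 := by
    intro i
    have : ∀ p, (b - Pi.single i N : Fin M → ℤ) p ^ 2 =
        b p ^ 2 + if p = i then - 2 * N * b i + N ^ 2 else 0 := by
      intro p
      by_cases hp : p = i
      · subst hp; simp; ring
      · simp [hp]
    simp only [this, Finset.sum_add_distrib, Finset.sum_ite_eq', Finset.mem_univ, if_true]
    ring
  have h1 : ∑ p, (b - Pi.single j N : Fin M → ℤ) p ^ 2 = ∑ p, (b - Pi.single i N : Fin M → ℤ) p ^ 2 := by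
    rw [hw]
    exact Equiv.sum_comp w fun p => (b - Pi.single i N : Fin M → ℤ) p ^ 2
  rw [key, key] at h1
  refine hinj (mul_left_cancel₀ hN ?_)
  linarith

lemma Fv_supp {b : Fin M → ℤ} {σ : Perm β} (h : Fv b σ ≠ 0) :
    (∀ i, 0 ≤ b i) ∧ ∑ i, b i = Fintype.card β + BA.Z M := by
  have := BA.supp_Fm (S := pt σ) (b := b) (fun h0 => h (by rw [Fv, h0, Int.cast_zero]))
  rwa [pt_sum] at this

/-- The restriction of an irreducible character of `S_{2N}` to `c × S_N`, for an `N`-cycle `c`. -/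
lemma exists_hooks {j : ℕ} (hβ : Fintype.card β = 2 ^ j) {c : Perm β} (hc : FullCyc c)
    (χ : Irr (Perm (β ⊕ β))) : ∃ a : Irr (Perm β) → ℤ,
      (∀ y : Perm β, χ.1 (Equiv.Perm.sumCongr c y) = ∑ μ, a μ * μ.1 y) ∧
      (∀ μ, a μ ≠ 0 → a μ = 1 ∨ a μ = -1) ∧
      (∀ μ ν, a μ ≠ 0 → a ν ≠ 0 → μ ≠ ν →
        a μ * μ.1 c = a ν * ν.1 c ∧ (μ.1 c = 1 ∨ μ.1 c = -1)) ∧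
      (∀ μ ν ξ, a μ ≠ 0 → a ν ≠ 0 → a ξ ≠ 0 → μ ≠ ν → μ ≠ ξ → ν = ξ) ∧
      (∀ μ, a μ ≠ 0 → μ.1 c = 0 → pPart 2 (charDeg χ.1) = 2 * pPart 2 (charDeg μ.1)) := by
  classical
  set N := Fintype.card β with hN
  have hNpos : 0 < N := by rw [hβ]; positivity
  have hne : Nonempty β := Fintype.card_pos_iff.1 hNpos
  have hcard2 : Fintype.card (β ⊕ β) = N + N := by rw [Fintype.card_sum]
  set M := 2 * Fintype.card (β ⊕ β) + 2 with hM
  have hMβ : 2 * Fintype.card β ≤ M := by omega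
  obtain ⟨b, hb⟩ := exists_bead (M := M) (by omega) (by omega) χ.2
  have hb1 := Fv_exists_ne χ.2 (Or.inl hb)
  have hinj := Fv_injective hb1
  obtain ⟨h0, hs⟩ := Fv_supp hb1
  rw [hcard2] at hs
  have hNz : (N : ℤ) ≠ 0 := by omega
  let B : Fin M → Fin M → ℤ := fun i => b - Pi.single i (N : ℤ)
  have hBF : ∀ i μ, mm (B i) μ ≠ 0 → ∀ σ, Fv (B i) σ = mm (B i) μ * μ.1 σ := fun i μ h σ =>
    Fv_eq_mm hMβ h σ
  have hBne : ∀ i (μ : Irr (Perm β)), mm (B i) μ ≠ 0 → Fv (B i) (1 : Perm β) ≠ 0 := fun i μ h => by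
    rw [hBF i μ h]
    exact mul_ne_zero (by exact_mod_cast h) (irr_one_ne μ.2)
  have hBinj : ∀ i (μ : Irr (Perm β)), mm (B i) μ ≠ 0 → Function.Injective (B i) := fun i μ h =>
    Fv_injective (hBne i μ h)
  have hB0 : ∀ i (μ : Irr (Perm β)), mm (B i) μ ≠ 0 → ∀ p, 0 ≤ B i p := fun i μ h =>
    (Fv_supp (hBne i μ h)).1
  have huniq : ∀ i k (μ : Irr (Perm β)), mm (B i) μ ≠ 0 → mm (B k) μ ≠ 0 → i = k := by
    intro i k μ hi hk
    exact comp_sub_ne hNz hinj ((mm_main hMβ hi).2.2 _ hk)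
  have huniq' : ∀ i (μ ν : Irr (Perm β)), mm (B i) μ ≠ 0 → mm (B i) ν ≠ 0 → μ = ν := by
    intro i μ ν h1 h2
    by_contra h
    exact h2 ((mm_main hMβ h1).2.1 ν (Ne.symm h))
  have hsub : ∀ (I : Finset (Fin M)), (∀ i ∈ I, ∃ μ : Irr (Perm β), mm (B i) μ ≠ 0) →
      Function.Injective (fun p => b p - if p ∈ I then (N : ℤ) else 0) ∧
      (∀ p, 0 ≤ b p - if p ∈ I then (N : ℤ) else 0) := by
    intro I hI
    constructor
    · exact BA.sub_injective hinj fun i hi => by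
        obtain ⟨μ, hμ⟩ := hI i hi
        exact hBinj i μ hμ
    · intro p
      split_ifs with hp
      · obtain ⟨μ, hμ⟩ := hI p hp
        have := hB0 p μ hμ p
        simpa [B] using this
      · simpa using h0 p
  have ha : ∀ μ : Irr (Perm β), ∑ i, mm (B i) μ ≠ 0 → ∃ i, mm (B i) μ ≠ 0 ∧ ∑ k, mm (B k) μ = mm (B i) μ := by
    intro μ hμ
    obtain ⟨i, -, hi⟩ := Finset.exists_ne_zero_of_sum_ne_zero hμ
    refine ⟨i, hi, Finset.sum_eq_single i (fun k _ hk => ?_) (by simp)⟩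
    by_contra h
    exact hk (huniq k i μ h hi)
  have htwo : ∀ i k (μ ν : Irr (Perm β)), mm (B i) μ ≠ 0 → mm (B k) ν ≠ 0 → i ≠ k →
      (BA.dl : BA M).coeff (b - Pi.single i (N : ℤ) - Pi.single k (N : ℤ)) ≠ 0 := by
    intro i k μ ν hi hk hik
    obtain ⟨h1, h2⟩ := hsub {i, k} (by
      intro l hl
      rcases Finset.mem_insert.1 hl with rfl | hl
      · exact ⟨μ, hi⟩
      · rw [Finset.mem_singleton.1 hl]; exact ⟨ν, hk⟩)
    have h3 := BA.sum_sub_ite (N : ℤ) b {i, k}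
    rw [hs, Finset.card_pair hik] at h3
    have h4 : (b - Pi.single i (N : ℤ) - Pi.single k (N : ℤ) : Fin M → ℤ) =
        fun p => b p - if p ∈ ({i, k} : Finset (Fin M)) then (N : ℤ) else 0 := by
      funext p
      simp only [Pi.sub_apply, Pi.single_apply, Finset.mem_insert, Finset.mem_singleton]
      by_cases hpi : p = i
      · have hpk : p ≠ k := fun h => hik (hpi.symm.trans h)
        simp [hpi, hik]
      · simp [hpi]
    rw [h4]
    exact BA.coeff_dl_ne_zero h1 h2 (by rw [h3]; push_cast; ring)
  refine ⟨fun μ => ∑ i, mm (B i) μ, fun y => ?_, fun μ hμ => ?_, fun μ ν hμ hν hne => ?_,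
    fun μ ν ξ hμ hν hξ hne hne' => ?_, fun μ hμ hμc => ?_⟩
  · rw [← hb, Fv_sumCongr hc]
    simp only [Int.cast_sum, Finset.sum_mul]
    rw [Finset.sum_comm]
    exact Finset.sum_congr rfl fun i _ => Fv_expand _ y
  · obtain ⟨i, hi, h1⟩ := ha μ hμ
    simp only [h1]
    exact (mm_main hMβ hi).1
  · obtain ⟨i, hi, h1⟩ := ha μ hμ
    obtain ⟨k, hk, h2⟩ := ha ν hν
    have hik : i ≠ k := by
      rintro rfl
      exact hne (huniq' i μ ν hi hk)
    simp only [h1, h2, ← hBF i μ hi, ← hBF k ν hk]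
    have e1 := htwo i k μ ν hi hk hik
    have e2 := htwo k i ν μ hk hi hik.symm
    have f1 := Fv_fullCyc_of_ne hc (hBinj i μ hi) e1
    have f2 := Fv_fullCyc_of_ne hc (hBinj k ν hk) e2
    refine ⟨?_, ?_⟩
    · rw [f1, f2]
      congr 2
      simp only [B]
      abel
    · refine (irr_fullCyc hc μ.2).resolve_left fun h => ?_
      have := hBF i μ hi c
      rw [h, mul_zero, f1] at this
      exact e1 (by exact_mod_cast this)
  · by_contra hne''
    obtain ⟨i, hi, -⟩ := ha μ hμ
    obtain ⟨k, hk, -⟩ := ha ν hν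
    obtain ⟨l, hl, -⟩ := ha ξ hξ
    have hik : i ≠ k := by rintro rfl; exact hne (huniq' i μ ν hi hk)
    have hil : i ≠ l := by rintro rfl; exact hne' (huniq' i μ ξ hi hl)
    have hkl : k ≠ l := by rintro rfl; exact hne'' (huniq' k ν ξ hk hl)
    obtain ⟨h1, h2⟩ := hsub {i, k, l} (by
      intro p hp
      simp only [Finset.mem_insert, Finset.mem_singleton] at hp
      rcases hp with rfl | rfl | rfl
      · exact ⟨μ, hi⟩
      · exact ⟨ν, hk⟩
      · exact ⟨ξ, hl⟩)
    have h3 := BA.sum_sub_ite (N : ℤ) b {i, k, l}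
    rw [hs, (Finset.card_eq_three.2 ⟨i, k, l, hik, hil, hkl, rfl⟩ : ({i, k, l} : Finset (Fin M)).card = 3)] at h3
    have h4 := BA.Z_le h1 h2
    rw [h3] at h4
    push_cast at h4
    omega
  · obtain ⟨i, hi, -⟩ := ha μ hμ
    have hbi : (N : ℤ) ≤ b i := by
      have := hB0 i μ hi i
      simpa [B] using this
    have hcore : ∀ k, (BA.dl : BA M).coeff (b - Pi.single i (N : ℤ) - Pi.single k (N : ℤ)) = 0 := by
      rcases fullCyc_dichotomy hc (hBinj i μ hi) with h | h
      · exact h.2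
      · exfalso
        rw [hBF i μ hi c, hμc, mul_zero] at h
        norm_num at h
    have hd := BA.hook_double (j := j) h0 hinj (by rw [hs, hβ]; push_cast; ring) (i := i)
      (by rw [hβ] at hbi; exact_mod_cast hbi) (by rw [← hβ]; exact hBinj i μ hi)
      (by rw [← hβ]; exact hcore)
    rw [← hβ] at hd
    have e1 : ((charDeg χ.1 : ℤ) : ℂ) = ((BA.Fm (Multiset.replicate (2 * N) 1) : BA M).coeff b : ℤ) := by
      rw [Int.cast_natCast, ← (Irr.isCh χ.2).one, ← hb, Fv, pt_one, hcard2, two_mul]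
    have e2 : ((BA.Fm (Multiset.replicate N 1) : BA M).coeff (B i) : ℂ) =
        ((mm (B i) μ * charDeg μ.1 : ℤ) : ℂ) := by
      rw [Int.cast_mul, Int.cast_natCast, ← (Irr.isCh μ.2).one, ← hBF i μ hi, Fv, pt_one]
    rw [← (Int.cast_injective e1 : _), (Int.cast_injective e2 : _)] at hd
    have hd' : OE (charDeg χ.1) ((2 * charDeg μ.1 : ℕ)) := by
      refine hd.trans ?_
      push_cast
      rcases (mm_main hMβ hi).1 with h | h <;> rw [h]
      · exact OE.of_eq (by ring)
      · exact (OE.of_eq (by ring)).trans (OE.neg _)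
    rw [pPart_of_OE (charDeg_ne_zero χ.2) (mul_ne_zero two_ne_zero (charDeg_ne_zero μ.2)) hd',
      pPart_two_mul (charDeg_ne_zero μ.2)]

end HookMatrix

section HookOrthogonality

open Equiv

lemma irr_coeff_zero {G : Type} [Group G] [Fintype G] {a : Irr G → ℂ}
    (h : ∀ g, ∑ μ, a μ * μ.1 g = 0) (μ : Irr G) : a μ = 0 := by
  refine Fintype.linearIndependent_iff.1 irr_linearIndependent a (funext fun g => ?_) μ
  simpa using h g

variable {β : Type} [Fintype β] [DecidableEq β]

lemma FullCyc.two_element {j : ℕ} (hβ : Fintype.card β = 2 ^ j) {c : Perm β} (hc : FullCyc c) :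
    ∃ m, orderOf c = 2 ^ m := by
  have hne : Nonempty β := Fintype.card_pos_iff.1 (by rw [hβ]; positivity)
  have h : orderOf c ∣ 2 ^ j := by
    rw [← Perm.lcm_cycleType]
    refine Multiset.lcm_dvd.2 fun r hr => ?_
    have h1 : r ∈ _root_.pt c := by rw [pt_eq]; exact Multiset.mem_add.2 (Or.inl hr)
    rw [hc.pt, Multiset.mem_singleton, hβ] at h1
    rw [h1]
  obtain ⟨m, -, hm⟩ := (Nat.dvd_prime_pow Nat.prime_two).1 h
  exact ⟨m, hm⟩

lemma irr_odd_ne {χ : Perm β → ℂ} (hχ : χ ∈ Irr (Perm β)) {y : Perm β}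
    (hy : ∃ m, orderOf y = 2 ^ m) (h : ¬ 2 ∣ charDeg χ) : χ y ≠ 0 := by
  obtain ⟨z, hz⟩ := irr_parity hχ hy
  intro h0
  rw [h0] at hz
  have : ((charDeg χ : ℤ) + 2 * z : ℤ) = 0 := by exact_mod_cast hz.symm
  omega

lemma irr_odd_of_unit {χ : Perm β → ℂ} (hχ : χ ∈ Irr (Perm β)) {y : Perm β}
    (hy : ∃ m, orderOf y = 2 ^ m) (h : χ y = 1 ∨ χ y = -1) : ¬ 2 ∣ charDeg χ := by
  obtain ⟨z, hz⟩ := irr_parity hχ hy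
  rcases h with h | h <;> rw [h] at hz
  · have : (1 : ℤ) = ((charDeg χ : ℤ) + 2 * z : ℤ) := by exact_mod_cast hz
    omega
  · have : (-1 : ℤ) = ((charDeg χ : ℤ) + 2 * z : ℤ) := by exact_mod_cast hz
    omega

lemma perm_oddAt {j : ℕ} (hβ : Fintype.card β = 2 ^ j) {c : Perm β} (hc : FullCyc c) :
    OddAt (Perm β) c := by
  intro ψ hψ h0
  have hne : Nonempty β := Fintype.card_pos_iff.1 (by rw [hβ]; positivity)
  have h1 := (irr_fullCyc hc hψ).resolve_left h0
  exact ⟨h1, irr_odd_of_unit hψ (hc.two_element hβ) h1⟩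

lemma sum_irr_full [Nonempty β] {c : Perm β} (hc : FullCyc c) :
    ∑ μ : Irr (Perm β), μ.1 c * μ.1 c = Fintype.card β := by
  rw [sum_irr_perm, if_pos rfl, hc.pt, ← Multiset.cons_zero, BA.zz_cons, BA.zz_zero]
  simp

lemma pt_eq_of_mem [Nonempty β] {y : Perm β} (h : Fintype.card β ∈ pt y) :
    pt y = {Fintype.card β} := by
  obtain ⟨R, hR⟩ := Multiset.exists_cons_of_mem h
  have h1 := pt_sum y
  rw [hR, Multiset.sum_cons] at h1
  have h2 : R.sum = 0 := by omega
  have h3 : R = 0 := by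
    refine Multiset.eq_zero_of_forall_notMem fun r hr => ?_
    have h4 := pt_pos y r (hR ▸ Multiset.mem_cons_of_mem hr)
    have h5 := Multiset.le_sum_of_mem hr
    omega
  rw [hR, h3]
  rfl

lemma sum_irr_column [Nonempty β] {c : Perm β} (hc : FullCyc c) (y y' : Perm β) :
    ∑ χ : Irr (Perm (β ⊕ β)), χ.1 (Equiv.Perm.sumCongr c y) * χ.1 (Equiv.Perm.sumCongr c y') =
      Fintype.card β * ∑ μ : Irr (Perm β), μ.1 y * μ.1 y' +
        (∑ μ : Irr (Perm β), μ.1 c * μ.1 y) * ∑ μ : Irr (Perm β), μ.1 c * μ.1 y' := by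
  rw [sum_irr_perm, sum_irr_perm, sum_irr_perm, sum_irr_perm, pt_full_sum hc, pt_full_sum hc, hc.pt,
    if_congr (Multiset.cons_inj_right _) rfl rfl, BA.zz_cons]
  have hz : BA.zz {Fintype.card β} = Fintype.card β := by
    rw [← Multiset.cons_zero, BA.zz_cons, BA.zz_zero]; simp
  by_cases h : pt y = pt y'
  · rw [if_pos h, if_pos h, ← h]
    by_cases h2 : pt y = {Fintype.card β}
    · rw [if_pos h2.symm, h2, hz, Multiset.count_singleton_self]
      push_cast
      ring
    · rw [if_neg (Ne.symm h2), Multiset.count_eq_zero_of_notMem fun hm => h2 (pt_eq_of_mem hm)]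
      push_cast
      ring
  · rw [if_neg h, if_neg h]
    by_cases h2 : ({Fintype.card β} : Multiset ℕ) = pt y
    · rw [if_neg (fun h3 => h (h2.symm.trans h3) : ¬ ({Fintype.card β} : Multiset ℕ) = pt y')]
      ring
    · rw [if_neg h2]
      ring

/-- The matrix of hook removals, with its orthogonality relations. -/
theorem hook_matrix {j : ℕ} (hβ : Fintype.card β = 2 ^ j) {c : Perm β} (hc : FullCyc c) :
    ∃ a : Irr (Perm (β ⊕ β)) → Irr (Perm β) → ℂ,
      (∀ χ, ∀ y : Perm β, χ.1 (Equiv.Perm.sumCongr c y) = ∑ μ, a χ μ * μ.1 y) ∧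
      (∀ χ μ, a χ μ ≠ 0 → a χ μ = 1 ∨ a χ μ = -1) ∧
      (∀ χ μ ν, a χ μ ≠ 0 → a χ ν ≠ 0 → μ ≠ ν →
        a χ μ * μ.1 c = a χ ν * ν.1 c ∧ (μ.1 c = 1 ∨ μ.1 c = -1)) ∧
      (∀ χ μ ν ξ, a χ μ ≠ 0 → a χ ν ≠ 0 → a χ ξ ≠ 0 → μ ≠ ν → μ ≠ ξ → ν = ξ) ∧
      (∀ χ μ, a χ μ ≠ 0 → μ.1 c = 0 → pPart 2 (charDeg χ.1) = 2 * pPart 2 (charDeg μ.1)) ∧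
      (∀ μ ν, ∑ χ, a χ μ * a χ ν = (if μ = ν then (Fintype.card β : ℂ) else 0) + μ.1 c * ν.1 c) ∧
      (∀ g : Perm (β ⊕ β), FullCyc g → ∀ μ, ∑ χ, χ.1 g * a χ μ = 0) := by
  classical
  have hne : Nonempty β := Fintype.card_pos_iff.1 (by rw [hβ]; positivity)
  choose a h1 h2 h3 h4 h5 using exists_hooks hβ hc
  refine ⟨fun χ μ => a χ μ, h1, fun χ μ h => ?_, fun χ μ ν hμ hν => ?_, fun χ μ ν ξ hμ hν hξ => ?_,
    fun χ μ hμ => ?_, fun μ ν => ?_, fun g hg μ => ?_⟩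
  · rcases h2 χ μ (Int.cast_ne_zero.1 h) with h | h <;> beta_reduce <;> rw [h] <;> simp
  · exact h3 χ μ ν (Int.cast_ne_zero.1 hμ) (Int.cast_ne_zero.1 hν)
  · exact h4 χ μ ν ξ (Int.cast_ne_zero.1 hμ) (Int.cast_ne_zero.1 hν) (Int.cast_ne_zero.1 hξ)
  · exact h5 χ μ (Int.cast_ne_zero.1 hμ)
  · have key : ∀ y' y : Perm β, ∑ μ : Irr (Perm β), (∑ ν : Irr (Perm β),
        (∑ χ, (a χ μ * a χ ν : ℂ) - ((if μ = ν then (Fintype.card β : ℂ) else 0) + μ.1 c * ν.1 c)) *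
          ν.1 y') * μ.1 y = 0 := by
      intro y' y
      have h := sum_irr_column hc y y'
      simp only [h1] at h
      have e1 : ∑ χ : Irr (Perm (β ⊕ β)), (∑ μ, (a χ μ : ℂ) * μ.1 y) * ∑ ν, (a χ ν : ℂ) * ν.1 y' =
          ∑ μ : Irr (Perm β), (∑ ν : Irr (Perm β), (∑ χ, (a χ μ * a χ ν : ℂ)) * ν.1 y') * μ.1 y := by
        simp only [Finset.sum_mul_sum]
        simp only [Finset.sum_mul]
        rw [Finset.sum_comm]
        refine Finset.sum_congr rfl fun μ _ => ?_
        rw [Finset.sum_comm]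
        exact Finset.sum_congr rfl fun ν _ => Finset.sum_congr rfl fun χ _ => by ring
      have e2 : (∑ μ : Irr (Perm β), μ.1 c * μ.1 y) * ∑ μ : Irr (Perm β), μ.1 c * μ.1 y' =
          ∑ μ : Irr (Perm β), (∑ ν : Irr (Perm β), (μ.1 c * ν.1 c) * ν.1 y') * μ.1 y := by
        simp only [Finset.sum_mul_sum]
        simp only [Finset.sum_mul]
        exact Finset.sum_congr rfl fun μ _ => Finset.sum_congr rfl fun ν _ => by ring
      have e3 : Fintype.card β * ∑ μ : Irr (Perm β), μ.1 y * μ.1 y' =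
          ∑ μ : Irr (Perm β), (∑ ν : Irr (Perm β),
            (if μ = ν then (Fintype.card β : ℂ) else 0) * ν.1 y') * μ.1 y := by
        rw [Finset.mul_sum]
        refine Finset.sum_congr rfl fun μ _ => ?_
        simp only [ite_mul, zero_mul, Finset.sum_ite_eq, Finset.mem_univ, if_true]
        ring
      rw [e1, e2, e3, ← Finset.sum_add_distrib, ← sub_eq_zero, ← Finset.sum_sub_distrib] at h
      refine Eq.trans ?_ h
      refine Finset.sum_congr rfl fun μ _ => ?_
      rw [← add_mul, ← sub_mul, ← Finset.sum_add_distrib, ← Finset.sum_sub_distrib]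
      congr 1
      exact Finset.sum_congr rfl fun ν _ => by ring
    have k1 := fun y' => irr_coeff_zero (key y') μ
    exact sub_eq_zero.1 (irr_coeff_zero k1 ν)
  · refine irr_coeff_zero (a := fun μ => ∑ χ, χ.1 g * (a χ μ : ℂ)) (fun y => ?_) μ
    have h := sum_irr_perm g (Equiv.Perm.sumCongr c y)
    rw [if_neg] at h
    · rw [← h]
      simp only [h1, Finset.mul_sum, Finset.sum_mul]
      rw [Finset.sum_comm]
      exact Finset.sum_congr rfl fun χ _ => Finset.sum_congr rfl fun μ _ => by ring
    · rw [hg.pt, pt_full_sum hc, ← Multiset.cons_zero]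
      intro h0
      have h2 := congrArg Multiset.card h0
      simp only [Multiset.card_cons, Multiset.card_zero] at h2
      have h3 := pt_sum y
      rw [Multiset.card_eq_zero.1 (by omega : Multiset.card (pt y) = 0)] at h3
      simp only [Multiset.sum_zero] at h3
      exact Fintype.card_ne_zero h3.symm
end HookOrthogonality

section HookCounting

variable {X Y : Type} [Fintype X] {a : X → Y → ℂ} {s : Y → ℂ} {N : ℕ}

open Classical in
lemma hook_card_of_zero (ha : ∀ χ μ, a χ μ ≠ 0 → a χ μ = 1 ∨ a χ μ = -1)
    (hgram : ∀ μ ν, ∑ χ, a χ μ * a χ ν = (if μ = ν then (N : ℂ) else 0) + s μ * s ν)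
    {ψ : Y} (hψ : s ψ = 0) : (Finset.univ.filter fun χ => a χ ψ ≠ 0).card = N := by
  have h := hgram ψ ψ
  rw [if_pos rfl, hψ, mul_zero, add_zero] at h
  have h2 : ∑ χ, a χ ψ * a χ ψ = ∑ χ, if a χ ψ ≠ 0 then (1 : ℂ) else 0 := by
    refine Finset.sum_congr rfl fun χ _ => ?_
    by_cases h0 : a χ ψ = 0
    · simp [h0]
    · rw [if_pos h0]
      rcases ha χ ψ h0 with h1 | h1 <;> rw [h1] <;> norm_num
  rw [h2, Finset.sum_boole] at h
  exact_mod_cast h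

open Classical in
lemma hook_pair_unique
    (hpair : ∀ χ μ ν, a χ μ ≠ 0 → a χ ν ≠ 0 → μ ≠ ν → a χ μ * a χ ν = s μ * s ν)
    (hgram : ∀ μ ν, ∑ χ, a χ μ * a χ ν = (if μ = ν then (N : ℂ) else 0) + s μ * s ν)
    {μ ν : Y} (hμ : s μ ≠ 0) (hν : s ν ≠ 0) (hne : μ ≠ ν) :
    ∃ χ, (a χ μ ≠ 0 ∧ a χ ν ≠ 0) ∧ ∀ χ', a χ' μ ≠ 0 → a χ' ν ≠ 0 → χ' = χ := by
  have h := hgram μ ν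
  rw [if_neg hne, zero_add] at h
  have h2 : ∑ χ, a χ μ * a χ ν = ∑ χ, if a χ μ ≠ 0 ∧ a χ ν ≠ 0 then s μ * s ν else 0 := by
    refine Finset.sum_congr rfl fun χ _ => ?_
    split_ifs with h0
    · exact hpair χ μ ν h0.1 h0.2 hne
    · by_contra h1
      exact h0 ⟨left_ne_zero_of_mul h1, right_ne_zero_of_mul h1⟩
  rw [h2, ← Finset.sum_filter, Finset.sum_const, nsmul_eq_mul,
    mul_eq_right₀ (mul_ne_zero hμ hν)] at h
  obtain ⟨χ, hχ⟩ := Finset.card_eq_one.1 (by exact_mod_cast h :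
    (Finset.univ.filter fun χ => a χ μ ≠ 0 ∧ a χ ν ≠ 0).card = 1)
  refine ⟨χ, ?_, fun χ' h1 h2 => ?_⟩
  · have : χ ∈ Finset.univ.filter fun χ => a χ μ ≠ 0 ∧ a χ ν ≠ 0 := by rw [hχ]; simp
    simpa using this
  · have : χ' ∈ Finset.univ.filter fun χ => a χ μ ≠ 0 ∧ a χ ν ≠ 0 := by simp [h1, h2]
    rw [hχ] at this
    simpa using this

open Classical in
lemma hook_single_card [Fintype Y] (ha : ∀ χ μ, a χ μ ≠ 0 → a χ μ = 1 ∨ a χ μ = -1)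
    (hpair : ∀ χ μ ν, a χ μ ≠ 0 → a χ ν ≠ 0 → μ ≠ ν → a χ μ * a χ ν = s μ * s ν)
    (htwo : ∀ χ μ ν ξ, a χ μ ≠ 0 → a χ ν ≠ 0 → a χ ξ ≠ 0 → μ ≠ ν → μ ≠ ξ → ν = ξ)
    (hs : ∀ χ μ ν, a χ μ ≠ 0 → a χ ν ≠ 0 → μ ≠ ν → s ν * s ν = 1)
    (hgram : ∀ μ ν, ∑ χ, a χ μ * a χ ν = (if μ = ν then (N : ℂ) else 0) + s μ * s ν)
    (hN : ∑ μ, s μ * s μ = N) {μ : Y} (hμ : s μ * s μ = 1) :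
    (Finset.univ.filter fun χ => a χ μ ≠ 0 ∧ ∀ ν, a χ ν ≠ 0 → ν = μ).card = 2 := by
  have hsq : ∀ χ ν, a χ ν ≠ 0 → a χ ν * a χ ν = 1 := fun χ ν h => by
    rcases ha χ ν h with h1 | h1 <;> rw [h1] <;> norm_num
  have h1 : ∑ χ, (2 * (a χ μ * a χ μ) - a χ μ * s μ * ∑ ν, a χ ν * s ν) = 2 := by
    rw [Finset.sum_sub_distrib, ← Finset.mul_sum, hgram, if_pos rfl]
    have : ∑ χ, a χ μ * s μ * ∑ ν, a χ ν * s ν = ∑ ν, s μ * s ν * ∑ χ, a χ μ * a χ ν := by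
      simp only [Finset.mul_sum]
      rw [Finset.sum_comm]
      exact Finset.sum_congr rfl fun ν _ => Finset.sum_congr rfl fun χ _ => by ring
    rw [this]
    simp only [hgram, mul_add, Finset.sum_add_distrib, mul_ite, mul_zero, Finset.sum_ite_eq,
      Finset.mem_univ, if_true]
    have : ∑ ν, s μ * s ν * (s μ * s ν) = N := by
      rw [← hN]
      exact Finset.sum_congr rfl fun ν _ => by linear_combination s ν * s ν * hμ
    rw [this, hμ]
    ring
  have h2 : ∀ χ, 2 * (a χ μ * a χ μ) - a χ μ * s μ * ∑ ν, a χ ν * s ν =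
      if a χ μ ≠ 0 ∧ ∀ ν, a χ ν ≠ 0 → ν = μ then 1 else 0 := by
    intro χ
    by_cases h0 : a χ μ = 0
    · simp [h0]
    by_cases hex : ∃ ν, a χ ν ≠ 0 ∧ ν ≠ μ
    · obtain ⟨ν, hν, hne⟩ := hex
      rw [if_neg fun h => hne (h.2 ν hν)]
      rw [Finset.sum_eq_add μ ν hne.symm (fun ξ _ hξ => ?_) (by simp) (by simp)]
      · have e1 := hpair χ μ ν h0 hν hne.symm
        have e2 := hs χ μ ν h0 hν hne.symm
        linear_combination (2 - s μ * s μ) * hsq χ μ h0 - hμ - s μ * s ν * e1 - s ν * s ν * hμ - e2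
      · by_contra h3
        exact hξ.2 (htwo χ μ ν ξ h0 hν (left_ne_zero_of_mul h3) hne.symm hξ.1.symm).symm
    · push Not at hex
      rw [if_pos ⟨h0, hex⟩, Finset.sum_eq_single μ (fun ξ _ hξ => ?_) (by simp)]
      · linear_combination (2 - s μ * s μ) * hsq χ μ h0 - hμ
      · by_contra h3
        exact hξ (hex ξ (left_ne_zero_of_mul h3))
  simp only [h2, Finset.sum_boole] at h1
  exact_mod_cast h1

open Classical in
lemma hook_single_unique [Fintype Y] {w : X → ℂ} {μ : Y} (hμ : s μ = 1 ∨ s μ = -1)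
    (ha : ∀ χ μ, a χ μ ≠ 0 → a χ μ = 1 ∨ a χ μ = -1)
    (hcard : (Finset.univ.filter fun χ => a χ μ ≠ 0 ∧ ∀ ν, a χ ν ≠ 0 → ν = μ).card = 2)
    (hw1 : ∀ χ, a χ μ ≠ 0 → (∀ ν, a χ ν ≠ 0 → ν = μ) → w χ = 1 ∨ w χ = -1)
    (hw2 : ∀ χ ν, a χ μ ≠ 0 → a χ ν ≠ 0 → ν ≠ μ → w χ = 0)
    (hw : ∑ χ, w χ * a χ μ = 0) {ε : ℂ} (hε : ε = 1 ∨ ε = -1) :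
    ∃ χ, (a χ μ ≠ 0 ∧ (∀ ν, a χ ν ≠ 0 → ν = μ) ∧ a χ μ * w χ = ε * s μ) ∧
      ∀ χ', a χ' μ ≠ 0 → (∀ ν, a χ' ν ≠ 0 → ν = μ) → a χ' μ * w χ' = ε * s μ → χ' = χ := by
  obtain ⟨x, y, hxy, h⟩ := Finset.card_eq_two.1 hcard
  have hm : ∀ χ, (a χ μ ≠ 0 ∧ ∀ ν, a χ ν ≠ 0 → ν = μ) ↔ χ = x ∨ χ = y := by
    intro χ
    have := congrArg (χ ∈ ·) h
    simpa using this
  have hx := (hm x).2 (Or.inl rfl)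
  have hy := (hm y).2 (Or.inr rfl)
  have hsum : w x * a x μ + w y * a y μ = 0 := by
    rw [← hw, Finset.sum_eq_add x y hxy (fun χ _ hχ => ?_) (by simp) (by simp)]
    by_contra h0
    have h1 := right_ne_zero_of_mul h0
    by_cases h2 : ∀ ν, a χ ν ≠ 0 → ν = μ
    · rcases (hm χ).1 ⟨h1, h2⟩ with h3 | h3
      · exact hχ.1 h3
      · exact hχ.2 h3
    · push Not at h2
      obtain ⟨ν, hν, hne⟩ := h2
      exact left_ne_zero_of_mul h0 (hw2 χ ν h1 hν hne)
  have hex : (a x μ * w x = ε * s μ ∧ a y μ * w y = - (ε * s μ)) ∨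
      (a y μ * w y = ε * s μ ∧ a x μ * w x = - (ε * s μ)) := by
    have e1 : a x μ * w x = ε * s μ ∨ a x μ * w x = - (ε * s μ) := by
      rcases ha x μ hx.1 with h1 | h1 <;> rcases hw1 x hx.1 hx.2 with h2 | h2 <;>
        rcases hε with h3 | h3 <;> rcases hμ with h4 | h4 <;> rw [h1, h2, h3, h4] <;> norm_num
    rcases e1 with e1 | e1
    · exact Or.inl ⟨e1, by linear_combination hsum - e1⟩
    · exact Or.inr ⟨by linear_combination hsum - e1, e1⟩
  have hne : ε * s μ ≠ - (ε * s μ) := by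
    rcases hε with h3 | h3 <;> rcases hμ with h4 | h4 <;> rw [h3, h4] <;> norm_num
  rcases hex with ⟨e1, e2⟩ | ⟨e1, e2⟩
  · refine ⟨x, ⟨hx.1, hx.2, e1⟩, fun χ' h1 h2 h3 => ?_⟩
    rcases (hm χ').1 ⟨h1, h2⟩ with rfl | rfl
    · rfl
    · exact absurd (h3.symm.trans e2) hne
  · refine ⟨y, ⟨hy.1, hy.2, e1⟩, fun χ' h1 h2 h3 => ?_⟩
    rcases (hm χ').1 ⟨h1, h2⟩ with rfl | rfl
    · exact absurd (h3.symm.trans e2) hne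
    · rfl

end HookCounting

section PermWrModel

open Equiv

variable {β : Type} [Fintype β] [DecidableEq β]

lemma card_oSet_perm [Nonempty β] {c : Perm β} (hc : FullCyc c) :
    Nat.card (OSet (Perm β) c) = Fintype.card β := by
  classical
  have h := sum_irr_full hc
  have h2 : ∑ μ : Irr (Perm β), μ.1 c * μ.1 c =
      ∑ μ : Irr (Perm β), if μ.1 c ≠ 0 then (1 : ℂ) else 0 := by
    refine Finset.sum_congr rfl fun μ _ => ?_
    rcases irr_fullCyc hc μ.2 with h1 | h1 | h1 <;> rw [h1] <;> norm_num
  rw [h2, Finset.sum_boole] at h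
  let e : {μ : Irr (Perm β) // μ.1 c ≠ 0} ≃ OSet (Perm β) c :=
    { toFun := fun μ => ⟨μ.1.1, μ.1.2, μ.2⟩
      invFun := fun μ => ⟨⟨μ.1, μ.2.1⟩, μ.2.2⟩
      left_inv := fun _ => rfl
      right_inv := fun _ => rfl }
  rw [← Nat.card_congr e, Nat.card_eq_fintype_card, Fintype.card_subtype]
  exact_mod_cast h

/-- Values and degrees on the irreducible characters meeting two hooks. -/
lemma pPart_of_two {χ : Perm (β ⊕ β) → ℂ} (hχ : χ ∈ Irr (Perm (β ⊕ β))) {j : ℕ}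
    {y : Perm (β ⊕ β)} (hy : pt y = {2 ^ j, 2 ^ j}) (h : χ y = 2 ∨ χ y = -2) :
    pPart 2 (charDeg χ) = 2 ∧ 2 ∣ charDeg χ := by
  obtain ⟨z, hz⟩ := irr_mod_four hχ hy
  have h1 : ∃ w : ℤ, (charDeg χ : ℤ) = 2 + 4 * w := by
    rcases h with h | h <;> rw [h] at hz
    · have : (2 : ℤ) = ((charDeg χ : ℤ) + 4 * z : ℤ) := by exact_mod_cast hz
      exact ⟨-z, by omega⟩
    · have : (-2 : ℤ) = ((charDeg χ : ℤ) + 4 * z : ℤ) := by exact_mod_cast hz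
      exact ⟨-z - 1, by omega⟩
  obtain ⟨w, hw⟩ := h1
  obtain ⟨m, hm⟩ : ∃ m, charDeg χ = 2 * m := ⟨charDeg χ / 2, by omega⟩
  refine ⟨?_, ⟨m, hm⟩⟩
  rw [hm, pPart_two_mul (by omega), pPart_of_odd (by omega)]

lemma sum_two {Y : Type} [Fintype Y] {f : Y → ℂ} {μ ν : Y} (hne : μ ≠ ν)
    (h : ∀ ξ, f ξ ≠ 0 → ξ = μ ∨ ξ = ν) : ∑ ξ, f ξ = f μ + f ν := by
  refine Finset.sum_eq_add μ ν hne (fun ξ _ hξ => ?_) (by simp) (by simp)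
  by_contra h0
  rcases h ξ h0 with h1 | h1
  · exact hξ.1 h1
  · exact hξ.2 h1

lemma sum_one {Y : Type} [Fintype Y] {f : Y → ℂ} {μ : Y}
    (h : ∀ ξ, f ξ ≠ 0 → ξ = μ) : ∑ ξ, f ξ = f μ := by
  refine Finset.sum_eq_single μ (fun ξ _ hξ => ?_) (by simp)
  by_contra h0
  exact hξ (h ξ h0)

set_option maxHeartbeats 1600000 in
theorem perm_wrModel {j : ℕ} (hβ : Fintype.card β = 2 ^ j) {c y : Perm β} (hc : FullCyc c)
    {g : Perm (β ⊕ β)} (hg : FullCyc g) (hy : ∃ m, orderOf y = 2 ^ m) :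
    WrModel (Perm (β ⊕ β)) (Equiv.Perm.sumCongr c y) g (Perm β) c y := by
  classical
  have hne : Nonempty β := Fintype.card_pos_iff.1 (by rw [hβ]; positivity)
  obtain ⟨a, hval, ha, hpr, htwo, hdeg, hgram, horth⟩ := hook_matrix hβ hc
  have hgram' : ∀ μ ν : Irr (Perm β), ∑ χ, a χ μ * a χ ν =
      @ite ℂ (μ = ν) (Classical.propDecidable _) (Fintype.card β : ℂ) 0 + μ.1 c * ν.1 c := by
    intro μ ν
    rw [hgram]
    congr
  have hccp : pt (Equiv.Perm.sumCongr c c) = {2 ^ j, 2 ^ j} := by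
    rw [pt_full_sum hc, hc.pt, hβ]; rfl
  have hcc2 : ∃ m, orderOf (Equiv.Perm.sumCongr c c) = 2 ^ m := by
    obtain ⟨m, hm⟩ := hc.two_element hβ
    have : orderOf (Equiv.Perm.sumCongr c c) ∣ 2 ^ m := by
      refine orderOf_dvd_of_pow_eq_one ?_
      have h1 : Equiv.Perm.sumCongr c c = Perm.sumCongrHom β β (c, c) := rfl
      have h2 : ((c, c) : Perm β × Perm β) ^ (2 ^ m) = 1 := by
        rw [Prod.pow_mk, ← hm, pow_orderOf_eq_one]; rfl
      rw [h1, ← map_pow, h2, map_one]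
    obtain ⟨i, -, hi⟩ := (Nat.dvd_prime_pow Nat.prime_two).1 this
    exact ⟨i, hi⟩
  have hg2 : ∃ m, orderOf g = 2 ^ m := hg.two_element (j := j + 1) (by
    rw [Fintype.card_sum, hβ]; ring)
  have hpair : ∀ χ μ ν, a χ μ ≠ 0 → a χ ν ≠ 0 → μ ≠ ν → a χ μ * a χ ν = μ.1 c * ν.1 c := by
    intro χ μ ν h1 h2 h3
    obtain ⟨e1, e2⟩ := hpr χ μ ν h1 h2 h3
    obtain ⟨-, e3⟩ := hpr χ ν μ h2 h1 h3.symm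
    have s1 : μ.1 c * μ.1 c = 1 := by rcases e2 with h | h <;> rw [h] <;> norm_num
    have s3 : a χ μ * a χ μ = 1 := by rcases ha χ μ h1 with h | h <;> rw [h] <;> norm_num
    have s2 : ν.1 c * ν.1 c = 1 := by rcases e3 with h | h <;> rw [h] <;> norm_num
    linear_combination (-a χ μ * a χ ν) * s2 - a χ μ * ν.1 c * e1 + μ.1 c * ν.1 c * s3
  have hsv : ∀ χ μ ν, a χ μ ≠ 0 → a χ ν ≠ 0 → μ ≠ ν → (ν.1 c = 1 ∨ ν.1 c = -1) :=
    fun χ μ ν h1 h2 h3 => (hpr χ ν μ h2 h1 h3.symm).2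
  have hsq : ∀ {z : ℂ}, z = 1 ∨ z = -1 → z * z = 1 := by
    rintro z (h | h) <;> rw [h] <;> norm_num
  have honly : ∀ χ μ, a χ μ ≠ 0 → μ.1 c = 0 → ∀ ν, a χ ν ≠ 0 → ν = μ := by
    intro χ μ h1 h2 ν h3
    by_contra h4
    rcases hsv χ ν μ h3 h1 h4 with h | h <;> rw [h2] at h <;> norm_num at h
  have hpairs : ∀ χ μ ν, a χ μ ≠ 0 → a χ ν ≠ 0 → μ ≠ ν → ∀ ξ, a χ ξ ≠ 0 → ξ = μ ∨ ξ = ν := by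
    intro χ μ ν h1 h2 h3 ξ h4
    by_contra! h5
    exact h5.2 (htwo χ μ ν ξ h1 h2 h4 h3 h5.1.symm).symm
  have hpairdeg : ∀ χ μ ν, a χ μ ≠ 0 → a χ ν ≠ 0 → μ ≠ ν →
      pPart 2 (charDeg χ.1) = 2 ∧ 2 ∣ charDeg χ.1 := by
    intro χ μ ν h1 h2 h3
    refine pPart_of_two χ.2 hccp ?_
    rw [hval, sum_two h3 fun ξ h4 => hpairs χ μ ν h1 h2 h3 ξ (left_ne_zero_of_mul h4)]
    obtain ⟨e1, e2⟩ := hpr χ μ ν h1 h2 h3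
    rw [← e1]
    rcases ha χ μ h1 with h | h <;> rcases e2 with h' | h' <;> rw [h, h'] <;> norm_num
  have hpairval : ∀ χ μ ν, a χ μ ≠ 0 → a χ ν ≠ 0 → μ ≠ ν →
      ∃ ε : ℂ, (ε = 1 ∨ ε = -1) ∧ χ.1 (Equiv.Perm.sumCongr c y) = ε * pairVal c y μ.1 ν.1 := by
    intro χ μ ν h1 h2 h3
    rw [hval, sum_two h3 fun ξ h4 => hpairs χ μ ν h1 h2 h3 ξ (left_ne_zero_of_mul h4)]
    obtain ⟨e1, e2⟩ := hpr χ μ ν h1 h2 h3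
    have e3 := hsv χ μ ν h1 h2 h3
    refine ⟨a χ μ * ν.1 c, ?_, ?_⟩
    · rcases ha χ μ h1 with h | h <;> rcases e3 with h' | h' <;> rw [h, h'] <;> norm_num
    · unfold pairVal
      linear_combination (-a χ μ * μ.1 y) * hsq e3 - (a χ ν * ν.1 y) * hsq e3 - ν.1 c * ν.1 y * e1
  have hpairg : ∀ χ μ ν, a χ μ ≠ 0 → a χ ν ≠ 0 → μ ≠ ν → χ.1 g = 0 := by
    intro χ μ ν h1 h2 h3
    by_contra h0
    exact irr_odd_of_unit χ.2 hg2 ((irr_fullCyc hg χ.2).resolve_left h0) (hpairdeg χ μ ν h1 h2 h3).2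
  have hsingle : ∀ χ μ, a χ μ ≠ 0 → (∀ ν, a χ ν ≠ 0 → ν = μ) → ∀ z : Perm β,
      χ.1 (Equiv.Perm.sumCongr c z) = a χ μ * μ.1 z := by
    intro χ μ _ h2 z
    rw [hval, sum_one fun ξ h4 => h2 ξ (left_ne_zero_of_mul h4)]
  have hsdeg : ∀ χ μ, a χ μ ≠ 0 → (∀ ν, a χ ν ≠ 0 → ν = μ) → (μ.1 c = 1 ∨ μ.1 c = -1) →
      ¬ 2 ∣ charDeg χ.1 := by
    intro χ μ h1 h2 h3
    refine irr_odd_of_unit χ.2 hcc2 ?_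
    rw [hsingle χ μ h1 h2]
    rcases ha χ μ h1 with h | h <;> rcases h3 with h' | h' <;> rw [h, h'] <;> norm_num
  have hsu : ∀ μ : Irr (Perm β), μ.1 c ≠ 0 → (μ.1 c = 1 ∨ μ.1 c = -1) := fun μ h =>
    (irr_fullCyc hc μ.2).resolve_left h
  intro N o
  have hN : N = Fintype.card β := by
    rw [← card_oSet_perm hc, ← Nat.card_congr o, Nat.card_fin]
  let ν : Fin N → Irr (Perm β) := fun i => ⟨(o i).1, (o i).2.1⟩
  have hνne : ∀ i, (ν i).1 c ≠ 0 := fun i => (o i).2.2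
  have hνinj : ∀ {i k}, ν i = ν k → i = k := fun {i k} h =>
    o.injective (Subtype.ext (congrArg (fun t : Irr (Perm β) => t.1) h))
  have hyne : ∀ μ : Irr (Perm β), μ.1 c ≠ 0 → μ.1 y ≠ 0 := fun μ h =>
    irr_odd_ne μ.2 hy (perm_oddAt hβ hc _ μ.2 h).2
  -- the three families
  have hE : ∀ ψ : {ψ : IrrX (Perm β) y // ψ.1 c = 0},
      Nonempty (Fin N ≃ {χ : Irr (Perm (β ⊕ β)) // a χ ⟨ψ.1.1, ψ.1.2.1⟩ ≠ 0}) := by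
    intro ψ
    refine ⟨(Fintype.equivFinOfCardEq ?_).symm⟩
    rw [Fintype.card_subtype, hN]
    exact hook_card_of_zero (s := fun μ => μ.1 c) ha hgram' ψ.2
  let E := fun ψ => (hE ψ).some
  have hP : ∀ p : Fin N × Fin N, p.1 < p.2 → ∃ χ, (a χ (ν p.1) ≠ 0 ∧ a χ (ν p.2) ≠ 0) ∧
      ∀ χ', a χ' (ν p.1) ≠ 0 → a χ' (ν p.2) ≠ 0 → χ' = χ := fun p hp =>
    hook_pair_unique (s := fun μ => μ.1 c) hpair hgram' (hνne _) (hνne _) fun h => hp.ne (hνinj h)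
  choose P hP1 hP2 using hP
  let sg : Bool → ℂ := fun b => if b then 1 else -1
  have hsg : ∀ b, sg b = 1 ∨ sg b = -1 := by intro b; cases b <;> simp [sg]
  have hT : ∀ i b, ∃ χ, (a χ (ν i) ≠ 0 ∧ (∀ μ, a χ μ ≠ 0 → μ = ν i) ∧
      a χ (ν i) * χ.1 g = sg b * (ν i).1 c) ∧ ∀ χ', a χ' (ν i) ≠ 0 →
      (∀ μ, a χ' μ ≠ 0 → μ = ν i) → a χ' (ν i) * χ'.1 g = sg b * (ν i).1 c → χ' = χ := by
    intro i b
    have hs1 := hsu _ (hνne i)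
    refine hook_single_unique (s := fun μ => μ.1 c) (w := fun χ => χ.1 g) hs1 ha
      (hook_single_card (s := fun μ => μ.1 c) ha hpair htwo (fun χ μ ν h1 h2 h3 => hsq (hsv χ μ ν h1 h2 h3)) hgram'
        (sum_irr_full hc) (hsq hs1)) (fun χ h1 h2 => ?_)
        (fun χ μ h1 h2 h3 => hpairg χ _ _ h1 h2 h3.symm) (horth g hg _) (hsg b)
    exact (irr_fullCyc hg χ.2).resolve_left (irr_odd_ne χ.2 hg2 (hsdeg χ _ h1 h2 hs1))
  choose T hT1 hT2 using hT
  let F : ({ψ : IrrX (Perm β) y // ψ.1 c = 0} × Fin N) ⊕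
        ({p : Fin N × Fin N // p.1 < p.2 ∧ pairVal c y (o p.1).1 (o p.2).1 ≠ 0} ⊕
          (Fin N × Bool)) → Irr (Perm (β ⊕ β)) := fun t =>
    match t with
    | .inl (ψ, i) => (E ψ i).1
    | .inr (.inl p) => P p.1 p.2.1
    | .inr (.inr (i, b)) => T i b
  have hF1 : ∀ ψ i, ((F (.inl (ψ, i))).1 (Equiv.Perm.sumCongr c y) = ψ.1.1 y ∨
      (F (.inl (ψ, i))).1 (Equiv.Perm.sumCongr c y) = - ψ.1.1 y) := by
    intro ψ i
    have h1 := (E ψ i).2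
    have h2 := hsingle _ _ h1 (honly _ _ h1 ψ.2) y
    change (E ψ i).1.1 _ = _ ∨ (E ψ i).1.1 _ = _
    rw [h2]
    rcases ha _ _ h1 with h | h <;> rw [h] <;> simp
  have hF2 : ∀ p, ((F (.inr (.inl p))).1 (Equiv.Perm.sumCongr c y) =
        pairVal c y (o p.1.1).1 (o p.1.2).1 ∨
      (F (.inr (.inl p))).1 (Equiv.Perm.sumCongr c y) =
        - pairVal c y (o p.1.1).1 (o p.1.2).1) := by
    intro p
    obtain ⟨ε, hε, h⟩ := hpairval _ _ _ (hP1 p.1 p.2.1).1 (hP1 p.1 p.2.1).2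
      fun h => p.2.1.ne (hνinj h)
    change (P p.1 p.2.1).1 _ = _ ∨ (P p.1 p.2.1).1 _ = _
    rw [h]
    rcases hε with h | h <;> rw [h] <;> simp [ν]
  have hF3 : ∀ i b, ((F (.inr (.inr (i, b)))).1 (Equiv.Perm.sumCongr c y) = (o i).1 y ∨
          (F (.inr (.inr (i, b)))).1 (Equiv.Perm.sumCongr c y) = - (o i).1 y) := by
    intro i b
    have h1 := hT1 i b
    have h2 := hsingle _ _ h1.1 h1.2.1 y
    change (T i b).1 _ = _ ∨ (T i b).1 _ = _
    rw [h2]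
    rcases ha _ _ h1.1 with h | h <;> rw [h] <;> simp [ν]
  have hFne : ∀ t, (F t).1 (Equiv.Perm.sumCongr c y) ≠ 0 := by
    rintro (⟨ψ, i⟩ | p | ⟨i, b⟩)
    · rcases hF1 ψ i with h | h <;> rw [h]
      · exact ψ.1.2.2
      · exact neg_ne_zero.2 ψ.1.2.2
    · rcases hF2 p with h | h <;> rw [h]
      · exact p.2.2
      · exact neg_ne_zero.2 p.2.2
    · rcases hF3 i b with h | h <;> rw [h]
      · exact hyne (ν i) (hνne i)
      · exact neg_ne_zero.2 (hyne (ν i) (hνne i))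
  have hFinj : Function.Injective F := by
    have h12 : ∀ ψ i p, F (.inl (ψ, i)) ≠ F (.inr (.inl p)) := by
      intro ψ i p h
      have h1 := (E ψ i).2
      have h2 := hP1 p.1 p.2.1
      change (E ψ i).1 = P p.1 p.2.1 at h
      rw [← h] at h2
      have e := honly _ _ h1 ψ.2
      exact p.2.1.ne (hνinj ((e _ h2.1).trans (e _ h2.2).symm))
    have h13 : ∀ ψ i k b, F (.inl (ψ, i)) ≠ F (.inr (.inr (k, b))) := by
      intro ψ i k b h
      have h1 := (E ψ i).2
      have h2 := hT1 k b
      change (E ψ i).1 = T k b at h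
      rw [← h] at h2
      have e := h2.2.1 _ h1
      have e2 := hνne k
      rw [← e] at e2
      exact e2 ψ.2
    have h23 : ∀ p k b, F (.inr (.inl p)) ≠ F (.inr (.inr (k, b))) := by
      intro p k b h
      have h1 := hP1 p.1 p.2.1
      have h2 := hT1 k b
      change P p.1 p.2.1 = T k b at h
      rw [← h] at h2
      exact p.2.1.ne (hνinj ((h2.2.1 _ h1.1).trans (h2.2.1 _ h1.2).symm))
    rintro (⟨ψ, i⟩ | p | ⟨i, b⟩) (⟨φ, k⟩ | q | ⟨k, d⟩) h
    · have h1 := (E ψ i).2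
      have h2 := (E φ k).2
      change (E ψ i).1 = (E φ k).1 at h
      have h3 := h2
      rw [← h] at h3
      have e := honly _ _ h1 ψ.2 _ h3
      have e' : φ = ψ := Subtype.ext (Subtype.ext (congrArg (fun t : Irr (Perm β) => t.1) e))
      subst e'
      rw [(E φ).injective (Subtype.ext h)]
    · exact absurd h (h12 _ _ _)
    · exact absurd h (h13 _ _ _ _)
    · exact absurd h.symm (h12 _ _ _)
    · have h1 := hP1 p.1 p.2.1
      have h2 := hP1 q.1 q.2.1
      change P p.1 p.2.1 = P q.1 q.2.1 at h
      rw [← h] at h2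
      have e := hpairs _ _ _ h1.1 h1.2 fun h => p.2.1.ne (hνinj h)
      have hp := p.2.1
      have hq := q.2.1
      have : p = q := by
        refine Subtype.ext (Prod.ext ?_ ?_)
        · rcases e _ h2.1 with e1 | e1 <;> rcases e _ h2.2 with e2 | e2 <;>
            have := hνinj e1 <;> have := hνinj e2 <;> omega
        · rcases e _ h2.1 with e1 | e1 <;> rcases e _ h2.2 with e2 | e2 <;>
            have := hνinj e1 <;> have := hνinj e2 <;> omega
      rw [this]
    · exact absurd h (h23 _ _ _)
    · exact absurd h.symm (h13 _ _ _ _)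
    · exact absurd h.symm (h23 _ _ _)
    · have h1 := hT1 i b
      have h2 := hT1 k d
      change T i b = T k d at h
      rw [← h] at h2
      have e := hνinj (h1.2.1 _ h2.1)
      subst e
      have e2 := mul_right_cancel₀ (hνne k) (h1.2.2.symm.trans h2.2.2)
      have : b = d := by
        cases b <;> cases d <;> simp [sg] at e2 ⊢ <;> norm_num at e2
      rw [this]
  have hFsurj : ∀ χ : Irr (Perm (β ⊕ β)), χ.1 (Equiv.Perm.sumCongr c y) ≠ 0 → ∃ t, F t = χ := by
    intro χ hχ
    have hex : ∃ μ, a χ μ ≠ 0 := by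
      by_contra! h
      exact hχ (by rw [hval]; simp [h])
    obtain ⟨μ, hμ⟩ := hex
    by_cases h1 : ∀ ξ, a χ ξ ≠ 0 → ξ = μ
    · have h2 := hsingle χ μ hμ h1 y
      by_cases h3 : μ.1 c = 0
      · let ψ : {ψ : IrrX (Perm β) y // ψ.1 c = 0} :=
          ⟨⟨μ.1, μ.2, fun h => hχ (by rw [h2, h, mul_zero])⟩, h3⟩
        obtain ⟨i, hi⟩ := (E ψ).surjective ⟨χ, hμ⟩
        exact ⟨.inl (ψ, i), congrArg Subtype.val hi⟩
      · obtain ⟨i, hi⟩ := o.surjective ⟨μ.1, μ.2, h3⟩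
        have hi' : ν i = μ := Subtype.ext (congrArg (fun t : OSet (Perm β) c => t.1) hi)
        subst hi'
        have h4 := (irr_fullCyc hg χ.2).resolve_left (irr_odd_ne χ.2 hg2
          (hsdeg χ _ hμ h1 (hsu _ h3)))
        have h5 : ∃ b, a χ (ν i) * χ.1 g = sg b * (ν i).1 c := by
          have : a χ (ν i) * χ.1 g = (ν i).1 c ∨ a χ (ν i) * χ.1 g = - (ν i).1 c := by
            rcases ha χ _ hμ with e1 | e1 <;> rcases h4 with e2 | e2 <;>
              rcases hsu _ h3 with e3 | e3 <;> rw [e1, e2, e3] <;> norm_num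
          rcases this with h | h
          · exact ⟨true, by rw [h]; simp [sg]⟩
          · exact ⟨false, by rw [h]; simp [sg]⟩
        obtain ⟨b, hb⟩ := h5
        exact ⟨.inr (.inr (i, b)), (hT2 i b χ hμ h1 hb).symm⟩
    · push Not at h1
      obtain ⟨ξ, hξ, hne⟩ := h1
      obtain ⟨i, hi⟩ := o.surjective ⟨μ.1, μ.2, fun h0 => by
        rcases hsv χ ξ μ hξ hμ hne with h | h <;> rw [h0] at h <;> norm_num at h⟩
      obtain ⟨k, hk⟩ := o.surjective ⟨ξ.1, ξ.2, fun h0 => by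
        rcases hsv χ μ ξ hμ hξ hne.symm with h | h <;> rw [h0] at h <;> norm_num at h⟩
      have hi' : ν i = μ := Subtype.ext (congrArg (fun t : OSet (Perm β) c => t.1) hi)
      have hk' : ν k = ξ := Subtype.ext (congrArg (fun t : OSet (Perm β) c => t.1) hk)
      subst hi' hk'
      have main : ∀ i k, i < k → a χ (ν i) ≠ 0 → a χ (ν k) ≠ 0 → ∃ t, F t = χ := by
        intro i k hik h1 h2
        refine ⟨.inr (.inl ⟨(i, k), hik, fun h0 => hχ ?_⟩), (hP2 (i, k) hik χ h1 h2).symm⟩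
        obtain ⟨ε, -, h⟩ := hpairval χ _ _ h1 h2 fun h => hik.ne (hνinj h)
        rw [h]
        exact (congrArg (ε * ·) h0).trans (mul_zero _)
      rcases lt_trichotomy i k with h | h | h
      · exact main i k h hμ hξ
      · exact absurd (by rw [h]) hne
      · exact main k i h hξ hμ
  let F' := fun t => (⟨(F t).1, (F t).2, hFne t⟩ : IrrX (Perm (β ⊕ β)) (Equiv.Perm.sumCongr c y))
  have hbij : Function.Bijective F' := by
    constructor
    · intro t t' h
      exact hFinj (Subtype.ext (congrArg (fun u : IrrX _ _ => u.1) h))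
    · intro χ
      obtain ⟨t, ht⟩ := hFsurj ⟨χ.1, χ.2.1⟩ χ.2.2
      exact ⟨t, Subtype.ext (congrArg (fun u : Irr (Perm (β ⊕ β)) => u.1) ht)⟩
  refine ⟨Equiv.ofBijective F' hbij, fun ψ i => ⟨hF1 ψ i, ?_⟩, fun p => ⟨hF2 p, ?_⟩,
    fun i b => ⟨hF3 i b, ?_, ?_⟩⟩
  · exact hdeg _ _ (E ψ i).2 ψ.2
  · exact (hpairdeg _ _ _ (hP1 p.1 p.2.1).1 (hP1 p.1 p.2.1).2 fun h => p.2.1.ne (hνinj h)).1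
  · have h1 := hT1 i b
    have h2 := hsingle _ _ h1.1 h1.2.1 y
    change (T i b).1 _ * (T i b).1 g = sg b * ((ν i).1 y * (ν i).1 c)
    rw [h2]
    linear_combination (ν i).1 y * h1.2.2
  · exact pPart_of_odd (hsdeg _ _ (hT1 i b).1 (hT1 i b).2.1 (hsu _ (hνne i)))

end PermWrModel

section Subnormalizers

variable {G : Type} [Group G]

/-- `h` normalizes a `2`-subgroup containing `x`. -/
def Good (x h : G) : Prop :=
  ∃ N : Subgroup G, IsPGroup 2 N ∧ x ∈ N ∧ ∀ n ∈ N, h * n * h⁻¹ ∈ N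

variable [Finite G]

lemma conj_mem_iff {N : Subgroup G} {h : G} (hN : ∀ n ∈ N, h * n * h⁻¹ ∈ N) (n : G) :
    h * n * h⁻¹ ∈ N ↔ n ∈ N := by
  refine ⟨fun h1 => ?_, hN n⟩
  have h2 : N.map (MulAut.conj h).toMonoidHom = N := by
    refine Subgroup.eq_of_le_of_card_ge ?_ ?_
    · rintro _ ⟨m, hm, rfl⟩
      exact hN m hm
    · rw [Subgroup.card_map_of_injective (MulAut.conj h).injective]
  rw [← h2] at h1
  obtain ⟨m, hm, e⟩ := h1
  have : h * m * h⁻¹ = h * n * h⁻¹ := e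
  rw [mul_left_inj, mul_right_inj] at this
  exact this ▸ hm

lemma mem_normalizer_of_conj {N : Subgroup G} {h : G} (hN : ∀ n ∈ N, h * n * h⁻¹ ∈ N) :
    h ∈ Subgroup.normalizer (N : Set G) :=
  Subgroup.mem_normalizer_iff.2 fun n => (conj_mem_iff hN n).symm

lemma isSubnormalIn_of_isPGroup {M : Subgroup G} (hM : IsPGroup 2 M) {H : Subgroup G} (h : H ≤ M) :
    IsSubnormalIn H M := by
  induction hn : Nat.card M - Nat.card H using Nat.strong_induction_on generalizing H with
  | _ n ih =>
  rcases eq_or_lt_of_le h with rfl | hlt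
  · exact Relation.ReflTransGen.refl
  have hnil : Group.IsNilpotent M := hM.isNilpotent
  have hlt' : H.subgroupOf M < ⊤ := by
    rw [lt_top_iff_ne_top]
    intro h1
    exact hlt.not_ge (Subgroup.subgroupOf_eq_top.1 h1)
  obtain ⟨m, hm, hm'⟩ := SetLike.exists_of_lt
    (Group.normalizerCondition_of_isNilpotent (G := M) _ hlt')
  have hnorm : (m : G) ∈ Subgroup.normalizer (H : Set G) := by
    refine mem_normalizer_of_conj fun n hn => ?_
    have := (Subgroup.mem_normalizer_iff.1 hm ⟨n, h hn⟩).1 (Subgroup.mem_subgroupOf.2 hn)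
    exact Subgroup.mem_subgroupOf.1 this
  have hle : H ≤ M ⊓ Subgroup.normalizer (H : Set G) := le_inf h Subgroup.le_normalizer
  have hlt2 : H < M ⊓ Subgroup.normalizer (H : Set G) := by
    refine lt_of_le_of_ne hle fun he => hm' (Subgroup.mem_subgroupOf.2 ?_)
    rw [he]
    exact ⟨m.2, hnorm⟩
  have hc1 : Nat.card H < Nat.card (M ⊓ Subgroup.normalizer (H : Set G) : Subgroup G) := by
    by_contra! h1
    exact hlt2.ne (Subgroup.eq_of_le_of_card_ge hle h1)
  have hc2 : Nat.card (M ⊓ Subgroup.normalizer (H : Set G) : Subgroup G) ≤ Nat.card M :=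
    Subgroup.card_le_of_le inf_le_left
  refine Relation.ReflTransGen.head ⟨hle, fun k hk n hn => ?_⟩
    (ih _ (by omega) (H := M ⊓ Subgroup.normalizer (H : Set G)) inf_le_left rfl)
  exact (Subgroup.mem_normalizer_iff.1 hk.2 n).1 hn

lemma isSubnormalIn_of_good {x h : G} (hg : Good x h) :
    IsSubnormalIn (Subgroup.zpowers x) (Subgroup.closure {x, h}) := by
  obtain ⟨N, hN, hx, hh⟩ := hg
  have hx' : x ∈ Subgroup.closure {x, h} := Subgroup.subset_closure (by simp)
  refine (isSubnormalIn_of_isPGroup (hN.to_le (inf_le_left : N ⊓ Subgroup.closure {x, h} ≤ N))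
    ?_).tail ⟨inf_le_right, fun k hk n hn => ⟨?_, ?_⟩⟩
  · rw [Subgroup.zpowers_le]
    exact ⟨hx, hx'⟩
  · have h1 : Subgroup.closure {x, h} ≤ Subgroup.normalizer (N : Set G) := by
      rw [Subgroup.closure_le]
      rintro k (rfl | rfl)
      · exact Subgroup.le_normalizer hx
      · exact mem_normalizer_of_conj hh
    exact (Subgroup.mem_normalizer_iff.1 (h1 hk) n).1 hn.1
  · exact Subgroup.mul_mem _ (Subgroup.mul_mem _ hk hn.2) (Subgroup.inv_mem _ hk)

lemma exists_normalIn_of_subnormal {x : G} {H K : Subgroup G} (h : IsSubnormalIn H K)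
    (hH : ∃ N : Subgroup G, IsPGroup 2 N ∧ x ∈ N ∧ NormalIn N H) :
    ∃ N : Subgroup G, IsPGroup 2 N ∧ x ∈ N ∧ NormalIn N K := by
  induction h with
  | refl => exact hH
  | @tail A B _ hAB ih =>
    obtain ⟨N, hN, hx, hNA⟩ := ih
    let S : Set (Subgroup G) := {M | IsPGroup 2 M ∧ NormalIn M A}
    obtain ⟨M, hM, hmax⟩ := Set.exists_max_image S (fun M => Nat.card M) (Set.toFinite S)
      ⟨N, hN, hNA⟩
    have htop : ∀ M' ∈ S, M' ≤ M := by
      intro M' hM'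
      have hle : M' ≤ Subgroup.normalizer (M : Set G) := fun m hm =>
        mem_normalizer_of_conj fun n hn => hM.2.2 m (hM'.2.1 hm) n hn
      have hS : M' ⊔ M ∈ S := by
        refine ⟨hM'.1.to_sup_of_normal_right' hM.1 hle, sup_le hM'.2.1 hM.2.1, fun k hk n hn => ?_⟩
        have h1 : (M' ⊔ M).map (MulAut.conj k).toMonoidHom ≤ M' ⊔ M := by
          rw [Subgroup.map_sup]
          refine sup_le_sup ?_ ?_
          · rintro _ ⟨m, hm, rfl⟩
            exact hM'.2.2 k hk m hm
          · rintro _ ⟨m, hm, rfl⟩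
            exact hM.2.2 k hk m hm
        exact h1 ⟨n, hn, rfl⟩
      have := Subgroup.eq_of_le_of_card_ge (le_sup_right : M ≤ M' ⊔ M) (hmax _ hS)
      rw [this]
      exact le_sup_left
    refine ⟨M, hM.1, htop N ⟨hN, hNA⟩ hx, hM.2.1.trans hAB.1, fun k hk n hn => ?_⟩
    have hS : M.map (MulAut.conj k).toMonoidHom ∈ S := by
      refine ⟨hM.1.map _, ?_, ?_⟩
      · rintro _ ⟨m, hm, rfl⟩
        exact hAB.2 k hk m (hM.2.1 hm)
      · rintro l hl _ ⟨m, hm, rfl⟩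
        have hkl : k⁻¹ * l * k ∈ A := by
          simpa using hAB.2 k⁻¹ (inv_mem hk) l hl
        refine ⟨_, hM.2.2 _ hkl m hm, ?_⟩
        simp [mul_assoc]
    exact htop _ hS ⟨n, hn, rfl⟩

lemma isPGroup_zpowers {G : Type} [Group G] {x : G} (hx : ∃ m, orderOf x = 2 ^ m) :
    IsPGroup 2 (Subgroup.zpowers x) := by
  obtain ⟨m, hm⟩ := hx
  exact IsPGroup.of_card (n := m) (by rw [Nat.card_zpowers, hm])

lemma good_of_isSubnormalIn {x h : G} (hx : ∃ m, orderOf x = 2 ^ m)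
    (hs : IsSubnormalIn (Subgroup.zpowers x) (Subgroup.closure {x, h})) : Good x h := by
  obtain ⟨N, h1, h2, h3⟩ := exists_normalIn_of_subnormal (x := x) hs
    ⟨Subgroup.zpowers x, isPGroup_zpowers hx, Subgroup.mem_zpowers x, le_rfl, fun k hk n hn =>
      mul_mem (mul_mem hk hn) (inv_mem hk)⟩
  exact ⟨N, h1, h2, h3.2 h (Subgroup.subset_closure (by simp))⟩

lemma Good.mem {x h : G} (hg : Good x h) : h ∈ subnormalizer x :=
  Subgroup.subset_closure (isSubnormalIn_of_good hg)

lemma subnormalizer_le {x : G} (hx : ∃ m, orderOf x = 2 ^ m) {K : Subgroup G}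
    (h : ∀ h, Good x h → h ∈ K) : subnormalizer x ≤ K :=
  (Subgroup.closure_le _).2 fun _ hk => h _ (good_of_isSubnormalIn hx hk)

lemma le_subnormalizer {x : G} {N : Subgroup G} (hN : IsPGroup 2 N) (hx : x ∈ N) :
    N ≤ subnormalizer x := fun _ hn =>
  Good.mem ⟨N, hN, hx, fun _ hm => mul_mem (mul_mem hn hm) (inv_mem hn)⟩

lemma mem_subnormalizer_of_commute {x h : G} (hx : ∃ m, orderOf x = 2 ^ m) (hc : h * x = x * h) :
    h ∈ subnormalizer x := by
  refine Good.mem ⟨Subgroup.zpowers x, isPGroup_zpowers hx, Subgroup.mem_zpowers x, ?_⟩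
  rintro _ ⟨n, rfl⟩
  have : Commute h (x ^ n) := Commute.zpow_right hc n
  show h * x ^ n * h⁻¹ ∈ _
  rw [this.eq, mul_inv_cancel_right]
  exact ⟨n, rfl⟩

lemma Good.mulEquiv {G G' : Type} [Group G] [Group G'] (e : G ≃* G') {x h : G} (hg : Good x h) :
    Good (e x) (e h) := by
  obtain ⟨N, h1, h2, h3⟩ := hg
  refine ⟨N.map e.toMonoidHom, h1.map _, ⟨x, h2, rfl⟩, ?_⟩
  rintro _ ⟨n, hn, rfl⟩
  exact ⟨_, h3 n hn, by simp⟩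

lemma orderOf_two_mulEquiv {G G' : Type} [Group G] [Group G'] (e : G ≃* G') {x : G}
    (hx : ∃ m, orderOf x = 2 ^ m) : ∃ m, orderOf (e x) = 2 ^ m := by
  rwa [MulEquiv.orderOf_eq]

lemma subnormalizer_map_le {G' : Type} [Group G'] (e : G ≃* G') {x : G}
    (hx : ∃ m, orderOf x = 2 ^ m) :
    (subnormalizer x).map e.toMonoidHom ≤ subnormalizer (e x) := by
  have : Finite G' := Finite.of_equiv _ e.toEquiv
  rw [Subgroup.map_le_iff_le_comap]
  exact subnormalizer_le hx fun h hg => (hg.mulEquiv e).mem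

lemma subnormalizer_map {G' : Type} [Group G'] (e : G ≃* G') {x : G}
    (hx : ∃ m, orderOf x = 2 ^ m) :
    (subnormalizer x).map e.toMonoidHom = subnormalizer (e x) := by
  have : Finite G' := Finite.of_equiv _ e.toEquiv
  refine le_antisymm (subnormalizer_map_le e hx) fun h hh => ?_
  have h1 := subnormalizer_map_le e.symm (orderOf_two_mulEquiv e hx) ⟨h, hh, rfl⟩
  rw [e.symm_apply_apply] at h1
  exact ⟨_, h1, e.apply_symm_apply h⟩

/-- A subgroup of odd index contains a conjugate of any `2`-subgroup. -/
lemma exists_conj_le {G : Type} [Group G] {P W : Subgroup G} (hP : IsPGroup 2 P) (hW : ¬ 2 ∣ W.index) :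
    ∃ u : G, ∀ p ∈ P, u⁻¹ * p * u ∈ W := by
  obtain ⟨q, hq⟩ := hP.nonempty_fixed_point_of_prime_not_dvd_card (G ⧸ W) hW
  obtain ⟨u, rfl⟩ := QuotientGroup.mk_surjective q
  refine ⟨u, fun p hp => ?_⟩
  have h1 := hq ⟨p, hp⟩
  have h2 : ((p * u : G) : G ⧸ W) = (u : G ⧸ W) := h1
  have h3 := QuotientGroup.eq.1 h2.symm
  rwa [← mul_assoc] at h3

lemma exists_sylow {x : G} (hx : ∃ m, orderOf x = 2 ^ m) : ∃ Q : Sylow 2 G, x ∈ Q := by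
  obtain ⟨Q, hQ⟩ := (isPGroup_zpowers hx).exists_le_sylow
  exact ⟨Q, hQ (Subgroup.mem_zpowers x)⟩

lemma Sylow.not_dvd_index_two (Q : Sylow 2 G) : ¬ 2 ∣ (Q : Subgroup G).index :=
  Q.not_dvd_index

lemma not_dvd_index_of_le {G : Type} [Group G] {H K : Subgroup G} (h : H ≤ K) (hH : ¬ 2 ∣ H.index) : ¬ 2 ∣ K.index :=
  fun h1 => hH (h1.trans (Subgroup.index_dvd_of_le h))

lemma subnormalizer_index {x : G} (hx : ∃ m, orderOf x = 2 ^ m) :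
    ¬ 2 ∣ (subnormalizer x).index := by
  obtain ⟨Q, hQ⟩ := exists_sylow hx
  exact not_dvd_index_of_le (le_subnormalizer Q.2 hQ) Q.not_dvd_index_two

/-- If the subnormalizer of `c` is a `2`-group then it lies in every overgroup of `c` of odd
index. -/
lemma subnormalizer_le_of_index {c : G} (hc : ∃ m, orderOf c = 2 ^ m)
    (hS : IsPGroup 2 (subnormalizer c)) {H : Subgroup G} (hH : ¬ 2 ∣ H.index) (hcH : c ∈ H) :
    subnormalizer c ≤ H := by
  have h1 : ∃ m, orderOf (⟨c, hcH⟩ : H) = 2 ^ m := by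
    rwa [Subgroup.orderOf_mk]
  obtain ⟨Q, hQ⟩ := exists_sylow h1
  have hQ2 : IsPGroup 2 ((Q : Subgroup H).map H.subtype) := Q.2.map _
  have h2 : (Q : Subgroup H).map H.subtype ≤ subnormalizer c := le_subnormalizer hQ2 ⟨_, hQ, rfl⟩
  have h3 : ¬ 2 ∣ ((Q : Subgroup H).map H.subtype).index := by
    rw [Subgroup.index_map_subtype, Nat.prime_two.dvd_mul]
    exact not_or.2 ⟨Q.not_dvd_index_two, hH⟩
  have h4 : (Q : Subgroup H).map H.subtype = subnormalizer c := by
    have := (hQ2.toSylow h3).3 hS h2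
    exact this.symm
  rw [← h4]
  rintro _ ⟨q, -, rfl⟩
  exact q.2

lemma mem_of_conj_mem {c h : G} (hc : ∃ m, orderOf c = 2 ^ m)
    (hS : IsPGroup 2 (subnormalizer c)) {H : Subgroup G} (hH : ¬ 2 ∣ H.index) (hcH : c ∈ H)
    (hch : h * c * h⁻¹ ∈ H) : h ∈ H := by
  have hSc := subnormalizer_le_of_index hc hS hH hcH
  let e := MulAut.conj h
  have hS' : IsPGroup 2 (subnormalizer (e c)) := by
    rw [← subnormalizer_map e hc]
    exact hS.map _
  have hSc' := subnormalizer_le_of_index (orderOf_two_mulEquiv e hc) hS' hH hch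
  have hle : ∀ n ∈ subnormalizer c, h * n * h⁻¹ ∈ H := by
    intro n hn
    refine hSc' ?_
    rw [← subnormalizer_map e hc]
    exact ⟨n, hn, rfl⟩
  -- both `2`-subgroups are Sylow in `H`
  let P1 : Subgroup H := (subnormalizer c).subgroupOf H
  let P2 : Subgroup H := (subnormalizer (e c)).subgroupOf H
  have hp2 : IsPGroup 2 P2 := hS'.comap_subtype
  have hi1 : ¬ 2 ∣ P1.index := by
    intro h1
    apply subnormalizer_index hc
    rw [← Subgroup.relIndex_mul_index hSc]
    exact h1.mul_right _
  obtain ⟨u, hu⟩ := exists_conj_le hp2 hi1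
  have hg : ∀ n ∈ subnormalizer c, ((u : G)⁻¹ * h) * n * ((u : G)⁻¹ * h)⁻¹ ∈ subnormalizer c := by
    intro n hn
    have h1 : (⟨h * n * h⁻¹, hle n hn⟩ : H) ∈ P2 := by
      refine Subgroup.mem_subgroupOf.2 ?_
      rw [← subnormalizer_map e hc]
      exact ⟨n, hn, rfl⟩
    have h2 := Subgroup.mem_subgroupOf.1 (hu _ h1)
    have h3 : ((u : G)⁻¹ * h) * n * ((u : G)⁻¹ * h)⁻¹ = (u : G)⁻¹ * (h * n * h⁻¹) * u := by group
    rw [h3]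
    exact h2
  have h4 : (u : G)⁻¹ * h ∈ subnormalizer c :=
    Good.mem ⟨_, hS, mem_subnormalizer_self c, hg⟩
  have h5 := mul_mem u.2 (hSc h4)
  rwa [mul_inv_cancel_left] at h5

end Subnormalizers

section Halvings

open Equiv Equiv.Perm

/-- The wreath product of a permutation group with the swap, acting on two copies of the set. -/
def wrMap {β : Type} (K : Subgroup (Perm β)) : Wr K →* Perm (β ⊕ β) where
  toFun p := Equiv.Perm.sumCongr p.a p.b * cond p.s (Equiv.sumComm β β) 1
  map_one' := by
    ext (q | q) <;> simp [Wr.one_def]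
  map_mul' := by
    rintro ⟨a, b, _ | _⟩ ⟨a', b', _ | _⟩ <;> ext (q | q) <;> simp [Wr.mul_def]

lemma wrMap_apply {β : Type} (K : Subgroup (Perm β)) (p : Wr K) :
    wrMap K p = Equiv.Perm.sumCongr p.a p.b * cond p.s (Equiv.sumComm β β) 1 := rfl

lemma wrMap_injective {β : Type} [Nonempty β] (K : Subgroup (Perm β)) :
    Function.Injective (wrMap K) := by
  have h0 : Nonempty β := inferInstance
  obtain ⟨z⟩ := h0
  rintro ⟨a, b, s⟩ ⟨a', b', s'⟩ h
  rw [wrMap_apply, wrMap_apply] at h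
  have h1 : s = s' := by
    have h2 := DFunLike.congr_fun h (Sum.inl z)
    rcases s with _ | _ <;> rcases s' with _ | _ <;> simp at h2 ⊢
  subst h1
  have hl : ∀ q, _ := fun q => DFunLike.congr_fun h (Sum.inl q)
  have hr : ∀ q, _ := fun q => DFunLike.congr_fun h (Sum.inr q)
  have hab : a = a' ∧ b = b' := by
    rcases s with _ | _
    · simp only [cond_false, mul_one, Equiv.Perm.sumCongr_apply, Sum.map_inl, Sum.map_inr,
        Sum.inl.injEq, Sum.inr.injEq] at hl hr
      exact ⟨Subtype.ext (Equiv.ext hl), Subtype.ext (Equiv.ext hr)⟩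
    · simp only [cond_true, Perm.mul_apply, Equiv.Perm.sumCongr_apply, Equiv.sumComm_apply,
        Sum.swap_inl, Sum.swap_inr, Sum.map_inl, Sum.map_inr,
        Sum.inl.injEq, Sum.inr.injEq] at hl hr
      exact ⟨Subtype.ext (Equiv.ext hr), Subtype.ext (Equiv.ext hl)⟩
  rw [hab.1, hab.2]

/-- The permutation preserves the partition into the two colour classes of `f`. -/
def Pres {α : Type} (f : α → Bool) (σ : Perm α) : Prop := ∃ s : Bool, ∀ p, f (σ p) = xor s (f p)

lemma mem_range_wrMap_of_pres {β : Type} {σ : Perm (β ⊕ β)} (h : Pres Sum.isLeft σ) :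
    ∃ a b : Perm β, ∃ s, σ = Equiv.Perm.sumCongr a b * cond s (Equiv.sumComm β β) 1 := by
  obtain ⟨s, hs⟩ := h
  have key : ∀ τ : Perm (β ⊕ β), (∀ p, Sum.isLeft (τ p) = Sum.isLeft p) →
      ∃ a b : Perm β, τ = Equiv.Perm.sumCongr a b := by
    intro τ hτ
    have hinv : ∀ p, Sum.isLeft (τ⁻¹ p) = Sum.isLeft p := by
      intro p
      rw [← hτ (τ⁻¹ p)]
      simp
    have hl : ∀ (τ : Perm (β ⊕ β)), (∀ p, Sum.isLeft (τ p) = Sum.isLeft p) → ∀ p : β,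
        ∃ q : β, τ (Sum.inl p) = Sum.inl q := fun τ hτ p =>
      Sum.isLeft_iff.1 ((hτ (Sum.inl p)).trans rfl)
    have hr : ∀ (τ : Perm (β ⊕ β)), (∀ p, Sum.isLeft (τ p) = Sum.isLeft p) → ∀ p : β,
        ∃ q : β, τ (Sum.inr p) = Sum.inr q := fun τ hτ p =>
      Sum.isRight_iff.1 (by simpa using hτ (Sum.inr p))
    choose a ha using hl τ hτ
    choose a' ha' using hl τ⁻¹ hinv
    choose b hb using hr τ hτ
    choose b' hb' using hr τ⁻¹ hinv
    refine ⟨⟨a, a', fun p => ?_, fun p => ?_⟩, ⟨b, b', fun p => ?_, fun p => ?_⟩, ?_⟩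
    · apply Sum.inl_injective (β := β); rw [← ha', ← ha]; simp
    · apply Sum.inl_injective (β := β); rw [← ha, ← ha']; simp
    · apply Sum.inr_injective (α := β); rw [← hb', ← hb]; simp
    · apply Sum.inr_injective (α := β); rw [← hb, ← hb']; simp
    · ext (p | p)
      · simp [ha]
      · simp [hb]
  rcases s with _ | _
  · obtain ⟨a, b, h⟩ := key σ fun p => by simpa using hs p
    exact ⟨a, b, false, by rw [h]; exact (mul_one _).symm⟩
  · obtain ⟨a, b, h⟩ := key (σ * Equiv.sumComm β β) fun p => by
      rw [Perm.mul_apply, hs]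
      rcases p with p | p <;> rfl
    refine ⟨a, b, true, ?_⟩
    rw [← h, cond_true, mul_assoc]
    ext (p | p) <;> simp

lemma pres_sumCongr {β : Type} (a b : Perm β) (s : Bool) :
    Pres Sum.isLeft (Equiv.Perm.sumCongr a b * cond s (Equiv.sumComm β β) 1) := by
  refine ⟨s, ?_⟩
  rcases s with _ | _ <;> rintro (p | p) <;> simp

lemma mem_range_wrMap_top {β : Type} {σ : Perm (β ⊕ β)} :
    σ ∈ (wrMap (⊤ : Subgroup (Perm β))).range ↔ Pres Sum.isLeft σ := by
  constructor
  · rintro ⟨p, rfl⟩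
    exact pres_sumCongr _ _ _
  · intro h
    obtain ⟨a, b, s, rfl⟩ := mem_range_wrMap_of_pres h
    exact ⟨⟨⟨a, trivial⟩, ⟨b, trivial⟩, s⟩, rfl⟩

variable {β : Type} [Fintype β] [DecidableEq β]

lemma padicValNat_factorial_two_pow (j : ℕ) : padicValNat 2 (2 ^ j).factorial + 1 = 2 ^ j := by
  induction j with
  | zero => simp
  | succ j ih =>
    rw [pow_succ', padicValNat_factorial_mul, two_mul]
    omega

omit [DecidableEq β] in
lemma card_range_wrMap [Nonempty β] (K : Subgroup (Perm β)) :
    Nat.card (wrMap K).range = 2 * Nat.card K ^ 2 := by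
  classical
  rw [← Nat.card_congr (MonoidHom.ofInjective (wrMap_injective K)).toEquiv]
  have : Fintype K := Fintype.ofFinite _
  rw [Nat.card_eq_fintype_card, Wr.card_eq, Nat.card_eq_fintype_card]

lemma wrMap_top_index {j : ℕ} (hβ : Fintype.card β = 2 ^ j) :
    ¬ 2 ∣ (wrMap (⊤ : Subgroup (Perm β))).range.index := by
  have : Nonempty β := Fintype.card_pos_iff.1 (by rw [hβ]; positivity)
  have h := (wrMap (⊤ : Subgroup (Perm β))).range.card_mul_index
  rw [card_range_wrMap, Subgroup.card_top, Nat.card_perm, Nat.card_perm, Nat.card_sum,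
    Nat.card_eq_fintype_card, hβ, ← two_mul, ← pow_succ'] at h
  have h1 := congrArg (padicValNat 2) h
  have h0 : (wrMap (⊤ : Subgroup (Perm β))).range.index ≠ 0 := Subgroup.index_ne_zero_of_finite
  have hf := Nat.factorial_ne_zero (2 ^ j)
  rw [padicValNat.mul (by positivity) h0, padicValNat.mul (by positivity) (by positivity),
    padicValNat.pow, padicValNat.self (by norm_num)] at h1
  have h2 := padicValNat_factorial_two_pow j
  have h3 := padicValNat_factorial_two_pow (j + 1)
  intro hd
  have h4 : 1 ≤ padicValNat 2 (wrMap (⊤ : Subgroup (Perm β))).range.index :=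
    one_le_padicValNat_of_dvd h0 hd
  rw [pow_succ] at *
  omega

/-- Every `2`-subgroup preserves a halving. -/
lemma exists_pres {j : ℕ} (hβ : Fintype.card β = 2 ^ j) {N : Subgroup (Perm (β ⊕ β))}
    (hN : IsPGroup 2 N) :
    ∃ u : Perm (β ⊕ β), ∀ n ∈ N, Pres (fun p => Sum.isLeft (u p)) n := by
  obtain ⟨u, hu⟩ := exists_conj_le hN (wrMap_top_index hβ)
  refine ⟨u⁻¹, fun n hn => ?_⟩
  obtain ⟨s, hs⟩ := mem_range_wrMap_top.1 (hu n hn)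
  refine ⟨s, fun p => ?_⟩
  have := hs (u⁻¹ p)
  simpa using this

lemma exists_fullCyc (β : Type) [Fintype β] [DecidableEq β] [Nonempty β] :
    ∃ c : Perm β, FullCyc c := by
  rcases subsingleton_or_nontrivial β with h | h
  · exact ⟨1, fun p q => by rw [Subsingleton.elim p q]⟩
  · obtain ⟨c, hc⟩ := (Equiv.Perm.exists_with_cycleType_iff β).2
      (⟨by simp, by simpa using Nat.succ_le_of_lt Fintype.one_lt_card⟩ :
        ({Fintype.card β} : Multiset ℕ).sum ≤ Fintype.card β ∧ ∀ a ∈ ({Fintype.card β} : Multiset ℕ), 2 ≤ a)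
    exact ⟨c, fullCyc_of_cycleType hc⟩

omit [Fintype β] [DecidableEq β] in
lemma FullCyc.conj {c u : Perm β} (hc : FullCyc c) : FullCyc (u * c * u⁻¹) := by
  intro p q
  obtain ⟨i, hi⟩ := hc (u⁻¹ p) (u⁻¹ q)
  refine ⟨i, ?_⟩
  rw [conj_zpow, Perm.mul_apply, Perm.mul_apply, hi]
  simp

/-- A `2`-element lies together with some full cycle in a `2`-subgroup. -/
lemma exists_fullCyc_mem {j : ℕ} (hβ : Fintype.card β = 2 ^ j) {y : Perm β}
    (hy : ∃ m, orderOf y = 2 ^ m) :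
    ∃ Q : Subgroup (Perm β), IsPGroup 2 Q ∧ y ∈ Q ∧ ∃ c ∈ Q, FullCyc c := by
  have : Nonempty β := Fintype.card_pos_iff.1 (by rw [hβ]; positivity)
  obtain ⟨Q, hQ⟩ := exists_sylow hy
  obtain ⟨c, hc⟩ := exists_fullCyc β
  obtain ⟨u, hu⟩ := exists_conj_le (isPGroup_zpowers (FullCyc.two_element hβ hc))
    Q.not_dvd_index_two
  refine ⟨Q, Q.2, hQ, _, hu c (Subgroup.mem_zpowers c), ?_⟩
  simpa using hc.conj (u := u⁻¹)

lemma isPGroup_range_wrMap [Nonempty β] {K : Subgroup (Perm β)} (hK : IsPGroup 2 K) :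
    IsPGroup 2 (wrMap K).range := by
  obtain ⟨n, hn⟩ := IsPGroup.iff_card.1 hK
  refine IsPGroup.of_card (n := n * 2 + 1) ?_
  rw [card_range_wrMap, hn]
  ring

lemma exists_pt {M : Multiset ℕ} (hM : ∀ a ∈ M, 1 ≤ a) (hs : M.sum = Fintype.card β) :
    ∃ y : Perm β, pt y = M := by
  obtain ⟨y, hy⟩ := (Equiv.Perm.exists_with_cycleType_iff β (m := M.filter (2 ≤ ·))).2
    ⟨hs ▸ (by
      conv_rhs => rw [← Multiset.filter_add_not (2 ≤ ·) M]
      rw [Multiset.sum_add]; omega), fun a ha => (Multiset.mem_filter.1 ha).2⟩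
  refine ⟨y, ?_⟩
  have h1 : M.filter (¬ 2 ≤ ·) = Multiset.replicate (M.filter (¬ 2 ≤ ·)).card 1 :=
    Multiset.eq_replicate_card.2 fun a ha => by
      have := Multiset.mem_filter.1 ha
      have := hM a this.1
      omega
  have h2 : M.sum = (M.filter (2 ≤ ·)).sum + (M.filter (¬ 2 ≤ ·)).card := by
    conv_lhs => rw [← Multiset.filter_add_not (2 ≤ ·) M, Multiset.sum_add, h1]
    simp
  rw [pt_eq, card_support_eq, hy, ← hs, h2, Nat.add_sub_cancel_left, ← h1,
    Multiset.filter_add_not]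

lemma pt_two_pow {y : Perm β} (hy : ∃ m, orderOf y = 2 ^ m) {a : ℕ} (ha : a ∈ pt y) :
    ∃ i, a = 2 ^ i := by
  obtain ⟨m, hm⟩ := hy
  rw [pt_eq, Multiset.mem_add] at ha
  rcases ha with ha | ha
  · have := dvd_of_mem_cycleType ha
    rw [hm, Nat.dvd_prime_pow Nat.prime_two] at this
    exact ⟨this.choose, this.choose_spec.2⟩
  · exact ⟨0, Multiset.eq_of_mem_replicate ha⟩

lemma two_element_of_pt {γ : Type} [Fintype γ] [DecidableEq γ] {y : Perm γ}
    (h : ∀ a ∈ pt y, ∃ i, a = 2 ^ i) : ∃ m, orderOf y = 2 ^ m := by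
  have h1 : ∀ S : Multiset ℕ, (∀ a ∈ S, ∃ i, a = 2 ^ i) → ∃ m, S.lcm = 2 ^ m := by
    intro S hS
    induction S using Multiset.induction_on with
    | empty => exact ⟨0, by simp⟩
    | cons a S ih =>
      obtain ⟨m, hm⟩ := ih fun b hb => hS b (Multiset.mem_cons_of_mem hb)
      obtain ⟨i, rfl⟩ := hS _ (Multiset.mem_cons_self _ _)
      rw [Multiset.lcm_cons, hm]
      rcases le_total i m with h | h
      · exact ⟨m, Nat.lcm_eq_right (pow_dvd_pow 2 h)⟩
      · exact ⟨i, Nat.lcm_eq_left (pow_dvd_pow 2 h)⟩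
  rw [← lcm_cycleType]
  exact h1 _ fun a ha => h a (by rw [pt_eq]; exact Multiset.mem_add.2 (Or.inl ha))

end Halvings

section WreathSubnormalizers

open Equiv Equiv.Perm

/-- The pair `(a, b)` acting on two copies of a set, after a swap of the copies if `s` holds. -/
def wrp {β : Type} (a b : Perm β) (s : Bool) : Perm (β ⊕ β) :=
  Equiv.Perm.sumCongr a b * cond s (Equiv.sumComm β β) 1

lemma wrp_mul {β : Type} (a b a' b' : Perm β) (s s' : Bool) :
    wrp a b s * wrp a' b' s' = wrp (a * cond s b' a') (b * cond s a' b') (xor s s') := by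
  have := (wrMap (⊤ : Subgroup (Perm β))).map_mul ⟨⟨a, trivial⟩, ⟨b, trivial⟩, s⟩
    ⟨⟨a', trivial⟩, ⟨b', trivial⟩, s'⟩
  rw [Wr.mul_def, wrMap_apply, wrMap_apply, wrMap_apply] at this
  rcases s with _ | _ <;> exact this.symm

lemma wrp_inv {β : Type} (a b : Perm β) (s : Bool) :
    (wrp a b s)⁻¹ = wrp (cond s b⁻¹ a⁻¹) (cond s a⁻¹ b⁻¹) s := by
  rw [inv_eq_iff_mul_eq_one, wrp_mul]
  rcases s with _ | _ <;> ext (q | q) <;> simp [wrp]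

lemma wrp_mem_range {β : Type} {K : Subgroup (Perm β)} {a b : Perm β} (ha : a ∈ K) (hb : b ∈ K)
    (s : Bool) : wrp a b s ∈ (wrMap K).range :=
  ⟨⟨⟨a, ha⟩, ⟨b, hb⟩, s⟩, rfl⟩

lemma exists_wrp {β : Type} {σ : Perm (β ⊕ β)} (h : Pres Sum.isLeft σ) :
    ∃ a b s, σ = wrp a b s := mem_range_wrMap_of_pres h

lemma wrp_conj_false {β : Type} (h₁ h₂ a b : Perm β) :
    wrp h₁ h₂ false * wrp a b false * (wrp h₁ h₂ false)⁻¹ =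
      wrp (h₁ * a * h₁⁻¹) (h₂ * b * h₂⁻¹) false := by
  rw [wrp_inv, wrp_mul, wrp_mul]; rfl

lemma wrp_conj_true {β : Type} (h₁ h₂ a b : Perm β) :
    wrp h₁ h₂ true * wrp a b false * (wrp h₁ h₂ true)⁻¹ =
      wrp (h₁ * b * h₁⁻¹) (h₂ * a * h₂⁻¹) false := by
  rw [wrp_inv, wrp_mul, wrp_mul]; rfl

lemma wrp_true_conj {β : Type} (a b : Perm β) :
    wrp 1 b⁻¹ false * wrp a b true * (wrp 1 b⁻¹ false)⁻¹ = wrp (a * b) 1 true := by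
  rw [wrp_inv, wrp_mul, wrp_mul]
  simp

lemma wrp_apply_inl {β : Type} (a b : Perm β) (p : β) : wrp a b false (Sum.inl p) = Sum.inl (a p) := rfl

lemma wrp_apply_inr {β : Type} (a b : Perm β) (p : β) : wrp a b false (Sum.inr p) = Sum.inr (b p) := rfl

/-- Every halving preserved by `x` is the standard one. -/
def UniqHalf {β : Type} (x : Perm (β ⊕ β)) : Prop :=
  ∀ u : Perm (β ⊕ β), Pres (fun p => Sum.isLeft (u p)) x →
    ∃ t, ∀ p, Sum.isLeft (u p) = xor t (Sum.isLeft p)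

lemma pres_of_xor {α : Type} {f f' : α → Bool} {t : Bool} (h : ∀ p, f p = xor t (f' p))
    {σ : Perm α} (hσ : Pres f σ) : Pres f' σ := by
  obtain ⟨s, hs⟩ := hσ
  refine ⟨s, fun p => ?_⟩
  have h1 := hs p
  rw [h, h] at h1
  rcases t with _ | _ <;> rcases s with _ | _ <;> simpa using h1

variable {β : Type} [Fintype β] [DecidableEq β]

lemma pres_of_good {j : ℕ} (hβ : Fintype.card β = 2 ^ j) {x h : Perm (β ⊕ β)} (hU : UniqHalf x)
    {N : Subgroup (Perm (β ⊕ β))} (hN : IsPGroup 2 N) (hx : x ∈ N)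
    (hh : ∀ n ∈ N, h * n * h⁻¹ ∈ N) : Pres Sum.isLeft h := by
  obtain ⟨u, hu⟩ := exists_pres hβ hN
  obtain ⟨t, ht⟩ := hU u (hu x hx)
  obtain ⟨s, hs⟩ := pres_of_xor ht (hu _ (hh x hx))
  obtain ⟨t', ht'⟩ := hU h ⟨s, fun p => by simpa using hs (h p)⟩
  exact ⟨t', ht'⟩

/-- The first projection of the part of `N` fixing both halves. -/
def projL (N : Subgroup (Perm (β ⊕ β))) : Subgroup (Perm β) :=
  (N.comap (sumCongrHom β β)).map (MonoidHom.fst _ _)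

/-- The second projection of the part of `N` fixing both halves. -/
def projR (N : Subgroup (Perm (β ⊕ β))) : Subgroup (Perm β) :=
  (N.comap (sumCongrHom β β)).map (MonoidHom.snd _ _)

omit [Fintype β] [DecidableEq β] in
lemma mem_projL {N : Subgroup (Perm (β ⊕ β))} {a : Perm β} :
    a ∈ projL N ↔ ∃ b, wrp a b false ∈ N := by
  constructor
  · rintro ⟨⟨a, b⟩, h, rfl⟩
    exact ⟨b, h⟩
  · rintro ⟨b, h⟩
    exact ⟨⟨a, b⟩, h, rfl⟩

omit [Fintype β] [DecidableEq β] in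
lemma mem_projR {N : Subgroup (Perm (β ⊕ β))} {b : Perm β} :
    b ∈ projR N ↔ ∃ a, wrp a b false ∈ N := by
  constructor
  · rintro ⟨⟨a, b⟩, h, rfl⟩
    exact ⟨a, h⟩
  · rintro ⟨a, h⟩
    exact ⟨⟨a, b⟩, h, rfl⟩

omit [Fintype β] [DecidableEq β] in
lemma isPGroup_projL {N : Subgroup (Perm (β ⊕ β))} (hN : IsPGroup 2 N) : IsPGroup 2 (projL N) :=
  (hN.comap_of_injective _ sumCongrHom_injective).map _

omit [Fintype β] [DecidableEq β] in
lemma isPGroup_projR {N : Subgroup (Perm (β ⊕ β))} (hN : IsPGroup 2 N) : IsPGroup 2 (projR N) :=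
  (hN.comap_of_injective _ sumCongrHom_injective).map _

/-- The subnormalizer of a full cycle. -/
theorem subnormalizer_full {j : ℕ} (hβ : Fintype.card β = 2 ^ j) {c : Perm β}
    (hc : IsPGroup 2 (subnormalizer c)) (hx : ∃ m, orderOf (wrp c 1 true) = 2 ^ m)
    (hU : UniqHalf (wrp c 1 true)) :
    subnormalizer (wrp c 1 true) = (wrMap (subnormalizer c)).range := by
  have : Nonempty β := Fintype.card_pos_iff.1 (by rw [hβ]; positivity)
  have hxr : wrp c 1 true ∈ (wrMap (subnormalizer c)).range :=
    wrp_mem_range (mem_subnormalizer_self c) (one_mem _) _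
  refine le_antisymm (subnormalizer_le hx ?_) (le_subnormalizer (isPGroup_range_wrMap hc) hxr)
  rintro h ⟨N, hN, hxN, hh⟩
  have key : ∀ a b, (∀ n ∈ N, wrp a b false * n * (wrp a b false)⁻¹ ∈ N) →
      wrp a b false ∈ (wrMap (subnormalizer c)).range := by
    intro a b hab
    have hcN : wrp c c false ∈ N := by
      have := mul_mem hxN hxN
      rw [wrp_mul] at this
      simpa using this
    refine wrp_mem_range (Good.mem ⟨projL N, isPGroup_projL hN, mem_projL.2 ⟨c, hcN⟩, ?_⟩)
      (Good.mem ⟨projR N, isPGroup_projR hN, mem_projR.2 ⟨c, hcN⟩, ?_⟩) _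
    · intro n hn
      obtain ⟨m, hm⟩ := mem_projL.1 hn
      exact mem_projL.2 ⟨_, wrp_conj_false a b n m ▸ hab _ hm⟩
    · intro m hm
      obtain ⟨n, hn⟩ := mem_projR.1 hm
      exact mem_projR.2 ⟨_, wrp_conj_false a b n m ▸ hab _ hn⟩
  obtain ⟨a, b, s, rfl⟩ := exists_wrp (pres_of_good hβ hU hN hxN hh)
  rcases s with _ | _
  · exact key a b hh
  · rw [← Subgroup.mul_mem_cancel_right _ hxr, wrp_mul]
    refine key _ _ fun n hn => ?_
    have h1 := hh _ (mul_mem (mul_mem hxN hn) (inv_mem hxN))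
    have h2 : wrp (a * 1) (b * c) false = wrp a b true * wrp c 1 true := by
      rw [wrp_mul]; rfl
    show wrp (a * 1) (b * c) false * n * (wrp (a * 1) (b * c) false)⁻¹ ∈ N
    rw [h2]
    convert h1 using 1
    group

/-- The subnormalizer of an element with a cycle on one half and a fixed point on the other. -/
theorem subnormalizer_half {j : ℕ} (hβ : Fintype.card β = 2 ^ j) {c y : Perm β}
    (hc : IsPGroup 2 (subnormalizer c)) (hc2 : ∃ m, orderOf c = 2 ^ m)
    (hy2 : ∃ m, orderOf y = 2 ^ m)
    (hx : ∃ m, orderOf (wrp c y false) = 2 ^ m)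
    (hU : UniqHalf (wrp c y false))
    {Q : Subgroup (Perm β)} (hQ : IsPGroup 2 Q) (hcQ : c ∈ Q) (hyQ : y ∈ Q) :
    subnormalizer (wrp c y false) = (wrMap (subnormalizer y)).range := by
  have : Nonempty β := Fintype.card_pos_iff.1 (by rw [hβ]; positivity)
  have hcy : c ∈ subnormalizer y := le_subnormalizer hQ hyQ hcQ
  have hSc : subnormalizer c ≤ subnormalizer y :=
    subnormalizer_le_of_index hc2 hc (subnormalizer_index hy2) hcy
  apply le_antisymm
  · refine subnormalizer_le hx ?_
    rintro h ⟨N, hN, hxN, hh⟩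
    have hcN : c ∈ projL N := mem_projL.2 ⟨y, hxN⟩
    have hyN : y ∈ projR N := mem_projR.2 ⟨c, hxN⟩
    obtain ⟨a, b, s, rfl⟩ := exists_wrp (pres_of_good hβ hU hN hxN hh)
    rcases s with _ | _
    · refine wrp_mem_range (hSc (Good.mem ⟨projL N, isPGroup_projL hN, hcN, ?_⟩))
        (Good.mem ⟨projR N, isPGroup_projR hN, hyN, ?_⟩) _
      · intro n hn
        obtain ⟨m, hm⟩ := mem_projL.1 hn
        exact mem_projL.2 ⟨_, wrp_conj_false a b n m ▸ hh _ hm⟩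
      · intro m hm
        obtain ⟨n, hn⟩ := mem_projR.1 hm
        exact mem_projR.2 ⟨_, wrp_conj_false a b n m ▸ hh _ hn⟩
    · have h1 : ∀ m ∈ projR N, a * m * a⁻¹ ∈ projL N := by
        intro m hm
        obtain ⟨n, hn⟩ := mem_projR.1 hm
        exact mem_projL.2 ⟨_, wrp_conj_true a b n m ▸ hh _ hn⟩
      have h2 : ∀ n ∈ projL N, b * n * b⁻¹ ∈ projR N := by
        intro n hn
        obtain ⟨m, hm⟩ := mem_projL.1 hn
        exact mem_projR.2 ⟨_, wrp_conj_true a b n m ▸ hh _ hm⟩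
      have h3 : b * a ∈ subnormalizer y := by
        refine Good.mem ⟨projR N, isPGroup_projR hN, hyN, fun n hn => ?_⟩
        have := h2 _ (h1 n hn)
        convert this using 1
        group
      have h4 : b ∈ subnormalizer y :=
        mem_of_conj_mem hc2 hc (subnormalizer_index hy2) hcy
          (le_subnormalizer (isPGroup_projR hN) hyN (h2 c hcN))
      exact wrp_mem_range ((Subgroup.mul_mem_cancel_left _ h4).1 h3) h4 _
  · have hσ : wrp 1 1 true ∈ subnormalizer (wrp c y false) :=
      le_subnormalizer (isPGroup_range_wrMap hQ) (wrp_mem_range hcQ hyQ _)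
        (wrp_mem_range (one_mem _) (one_mem _) _)
    have hb : subnormalizer y ≤ (subnormalizer (wrp c y false)).comap
        ((sumCongrHom β β).comp (MonoidHom.inr _ _)) := by
      refine subnormalizer_le hy2 ?_
      rintro b ⟨N, hN, hyN, hbN⟩
      refine Good.mem (x := wrp c y false)
        ⟨((Subgroup.zpowers c).prod N).map (sumCongrHom β β), ?_, ?_, ?_⟩
      · apply IsPGroup.map
        obtain ⟨n, hn⟩ := IsPGroup.iff_card.1 hN
        obtain ⟨m, hm⟩ := IsPGroup.iff_card.1 (isPGroup_zpowers hc2)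
        refine IsPGroup.of_card (n := m + n) ?_
        rw [Nat.card_congr (Subgroup.prodEquiv _ _).toEquiv, Nat.card_prod, hm, hn, pow_add]
      · exact ⟨(c, y), ⟨Subgroup.mem_zpowers c, hyN⟩, rfl⟩
      · rintro _ ⟨⟨n, m⟩, ⟨hn, hm⟩, rfl⟩
        exact ⟨(n, b * m * b⁻¹), ⟨hn, hbN m hm⟩, by
          rw [MonoidHom.comp_apply, ← map_inv, ← map_mul, ← map_mul]
          congr 1⟩
    have hb' : ∀ b ∈ subnormalizer y, wrp 1 b false ∈ subnormalizer (wrp c y false) :=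
      fun b h => hb h
    have ha' : ∀ b ∈ subnormalizer y, wrp b 1 false ∈ subnormalizer (wrp c y false) := by
      intro b h
      have := mul_mem (mul_mem hσ (hb' b h)) (inv_mem hσ)
      rw [wrp_conj_true] at this
      simpa using this
    rintro _ ⟨⟨⟨a, ha⟩, ⟨b, hb⟩, s⟩, rfl⟩
    show wrp a b s ∈ _
    have h1 : wrp a b s = wrp a 1 false * wrp 1 b false * wrp 1 1 s := by
      rw [wrp_mul, wrp_mul]
      simp
    rw [h1]
    refine mul_mem (mul_mem (ha' a ha) (hb' b hb)) ?_
    rcases s with _ | _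
    · have h2 : wrp (1 : Perm β) 1 false = 1 := by ext (q | q) <;> simp [wrp]
      rw [h2]
      exact one_mem _
    · exact hσ

omit [Fintype β] [DecidableEq β] in
lemma wrp_sq_pow (a b : Perm β) (n : ℤ) :
    (wrp a b true) ^ (2 * n) = wrp ((a * b) ^ n) ((b * a) ^ n) false := by
  rw [zpow_mul, zpow_two, wrp_mul]
  exact (map_zpow (sumCongrHom β β) (a * b, b * a) n).symm

omit [Fintype β] [DecidableEq β] in
lemma isLeft_zpow (a b : Perm β) (n : ℤ) (p : β ⊕ β) :
    Sum.isLeft (((wrp a b true) ^ (2 * n + 1)) p) = !Sum.isLeft p := by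
  rw [zpow_add, zpow_one, Perm.mul_apply, wrp_sq_pow]
  rcases p with p | p <;> simp [wrp]

omit [Fintype β] [DecidableEq β] in
lemma fullCyc_wrp [Nonempty β] {a b : Perm β} {s : Bool} (h : FullCyc (wrp a b s)) :
    s = true ∧ FullCyc (a * b) := by
  have hs : s = true := by
    by_contra hs
    rw [Bool.not_eq_true] at hs
    subst hs
    let z : β := Classical.arbitrary β
    obtain ⟨i, hi⟩ := h (Sum.inl z) (Sum.inr z)
    have : (wrp a b false) ^ i = wrp (a ^ i) (b ^ i) false :=
      (map_zpow (sumCongrHom β β) (a, b) i).symm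
    rw [this] at hi
    simp [wrp] at hi
  subst hs
  refine ⟨rfl, fun p q => ?_⟩
  obtain ⟨i, hi⟩ := h (Sum.inl p) (Sum.inl q)
  rcases Int.even_or_odd' i with ⟨m, rfl | rfl⟩
  · rw [wrp_sq_pow] at hi
    exact ⟨m, by simpa [wrp] using hi⟩
  · have := isLeft_zpow a b m (Sum.inl p)
    rw [hi] at this
    simp at this

omit [Fintype β] [DecidableEq β] in
lemma uniqHalf_of_fullCyc {x : Perm (β ⊕ β)} [Nonempty β] (hx : FullCyc x)
    (hl : Pres Sum.isLeft x) : UniqHalf x := by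
  have hconst : ∀ f : β ⊕ β → Bool, (∀ p, f (x p) = f p) → ∀ p q, f p = f q := by
    intro f hf
    have hz : ∀ (i : ℤ) p, f ((x ^ i) p) = f p := by
      intro i
      induction i using Int.induction_on with
      | zero => simp
      | succ n ih => intro p; rw [zpow_add_one, Perm.mul_apply, ih, hf]
      | pred n ih => intro p; rw [zpow_sub_one, Perm.mul_apply, ih, ← hf (x⁻¹ p)]; simp
    intro p q
    obtain ⟨i, rfl⟩ := hx p q
    exact (hz i p).symm
  have htrue : ∀ (u : Perm (β ⊕ β)) (s : Bool),
      (∀ p, Sum.isLeft (u (x p)) = xor s (Sum.isLeft (u p))) → s = true := by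
    intro u s hs
    by_contra h
    rw [Bool.not_eq_true] at h
    subst h
    have z : β := Classical.arbitrary β
    have := hconst (fun p => Sum.isLeft (u p)) (fun p => by simpa using hs p)
      (u⁻¹ (Sum.inl z)) (u⁻¹ (Sum.inr z))
    simp at this
  rintro u ⟨s, hs⟩
  obtain ⟨s', hs'⟩ := hl
  have h1 := htrue u s hs
  have h2 := htrue 1 s' (by simpa using hs')
  subst h1 h2
  have h3 := hconst (fun p => xor (Sum.isLeft (u p)) (Sum.isLeft p)) (fun p => by
    have h4 : Sum.isLeft (u (x p)) = xor true (Sum.isLeft (u p)) := hs p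
    rw [h4, hs']
    cases Sum.isLeft (u p) <;> cases Sum.isLeft p <;> rfl)
  let z : β ⊕ β := Sum.inl (Classical.arbitrary β)
  refine ⟨xor (Sum.isLeft (u z)) (Sum.isLeft z), fun p => ?_⟩
  rw [← h3 p z]
  simp

omit [DecidableEq β] in
lemma uniqHalf_half [Nonempty β] {c y : Perm β} (hc : FullCyc c) {z : β} (hz : y z = z) :
    UniqHalf (wrp c y false) := by
  rintro u ⟨s, hs⟩
  have h0 : s = false := by
    have := hs (Sum.inr z)
    simp only [wrp_apply_inr, hz] at this
    cases s <;> cases h : Sum.isLeft (u (Sum.inr z)) <;> rw [h] at this <;> simp at this ⊢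
  subst h0
  have hconst : ∀ p q : β, Sum.isLeft (u (Sum.inl p)) = Sum.isLeft (u (Sum.inl q)) := by
    have hz : ∀ (i : ℤ) p, Sum.isLeft (u (Sum.inl ((c ^ i) p))) = Sum.isLeft (u (Sum.inl p)) := by
      have h1 : ∀ p, Sum.isLeft (u (Sum.inl (c p))) = Sum.isLeft (u (Sum.inl p)) := fun p => by
        simpa [wrp_apply_inl] using hs (Sum.inl p)
      intro i
      induction i using Int.induction_on with
      | zero => simp
      | succ n ih => intro p; rw [zpow_add_one, Perm.mul_apply, ih, h1]
      | pred n ih => intro p; rw [zpow_sub_one, Perm.mul_apply, ih, ← h1 (c⁻¹ p)]; simp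
    intro p q
    obtain ⟨i, rfl⟩ := hc p q
    exact (hz i p).symm
  -- the colour classes are determined by cardinality
  have hcard : ∀ t : Bool, (∀ p : β, Sum.isLeft (u (Sum.inl p)) = t) →
      ∀ p : β, Sum.isLeft (u (Sum.inr p)) = !t := by
    intro t ht p
    by_contra hne
    have hp : Sum.isLeft (u (Sum.inr p)) = t := by
      cases t <;> simpa using hne
    let f : Option β → {q : β ⊕ β // Sum.isLeft q = t} := fun o =>
      o.elim ⟨u (Sum.inr p), hp⟩ fun q => ⟨u (Sum.inl q), ht q⟩
    have hf : Function.Injective f := by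
      rintro (_ | q) (_ | q') h
      · rfl
      · simp [f] at h
      · simp [f] at h
      · simpa [f] using h
    have h1 := Fintype.card_le_of_injective f hf
    have h2 : Fintype.card {q : β ⊕ β // Sum.isLeft q = t} = Fintype.card β := by
      refine (Fintype.card_of_bijective
        (f := fun q : β => (⟨cond t (Sum.inl q) (Sum.inr q), by cases t <;> rfl⟩ :
          {q : β ⊕ β // Sum.isLeft q = t})) ⟨?_, ?_⟩).symm
      · intro q q' h
        cases t <;> simpa using h
      · rintro ⟨q | q, h⟩
        · cases t
          · simp at h
          · exact ⟨q, rfl⟩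
        · cases t
          · exact ⟨q, rfl⟩
          · simp at h
    rw [h2, Fintype.card_option] at h1
    omega
  let w : β := Classical.arbitrary β
  refine ⟨!Sum.isLeft (u (Sum.inl w)), ?_⟩
  rintro (p | p)
  · rw [hconst p w]; simp
  · rw [hcard _ (fun p => hconst p w) p]; simp

end WreathSubnormalizers

section MainCases

open Equiv Equiv.Perm

/-- The bijection of the main theorem exists for `x` and `g`, and in the subnormalizer of `x` the
characters take the values `0, 1, -1` at `g`, the units only in odd degree. -/
def MainAt {G : Type} [Group G] (x g : G) : Prop :=
  ∀ hgx : g ∈ subnormalizer x,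
    Corr G (subnormalizer x) x g ⟨x, mem_subnormalizer_self x⟩ ⟨g, hgx⟩ ∧
      OddAt (subnormalizer x) ⟨g, hgx⟩

/-- An isomorphism of groups restricts to subnormalizers. -/
def subnormalizerEquiv {G G' : Type} [Group G] [Group G'] [Finite G] (e : G ≃* G') {x : G}
    (hx : ∃ m, orderOf x = 2 ^ m) : subnormalizer x ≃* subnormalizer (e x) :=
  (e.subgroupMap (subnormalizer x)).trans (MulEquiv.subgroupCongr (subnormalizer_map e hx))

lemma subnormalizerEquiv_mk {G G' : Type} [Group G] [Group G'] [Finite G] (e : G ≃* G') {x : G}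
    (hx : ∃ m, orderOf x = 2 ^ m) {a : G} (ha : a ∈ subnormalizer x)
    (ha' : e a ∈ subnormalizer (e x)) : subnormalizerEquiv e hx ⟨a, ha⟩ = ⟨e a, ha'⟩ := rfl

lemma MainAt.of_mulEquiv {G G' : Type} [Group G] [Group G'] [Finite G] (e : G ≃* G') {x g : G}
    (hx : ∃ m, orderOf x = 2 ^ m) (h : MainAt (e x) (e g)) : MainAt x g := by
  intro hgx
  have : Finite G' := Finite.of_equiv _ e.toEquiv
  have hgx' : e g ∈ subnormalizer (e x) := by
    rw [← subnormalizer_map e hx]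
    exact ⟨g, hgx, rfl⟩
  obtain ⟨h1, h2⟩ := h hgx'
  refine ⟨Corr.left e (Corr.right (subnormalizerEquiv e hx) ?_), ?_⟩
  · rw [subnormalizerEquiv_mk e hx hgx hgx']
    exact h1
  · have := OddAt.mulEquiv (subnormalizerEquiv e hx).symm h2
    rwa [← subnormalizerEquiv_mk e hx hgx hgx', MulEquiv.symm_apply_apply] at this

lemma card_oSet_of_oddAt {H : Type} [Group H] [Finite H] {c : H} (h : OddAt H c) :
    Nat.card (OSet H c) = Nat.card {a : H // a * c = c * a} := by
  classical
  have := Fintype.ofFinite H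
  have h1 := sum_normSq_irr c
  have h2 : ∑ μ : Irr H, Complex.normSq (μ.1 c) =
      ∑ μ : Irr H, if μ.1 c ≠ 0 then (1 : ℝ) else 0 := by
    refine Finset.sum_congr rfl fun μ _ => ?_
    by_cases h0 : μ.1 c = 0
    · simp [h0]
    · rcases (h _ μ.2 h0).1 with h1 | h1 <;> rw [h1] <;> simp
  rw [h2, Finset.sum_boole] at h1
  let e : {μ : Irr H // μ.1 c ≠ 0} ≃ OSet H c :=
    { toFun := fun μ => ⟨μ.1.1, μ.1.2, μ.2⟩
      invFun := fun μ => ⟨⟨μ.1, μ.2.1⟩, μ.2.2⟩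
      left_inv := fun _ => rfl
      right_inv := fun _ => rfl }
  rw [← Nat.card_congr e, Nat.card_eq_fintype_card, Fintype.card_subtype, Nat.card_eq_fintype_card,
    Fintype.card_subtype]
  have h3 : ((Finset.univ.filter fun μ : Irr H => μ.1 c ≠ 0).card : ℝ) =
      ((Finset.univ.filter fun a : H => a * c = c * a).card : ℝ) := by
    convert h1
  exact_mod_cast h3

lemma finite_irrX {G : Type} [Group G] [Finite G] (g : G) : Finite (IrrX G g) := by
  have := Fintype.ofFinite G
  let f : IrrX G g → Irr G := fun χ => ⟨χ.1, χ.2.1⟩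
  refine Finite.of_injective f fun a b h => Subtype.ext ?_
  exact congrArg (fun z : Irr G => z.1) h

lemma finite_oSet {G : Type} [Group G] [Finite G] (g : G) : Finite (OSet G g) := by
  have := Fintype.ofFinite G
  let f : OSet G g → Irr G := fun χ => ⟨χ.1, χ.2.1⟩
  refine Finite.of_injective f fun a b h => Subtype.ext ?_
  exact congrArg (fun z : Irr G => z.1) h

lemma wrp_false {β : Type} (a b : Perm β) : wrp a b false = Equiv.Perm.sumCongr a b :=
  mul_one _

/-- The wreath product as a subnormalizer. -/
def wrEquiv {β : Type} [Nonempty β] {K : Subgroup (Perm β)} {S : Subgroup (Perm (β ⊕ β))}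
    (h : S = (wrMap K).range) : Wr K ≃* S :=
  (MonoidHom.ofInjective (wrMap_injective K)).trans (MulEquiv.subgroupCongr h.symm)

lemma wrEquiv_mk {β : Type} [Nonempty β] {K : Subgroup (Perm β)} {S : Subgroup (Perm (β ⊕ β))}
    (h : S = (wrMap K).range) {a b : Perm β} (ha : a ∈ K) (hb : b ∈ K) (s : Bool)
    (hs : wrp a b s ∈ S) : wrEquiv h ⟨⟨a, ha⟩, ⟨b, hb⟩, s⟩ = ⟨wrp a b s, hs⟩ := rfl

/-- A `2`-element is conjugate into the wreath product. -/
lemma exists_equiv_pres {j : ℕ} {α : Type} [Fintype α] (hα : Fintype.card α = 2 ^ (j + 1))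
    {x : Perm α} (hx : ∃ m, orderOf x = 2 ^ m) :
    ∃ e : α ≃ Fin (2 ^ j) ⊕ Fin (2 ^ j), Pres Sum.isLeft (e.permCongrHom x) := by
  classical
  let e₀ : α ≃ Fin (2 ^ j) ⊕ Fin (2 ^ j) :=
    Fintype.equivOfCardEq (by rw [hα, Fintype.card_sum, Fintype.card_fin]; ring)
  obtain ⟨u, hu⟩ := exists_pres (Fintype.card_fin (2 ^ j))
    (isPGroup_zpowers (orderOf_two_mulEquiv e₀.permCongrHom hx))
  obtain ⟨s, hs⟩ := hu _ (Subgroup.mem_zpowers _)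
  refine ⟨e₀.trans u, s, fun p => ?_⟩
  have := hs (u.symm p)
  simpa [Equiv.permCongrHom, Equiv.permCongr_apply] using this

lemma exists_equiv_full {j : ℕ} {α : Type} [Fintype α] (hα : Fintype.card α = 2 ^ (j + 1))
    {x : Perm α} (hc : FullCyc x) :
    ∃ e : Perm α ≃* Perm (Fin (2 ^ j) ⊕ Fin (2 ^ j)), ∃ c : Perm (Fin (2 ^ j)),
      FullCyc c ∧ e x = wrp c 1 true ∧ UniqHalf (wrp c 1 true) := by
  classical
  obtain ⟨e, he⟩ := exists_equiv_pres hα (FullCyc.two_element hα hc)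
  have hfull : FullCyc (e.permCongrHom x) := hc.permCongr e
  obtain ⟨a, b, s, hab⟩ := exists_wrp he
  rw [hab] at hfull
  obtain ⟨rfl, hf⟩ := fullCyc_wrp hfull
  refine ⟨e.permCongrHom.trans (MulAut.conj (wrp 1 b⁻¹ false)), a * b, hf, ?_, ?_⟩
  · rw [MulEquiv.trans_apply, hab, MulAut.conj_apply, wrp_true_conj]
  · refine uniqHalf_of_fullCyc ?_ (pres_sumCongr _ _ _)
    rw [← wrp_true_conj]
    exact hfull.conj

lemma oddAt_top {G : Type} [Group G] [Finite G] {K : Subgroup G} (hK : K = ⊤) {g : G} (hg : g ∈ K)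
    (h : OddAt G g) : OddAt K ⟨g, hg⟩ := by
  subst hK
  have : (⟨g, hg⟩ : (⊤ : Subgroup G)) = Subgroup.topEquiv.symm g := rfl
  rw [this]
  exact h.mulEquiv _

/-- The subnormalizer of a full cycle is a Sylow `2`-subgroup. -/
theorem full_sub (j : ℕ) : ∀ {α : Type} [Fintype α], Fintype.card α = 2 ^ j → ∀ {x : Perm α},
    FullCyc x → IsPGroup 2 (subnormalizer x) ∧
      OddAt (subnormalizer x) ⟨x, mem_subnormalizer_self x⟩ := by
  classical
  induction j with
  | zero =>
    intro α _ hα x hx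
    have : Subsingleton α := Fintype.card_le_one_iff_subsingleton.1 (by rw [hα]; simp)
    exact ⟨IsPGroup.of_subsingleton _ _, oddAt_top (Subsingleton.elim _ _) _ (perm_oddAt hα hx)⟩
  | succ j ih =>
    intro α _ hα x hx
    have hx2 := FullCyc.two_element hα hx
    obtain ⟨e, c, hc, hex, hU⟩ := exists_equiv_full hα hx
    obtain ⟨h1, h2⟩ := ih (Fintype.card_fin (2 ^ j)) hc
    have hw := subnormalizer_full (Fintype.card_fin (2 ^ j)) h1
      (hex ▸ orderOf_two_mulEquiv e hx2) hU
    rw [← hex] at hw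
    have hp : IsPGroup 2 (subnormalizer (e x)) := by
      rw [hw]; exact isPGroup_range_wrMap h1
    refine ⟨hp.of_equiv (subnormalizerEquiv e hx2).symm, ?_⟩
    have h3 := ((Wr.oddAt h2).mulEquiv (wrEquiv hw)).mulEquiv (subnormalizerEquiv e hx2).symm
    have h4 : wrEquiv hw ⟨⟨c, mem_subnormalizer_self c⟩, 1, true⟩ =
        subnormalizerEquiv e hx2 ⟨x, mem_subnormalizer_self x⟩ := Subtype.ext hex.symm
    rwa [h4, MulEquiv.symm_apply_apply] at h3

lemma isConj_subgroup {G : Type} [Group G] {K : Subgroup G} {a b h : G} (ha : a ∈ K) (hb : b ∈ K)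
    (hh : h ∈ K) (e : h * a * h⁻¹ = b) : IsConj (⟨a, ha⟩ : K) ⟨b, hb⟩ :=
  isConj_iff.2 ⟨⟨h, hh⟩, Subtype.ext e⟩

lemma exists_conj_full {α : Type} [Fintype α] [Nonempty α] {c c' : Perm α} (hc : FullCyc c)
    (hc' : FullCyc c') : ∃ h, h * c * h⁻¹ = c' := by
  classical
  exact isConj_iff.1 (pt_eq_iff.1 (by rw [hc.pt, hc'.pt]))

/-- The main theorem for full cycles. -/
theorem main_full {j : ℕ} {α : Type} [Fintype α] (hα : Fintype.card α = 2 ^ j) {x g : Perm α}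
    (hx : FullCyc x) (hg : FullCyc g) : MainAt x g := by
  classical
  have hne : Nonempty α := Fintype.card_pos_iff.1 (by rw [hα]; positivity)
  intro hgx
  have hx2 := FullCyc.two_element hα hx
  obtain ⟨hp, hodd⟩ := full_sub j hα hx
  obtain ⟨h, hh⟩ := exists_conj_full hx hg
  have hhS : h ∈ subnormalizer x :=
    mem_of_conj_mem hx2 hp (subnormalizer_index hx2) (mem_subnormalizer_self x) (by rw [hh]; exact hgx)
  have hconj : IsConj (⟨x, mem_subnormalizer_self x⟩ : subnormalizer x) ⟨g, hgx⟩ :=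
    isConj_subgroup _ _ hhS hh
  refine ⟨Corr.isConj hconj ?_, hodd.isConj hconj⟩
  have hS := perm_oddAt hα hx
  have hcard : Nat.card (IrrX (Perm α) x) =
      Nat.card (IrrX (subnormalizer x) ⟨x, mem_subnormalizer_self x⟩) := by
    refine (card_oSet_of_oddAt hS).trans (Eq.trans ?_ (card_oSet_of_oddAt hodd).symm)
    refine Nat.card_congr ⟨fun a => ⟨⟨a.1, mem_subnormalizer_of_commute hx2 a.2⟩,
      Subtype.ext a.2⟩, fun a => ⟨a.1.1, congrArg Subtype.val a.2⟩, fun _ => rfl, fun _ => rfl⟩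
  have hfin := finite_irrX x
  have hfin' := finite_irrX (⟨x, mem_subnormalizer_self x⟩ : subnormalizer x)
  have h1 := fun χ : IrrX (Perm α) x => hS χ.1 χ.2.1 χ.2.2
  have h2 := fun χ : IrrX (subnormalizer x) ⟨x, mem_subnormalizer_self x⟩ =>
    hodd χ.1 χ.2.1 χ.2.2
  obtain ⟨Γ⟩ := Finite.card_eq.1 hcard
  refine ⟨Γ, fun χ => ?_, fun χ => ?_, fun χ _ => ?_⟩
  · rw [pPart_of_odd (h1 χ).2, pPart_of_odd (h2 _).2]
  · rcases (h1 χ).1 with e | e <;> rcases (h2 (Γ χ)).1 with e' | e' <;> rw [e, e'] <;> simp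
  · have hgχ : χ.1 g = χ.1 x := ((Irr.isCh χ.2.1).isConj (isConj_iff.2 ⟨h, hh⟩)).symm
    rw [hgχ]
    rcases (h1 χ).1 with e | e <;> rcases (h2 (Γ χ)).1 with e' | e' <;> rw [e, e']
    · exact ⟨1, by simp⟩
    · exact ⟨-1, by simp⟩
    · exact ⟨-1, by simp⟩
    · exact ⟨1, by simp⟩

/-- The nonvanishing of characters is carried along a correspondence by counting. -/
lemma Corr.ne_zero {G K : Type} [Group G] [Group K] [Finite K] {y c : G} {y' c' : K}
    (hΓ : Corr G K y c y' c') (hO : ∀ ψ ∈ Irr G, ψ c ≠ 0 → ¬ 2 ∣ charDeg ψ ∧ ψ y ≠ 0)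
    (hcard : Nat.card (OSet K c') ≤ Nat.card (OSet G c)) :
    ∀ ψ ∈ Irr K, ψ c' ≠ 0 → ψ y' ≠ 0 := by
  obtain ⟨Γ, -, -, h3⟩ := hΓ
  let i : OSet G c → IrrX G y := fun ψ => ⟨ψ.1, ψ.2.1, (hO _ ψ.2.1 ψ.2.2).2⟩
  have hne : ∀ ψ : OSet G c, (Γ (i ψ)).1 c' ≠ 0 := by
    intro ψ
    obtain ⟨ε, hε, -, e⟩ := h3 (i ψ) (mem_irrP'_iff.2 ⟨ψ.2.1, (hO _ ψ.2.1 ψ.2.2).1⟩)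
    rw [e]
    have h0 : (i ψ).1 c ≠ 0 := ψ.2.2
    rcases hε with rfl | rfl <;> simpa using h0
  let f : OSet G c → OSet K c' := fun ψ => ⟨(Γ (i ψ)).1, (Γ (i ψ)).2.1, hne ψ⟩
  have hf : Function.Injective f := by
    intro ψ φ h
    have h4 : Γ (i ψ) = Γ (i φ) := Subtype.ext (congrArg (fun z : OSet K c' => z.1) h)
    exact Subtype.ext (congrArg (fun z : IrrX G y => z.1) (Γ.injective h4))
  have hfin := finite_oSet c'
  intro ψ hψ h0
  obtain ⟨φ, hφ⟩ := (hf.bijective_of_nat_card_le hcard).2 ⟨ψ, hψ, h0⟩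
  have h6 : (Γ (i φ)).1 = ψ := congrArg (fun z : OSet K c' => z.1) hφ
  rw [← h6]
  exact (Γ _).2.2

/-- The main theorem for an element acting as a full cycle on one half and with a fixed point on
the other. -/
theorem main_half {j : ℕ} {β : Type} [Fintype β] (hβ : Fintype.card β = 2 ^ j) {c y : Perm β}
    (hc : FullCyc c) (hy2 : ∃ m, orderOf y = 2 ^ m) {z : β} (hz : y z = z)
    {Q : Subgroup (Perm β)} (hQ : IsPGroup 2 Q) (hcQ : c ∈ Q) (hyQ : y ∈ Q)
    (hx : ∃ m, orderOf (wrp c y false) = 2 ^ m) (ih : MainAt y c)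
    {g : Perm (β ⊕ β)} (hg : FullCyc g) : MainAt (wrp c y false) g := by
  classical
  have hne : Nonempty β := Fintype.card_pos_iff.1 (by rw [hβ]; positivity)
  intro hgx
  have hc2 := FullCyc.two_element hβ hc
  have hp := (full_sub j hβ hc).1
  have hcy : c ∈ subnormalizer y := le_subnormalizer hQ hyQ hcQ
  have hw := subnormalizer_half hβ hp hc2 hy2 hx (uniqHalf_half hc hz) hQ hcQ hyQ
  obtain ⟨hΓ, hodd⟩ := ih hcy
  have hS := perm_oddAt hβ hc
  have hO : ∀ ψ ∈ Irr (Perm β), ψ c ≠ 0 → ¬ 2 ∣ charDeg ψ ∧ ψ y ≠ 0 := fun ψ hψ h0 =>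
    ⟨(hS ψ hψ h0).2, irr_odd_ne hψ hy2 (hS ψ hψ h0).2⟩
  have hcard : Nat.card (OSet (subnormalizer y) ⟨c, hcy⟩) ≤ Nat.card (OSet (Perm β) c) := by
    rw [card_oSet_of_oddAt hodd, card_oSet_of_oddAt hS]
    let f : {a : subnormalizer y // a * ⟨c, hcy⟩ = ⟨c, hcy⟩ * a} → {a : Perm β // a * c = c * a} :=
      fun a => ⟨a.1.1, congrArg (fun z : subnormalizer y => z.1) a.2⟩
    refine Nat.card_le_card_of_injective f fun a b h => Subtype.ext (Subtype.ext ?_)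
    exact congrArg (fun z : {a : Perm β // a * c = c * a} => z.1) h
  have hy' := hΓ.ne_zero hO hcard
  -- the shape of `g`
  obtain ⟨⟨⟨a, ha⟩, ⟨b, hb⟩, s⟩, hgab⟩ : g ∈ (wrMap (subnormalizer y)).range := hw ▸ hgx
  have hgab' : wrp a b s = g := hgab
  subst hgab'
  obtain ⟨rfl, hab⟩ := fullCyc_wrp hg
  obtain ⟨h, hh⟩ := exists_conj_full hc hab
  have hhy : h ∈ subnormalizer y :=
    mem_of_conj_mem hc2 hp (subnormalizer_index hy2) hcy (by rw [hh]; exact mul_mem ha hb)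
  have hconj : IsConj (⟨⟨c, hcy⟩, 1, true⟩ : Wr (subnormalizer y)) ⟨⟨a, ha⟩, ⟨b, hb⟩, true⟩ := by
    refine isConj_iff.2 ⟨⟨⟨h, hhy⟩, ⟨b, hb⟩ * ⟨h, hhy⟩, false⟩, ?_⟩
    rw [mul_inv_eq_iff_eq_mul, Wr.mul_def, Wr.mul_def]
    have h7 : h * c = a * (b * h) := by rw [← mul_assoc, ← hh]; group
    refine Wr.ext (Subtype.ext ?_) (Subtype.ext ?_) rfl
    · exact h7
    · show b * h * 1 = b * h
      rw [mul_one]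
  have hfinW : Finite (Wr (subnormalizer y)) := Finite.of_equiv _ (wrEquiv hw).symm.toEquiv
  have hM := perm_wrModel hβ hc hg hy2
  rw [← wrp_false] at hM
  have hcorr := corr_of_wrModel hM (Wr.wrModel hodd hy') hΓ hO hcard
  constructor
  · refine Corr.right (wrEquiv hw).symm ?_
    rw [(wrEquiv hw).symm_apply_eq.2
        (wrEquiv_mk hw hcy (mem_subnormalizer_self y) false (mem_subnormalizer_self _)).symm,
      (wrEquiv hw).symm_apply_eq.2 (wrEquiv_mk hw ha hb true hgx).symm]
    exact Corr.isConj hconj hcorr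
  · rw [← wrEquiv_mk hw ha hb true hgx]
    exact ((Wr.oddAt hodd).isConj hconj).mulEquiv (wrEquiv hw)

end MainCases

section PowersOfTwo

/-- A multiset of powers of two. -/
def PowTwo (M : Multiset ℕ) : Prop := ∀ a ∈ M, ∃ i, a = 2 ^ i

lemma PowTwo.mono {M N : Multiset ℕ} (h : PowTwo M) (hN : N ≤ M) : PowTwo N :=
  fun a ha => h a (Multiset.mem_of_le hN ha)

lemma PowTwo.pos {M : Multiset ℕ} (h : PowTwo M) {a : ℕ} (ha : a ∈ M) : 1 ≤ a := by
  obtain ⟨i, rfl⟩ := h a ha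
  exact Nat.one_le_two_pow

/-- Parts dividing `T` whose sum is at least `T` include parts whose sum is exactly `T`. -/
lemma PowTwo.exists_sum_eq_of_dvd (n : ℕ) : ∀ {M : Multiset ℕ} {T : ℕ}, M.card = n → PowTwo M →
    (∀ a ∈ M, a ∣ T) → T ≤ M.sum → ∃ U ≤ M, U.sum = T := by
  classical
  induction n with
  | zero =>
    intro M T hn _ _ hT
    obtain rfl := Multiset.card_eq_zero.1 hn
    exact ⟨0, le_rfl, (Nat.le_zero.1 hT).symm⟩
  | succ n ih =>
    intro M T hn hM hd hT
    rcases Nat.eq_zero_or_pos T with rfl | hT0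
    · exact ⟨0, Multiset.zero_le _, rfl⟩
    have hne : M.toFinset.Nonempty := by
      rw [Multiset.toFinset_nonempty]
      rintro rfl
      simp at hn
    obtain ⟨m, hm, hmax⟩ := Finset.exists_max_image M.toFinset id hne
    rw [Multiset.mem_toFinset] at hm
    obtain ⟨N, rfl⟩ := Multiset.exists_cons_of_mem hm
    have hmT := Nat.le_of_dvd hT0 (hd m hm)
    rw [Multiset.sum_cons] at hT
    obtain ⟨U, hU, hs⟩ := ih (M := N) (T := T - m) (by simpa using hn)
      (hM.mono (Multiset.le_cons_self _ _))
      (fun a ha => by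
        refine Nat.dvd_sub (hd a (Multiset.mem_cons_of_mem ha)) ?_
        have h1 : a ≤ m := hmax a (by simp [ha])
        obtain ⟨i, rfl⟩ := hM a (Multiset.mem_cons_of_mem ha)
        obtain ⟨i', rfl⟩ := hM m hm
        exact pow_dvd_pow 2 ((Nat.pow_le_pow_iff_right (by norm_num)).1 h1)) (by omega)
    refine ⟨m ::ₘ U, Multiset.cons_le_cons _ hU, ?_⟩
    rw [Multiset.sum_cons, hs]
    omega

lemma PowTwo.exists_sum_eq {M : Multiset ℕ} (hM : PowTwo M) {i t : ℕ} (hd : 2 ^ i ∣ M.sum)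
    (ht : t ∈ M) (hti : t ≤ 2 ^ i) : ∃ U ≤ M, U.sum = 2 ^ i := by
  classical
  have hdv : ∀ a ∈ M.filter (· ≤ 2 ^ i), a ∣ 2 ^ i := by
    intro a ha
    obtain ⟨ha, h1⟩ := Multiset.mem_filter.1 ha
    obtain ⟨i', rfl⟩ := hM a ha
    exact pow_dvd_pow 2 ((Nat.pow_le_pow_iff_right (by norm_num)).1 h1)
  have hbig : 2 ^ i ∣ (M.filter fun a => ¬ a ≤ 2 ^ i).sum := by
    refine Multiset.dvd_sum fun a ha => ?_
    obtain ⟨ha, h1⟩ := Multiset.mem_filter.1 ha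
    obtain ⟨i', rfl⟩ := hM a ha
    exact pow_dvd_pow 2 ((Nat.pow_le_pow_iff_right (by norm_num)).1 (not_le.1 h1).le)
  have hsmall : 2 ^ i ∣ (M.filter (· ≤ 2 ^ i)).sum := by
    rw [← Multiset.filter_add_not (· ≤ 2 ^ i) M, Multiset.sum_add] at hd
    exact (Nat.dvd_add_left hbig).1 hd
  have hpos : t ≤ (M.filter (· ≤ 2 ^ i)).sum :=
    Multiset.single_le_sum (fun _ _ => Nat.zero_le _) _ (Multiset.mem_filter.2 ⟨ht, hti⟩)
  obtain ⟨U, hU, hs⟩ := PowTwo.exists_sum_eq_of_dvd _ rfl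
    (hM.mono (Multiset.filter_le (· ≤ 2 ^ i) M)) hdv
    (Nat.le_of_dvd ((hM.pos ht).trans hpos) hsmall)
  exact ⟨U, hU.trans (Multiset.filter_le _ _), hs⟩

/-- Powers of two summing to a bigger power of two are not distinct. -/
lemma PowTwo.exists_dup {M : Multiset ℕ} (hM : PowTwo M) {k : ℕ} (hs : M.sum = 2 ^ k)
    (hk : 2 ^ k ∉ M) : ∃ s N, M = s ::ₘ s ::ₘ N := by
  classical
  by_contra! hno
  have hnd : M.Nodup := Multiset.nodup_iff_ne_cons_cons.2 hno
  have hsub : M.toFinset ⊆ (Finset.range k).image (2 ^ ·) := by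
    intro a ha
    rw [Multiset.mem_toFinset] at ha
    have h1 : a ≤ M.sum := Multiset.single_le_sum (fun _ _ => Nat.zero_le _) _ ha
    obtain ⟨i, rfl⟩ := hM a ha
    rw [hs, Nat.pow_le_pow_iff_right (by norm_num)] at h1
    have h2 : i ≠ k := by rintro rfl; exact hk ha
    exact Finset.mem_image.2 ⟨i, Finset.mem_range.2 (lt_of_le_of_ne h1 h2), rfl⟩
  have h1 : ∑ a ∈ M.toFinset, a = M.sum := by
    rw [Finset.sum, Multiset.toFinset_val, hnd.dedup, Multiset.map_id']
  have h2 := Finset.sum_le_sum_of_subset (f := fun a : ℕ => a) hsub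
  rw [h1, hs, Finset.sum_image (by intro a _ b _ h; exact Nat.pow_right_injective le_rfl h),
    Nat.geomSum_eq le_rfl] at h2
  have h3 : 0 < 2 ^ k := by positivity
  simp only [Nat.add_one_sub_one, Nat.div_one] at h2
  omega

/-- Small powers of two can be distributed over two boxes of the same size such that one part
lies in both boxes. -/
lemma PowTwo.exists_split {M : Multiset ℕ} (hM : PowTwo M) {k : ℕ} (hs : M.sum = 2 ^ (k + 1))
    (hlt : ∀ a ∈ M, a < 2 ^ k) : ∃ s M₁ M₂, M = (s ::ₘ M₁) + (s ::ₘ M₂) ∧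
      (s ::ₘ M₁).sum = 2 ^ k ∧ (s ::ₘ M₂).sum = 2 ^ k := by
  classical
  have key : ∀ (A B : Multiset ℕ) (s t : ℕ), PowTwo (s ::ₘ s ::ₘ A) → PowTwo B →
      (s ::ₘ s ::ₘ A).sum = 2 ^ k → B.sum = 2 ^ k → t ∈ B → t ≤ s → s < 2 ^ k →
      ∃ r M₁ M₂, (s ::ₘ s ::ₘ A) + B = (r ::ₘ M₁) + (r ::ₘ M₂) ∧
        (r ::ₘ M₁).sum = 2 ^ k ∧ (r ::ₘ M₂).sum = 2 ^ k := by
    intro A B s t hA hB hsA hsB ht hts hsk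
    obtain ⟨i, rfl⟩ := hA s (by simp)
    obtain ⟨U, hU, hUs⟩ := hB.exists_sum_eq
      (by rw [hsB]; exact pow_dvd_pow 2 ((Nat.pow_le_pow_iff_right (by norm_num)).1 hsk.le)) ht hts
    obtain ⟨V, rfl⟩ := Multiset.le_iff_exists_add.1 hU
    simp only [Multiset.sum_cons, Multiset.sum_add] at hsA hsB ⊢
    refine ⟨2 ^ i, A + U, V, ?_, by simp; omega, by omega⟩
    simp only [← Multiset.singleton_add]
    abel
  have hne : M ≠ 0 := by
    rintro rfl
    exact pow_ne_zero (k + 1) two_ne_zero hs.symm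
  obtain ⟨t, ht⟩ := Multiset.exists_mem_of_ne_zero hne
  obtain ⟨A, hA, hsA⟩ := hM.exists_sum_eq (i := k) (by rw [hs]; exact pow_dvd_pow 2 k.le_succ) ht
    (hlt t ht).le
  obtain ⟨B, rfl⟩ := Multiset.le_iff_exists_add.1 hA
  have hsB : B.sum = 2 ^ k := by
    rw [Multiset.sum_add, hsA] at hs
    omega
  have hpA := hM.mono (Multiset.le_add_right A B)
  have hpB := hM.mono (Multiset.le_add_left B A)
  obtain ⟨s, A', rfl⟩ := hpA.exists_dup hsA fun h =>
    lt_irrefl _ (hlt _ (Multiset.mem_add.2 (.inl h)))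
  obtain ⟨u, B', rfl⟩ := hpB.exists_dup hsB fun h =>
    lt_irrefl _ (hlt _ (Multiset.mem_add.2 (.inr h)))
  rcases le_total u s with h | h
  · exact key _ _ s u hpA hpB hsA hsB (by simp) h (hlt _ (by simp))
  · rw [add_comm]
    exact key _ _ u s hpB hpA hsB hsA (by simp) h (hlt _ (by simp))

end PowersOfTwo

section Transpositions

open Equiv Equiv.Perm

variable {α : Type} [DecidableEq α]

omit [DecidableEq α] in
lemma perm_apply_inv (σ : Perm α) (p : α) : σ (σ⁻¹ p) = p := σ.apply_symm_apply p

/-- An involution commuting with `x` splits into transpositions in the subnormalizer of `x`. -/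
lemma swap_mem_subnormalizer [Finite α] {x τ : Perm α} (hx : ∃ m, orderOf x = 2 ^ m)
    (hτ : ∀ p, τ (τ p) = p) (hc : ∀ p, τ (x p) = x (τ p)) (a : α) :
    swap a (τ a) ∈ subnormalizer x := by
  let E : Subgroup (Perm α) :=
    { carrier := {σ | (∀ p, σ (τ p) = τ (σ p)) ∧ ∀ p, σ p = p ∨ σ p = τ p}
      mul_mem' := by
        rintro σ σ' ⟨h1, h2⟩ ⟨h1', h2'⟩
        refine ⟨fun p => ?_, fun p => ?_⟩
        · rw [mul_apply, mul_apply, h1', h1]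
        · rw [mul_apply]
          rcases h2' p with h | h <;> rw [h]
          · exact h2 p
          · rw [h1]
            rcases h2 p with h | h <;> rw [h]
            · exact .inr rfl
            · exact .inl (hτ p)
      one_mem' := ⟨fun _ => rfl, fun _ => .inl rfl⟩
      inv_mem' := by
        rintro σ ⟨h1, h2⟩
        refine ⟨fun p => ?_, fun p => ?_⟩
        · rw [inv_eq_iff_eq, h1, perm_apply_inv]
        · rcases h2 (σ⁻¹ p) with h | h
          · rw [perm_apply_inv] at h
            exact .inl h.symm
          · rw [perm_apply_inv] at h
            exact .inr (by conv_rhs => rw [h, hτ]) }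
  have hE : IsPGroup 2 E := by
    rintro ⟨σ, h1, h2⟩
    refine ⟨1, Subtype.ext (Equiv.ext fun p => ?_)⟩
    show (σ ^ (2 ^ 1)) p = p
    rw [pow_one, pow_two, mul_apply]
    rcases h2 p with h | h
    · rw [h, h]
    · rw [h, h1, h, hτ]
  have hnorm : Subgroup.zpowers x ≤ Subgroup.normalizer (E : Set (Perm α)) := by
    rw [Subgroup.zpowers_le]
    refine mem_normalizer_of_conj ?_
    rintro σ ⟨h1, h2⟩
    have hc' : ∀ p, τ (x⁻¹ p) = x⁻¹ (τ p) := fun p => by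
      rw [eq_inv_iff_eq, ← hc, perm_apply_inv]
    refine ⟨fun p => ?_, fun p => ?_⟩
    · simp only [mul_apply]
      rw [← hc', h1, hc]
    · simp only [mul_apply]
      rcases h2 (x⁻¹ p) with h | h <;> rw [h]
      · exact .inl (perm_apply_inv _ _)
      · rw [hc', perm_apply_inv]
        exact .inr rfl
  refine le_subnormalizer (hE.to_sup_of_normal_left' (isPGroup_zpowers hx) hnorm)
    (Subgroup.mem_sup_right (Subgroup.mem_zpowers x)) (Subgroup.mem_sup_left ⟨fun p => ?_, fun p => ?_⟩)
  · by_cases h1 : p = a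
    · rw [h1, swap_apply_left, swap_apply_right, hτ]
    · by_cases h2 : p = τ a
      · rw [h2, hτ, swap_apply_left, swap_apply_right]
      · rw [swap_apply_of_ne_of_ne h1 h2, swap_apply_of_ne_of_ne]
        · rintro rfl; exact h2 (hτ p).symm
        · intro h; exact h1 (τ.injective h)
  · by_cases h1 : p = a
    · rw [h1, swap_apply_left]; exact .inr rfl
    · by_cases h2 : p = τ a
      · rw [h2, swap_apply_right, hτ]; exact .inr rfl
      · exact .inl (swap_apply_of_ne_of_ne h1 h2)

end Transpositions

section Top

open Equiv Equiv.Perm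

variable {β : Type}

lemma wrp_pow_false (a b : Perm β) (n : ℕ) : wrp a b false ^ n = wrp (a ^ n) (b ^ n) false := by
  induction n with
  | zero => ext (p | p) <;> rfl
  | succ n ih => rw [pow_succ, ih, wrp_mul, pow_succ, pow_succ]; rfl

lemma two_element_iff {G : Type} [Group G] {a : G} :
    (∃ m, orderOf a = 2 ^ m) ↔ ∃ n, a ^ 2 ^ n = 1 := by
  constructor
  · rintro ⟨m, hm⟩
    exact ⟨m, hm ▸ pow_orderOf_eq_one a⟩
  · rintro ⟨n, hn⟩
    obtain ⟨m, -, h⟩ := (Nat.dvd_prime_pow Nat.prime_two).1 (orderOf_dvd_of_pow_eq_one hn)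
    exact ⟨m, h⟩

lemma two_element_of_wrp {a b : Perm β} (h : ∃ m, orderOf (wrp a b false) = 2 ^ m) :
    (∃ m, orderOf a = 2 ^ m) ∧ ∃ m, orderOf b = 2 ^ m := by
  simp only [two_element_iff] at h ⊢
  obtain ⟨n, hn⟩ := h
  rw [wrp_pow_false] at hn
  refine ⟨⟨n, Equiv.ext fun p => ?_⟩, ⟨n, Equiv.ext fun p => ?_⟩⟩
  · exact Sum.inl_injective (Equiv.congr_fun hn (Sum.inl p))
  · exact Sum.inr_injective (Equiv.congr_fun hn (Sum.inr p))

variable [DecidableEq β]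

/-- The subnormalizer of a `2`-element preserving the halves contains full cycles on each half. -/
lemma exists_half_cycles [Fintype β] {j : ℕ} (hβ : Fintype.card β = 2 ^ j) {x : Perm (β ⊕ β)}
    (hx : ∃ m, orderOf x = 2 ^ m) (hP : Pres Sum.isLeft x) :
    ∃ c c', FullCyc c ∧ FullCyc c' ∧ wrp c 1 false ∈ subnormalizer x ∧
      wrp 1 c' false ∈ subnormalizer x := by
  have hne : Nonempty β := Fintype.card_pos_iff.1 (by rw [hβ]; positivity)
  obtain ⟨a, b, s, rfl⟩ := exists_wrp hP
  rcases s with _ | _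
  · obtain ⟨ha, hb⟩ := two_element_of_wrp hx
    obtain ⟨Q, hQ, haQ, c, hcQ, hc⟩ := exists_fullCyc_mem hβ ha
    obtain ⟨R, hR, hbR, c', hcR, hc'⟩ := exists_fullCyc_mem hβ hb
    have hQR : IsPGroup 2 ((Q.prod R).map (sumCongrHom β β)) := by
      refine IsPGroup.map ?_ _
      rw [IsPGroup.iff_card] at hQ hR ⊢
      obtain ⟨n, hn⟩ := hQ
      obtain ⟨n', hn'⟩ := hR
      exact ⟨n + n', by
        rw [Nat.card_congr (Q.prodEquiv R).toEquiv, Nat.card_prod, hn, hn', pow_add]⟩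
    have hmem : ∀ a b, a ∈ Q → b ∈ R → wrp a b false ∈ (Q.prod R).map (sumCongrHom β β) :=
      fun a b ha hb => ⟨(a, b), ⟨ha, hb⟩, (wrp_false a b).symm⟩
    have hle := le_subnormalizer hQR (hmem a b haQ hbR)
    exact ⟨c, c', hc, hc', hle (hmem _ _ hcQ (one_mem _)), hle (hmem _ _ (one_mem _) hcR)⟩
  · have hab : ∃ m, orderOf (a * b) = 2 ^ m := by
      refine (two_element_of_wrp (b := b * a) ?_).1
      have h1 : wrp (a * b) (b * a) false = wrp a b true ^ 2 := by rw [pow_two, wrp_mul]; rfl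
      rw [h1]
      obtain ⟨n, hn⟩ := two_element_iff.1 hx
      exact two_element_iff.2 ⟨n, by rw [← pow_mul, mul_comm, pow_mul, hn, one_pow]⟩
    obtain ⟨Q, hQ, haQ, c, hcQ, hc⟩ := exists_fullCyc_mem hβ hab
    have hN := isPGroup_range_wrMap hQ
    let φ := MulAut.conj (wrp 1 b false)
    have hinv : (wrp 1 b⁻¹ false : Perm (β ⊕ β))⁻¹ = wrp 1 b false := by
      rw [wrp_inv]; simp
    have hφ : ∀ p q, φ (wrp p q false) = wrp p (b * q * b⁻¹) false := fun p q => by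
      rw [MulAut.conj_apply, wrp_conj_false]; simp
    have hle := le_subnormalizer (x := wrp a b true) (hN.map φ.toMonoidHom)
      ⟨wrp (a * b) 1 true, wrp_mem_range haQ (one_mem _) _, by
        show wrp 1 b false * _ * (wrp 1 b false)⁻¹ = _
        rw [← wrp_true_conj, ← hinv]
        group⟩
    refine ⟨c, b * c * b⁻¹, hc, hc.conj, hle ⟨wrp c 1 false, wrp_mem_range hcQ (one_mem _) _, ?_⟩,
      hle ⟨wrp 1 c false, wrp_mem_range (one_mem _) hcQ _, ?_⟩⟩
    · exact (hφ _ _).trans (by simp)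
    · exact hφ _ _

/-- A group acting transitively on both halves separately and containing a transposition mixing
the halves is the symmetric group. -/
lemma eq_top_of_swap_mem [Finite β] {S : Subgroup (Perm (β ⊕ β))} {c c' : Perm β} (hc : FullCyc c)
    (hc' : FullCyc c') (h : wrp c 1 false ∈ S) (h' : wrp 1 c' false ∈ S) {a b : β}
    (hab : swap (Sum.inl a) (Sum.inr b) ∈ S) : S = ⊤ := by
  have conj : ∀ σ ∈ S, ∀ p q, swap p q ∈ S → swap (σ p) (σ q) ∈ S := by
    intro σ hσ p q hpq
    have := mul_mem (mul_mem hσ hpq) (inv_mem hσ)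
    rwa [Equiv.mul_swap_eq_swap_mul, mul_inv_cancel_right] at this
  have hz : ∀ (n : ℤ) p, (wrp c 1 false ^ n) (Sum.inl p) = Sum.inl ((c ^ n) p) ∧
      (wrp c 1 false ^ n) (Sum.inr p) = Sum.inr p := by
    have h1 : ∀ n : ℤ, wrp c 1 false ^ n = wrp (c ^ n) 1 false := by
      intro n
      rw [wrp_false, wrp_false]
      have := (map_zpow (sumCongrHom β β) (c, 1) n).symm
      simpa using this
    intro n p
    rw [h1]
    exact ⟨rfl, rfl⟩
  have hz' : ∀ (n : ℤ) p, (wrp 1 c' false ^ n) (Sum.inr p) = Sum.inr ((c' ^ n) p) ∧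
      (wrp 1 c' false ^ n) (Sum.inl p) = Sum.inl p := by
    have h1 : ∀ n : ℤ, wrp 1 c' false ^ n = wrp 1 (c' ^ n) false := by
      intro n
      rw [wrp_false, wrp_false]
      have := (map_zpow (sumCongrHom β β) (1, c') n).symm
      simpa using this
    intro n p
    rw [h1]
    exact ⟨rfl, rfl⟩
  have mixed : ∀ p q, swap (Sum.inl p) (Sum.inr q) ∈ S := by
    intro p q
    obtain ⟨n, hn⟩ := hc a p
    obtain ⟨m, hm⟩ := hc' b q
    have h1 := conj _ (zpow_mem h n) _ _ hab
    rw [(hz n a).1, (hz n b).2, hn] at h1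
    have h2 := conj _ (zpow_mem h' m) _ _ h1
    rwa [(hz' m p).2, (hz' m b).1, hm] at h2
  rw [eq_top_iff, ← closure_isSwap, Subgroup.closure_le]
  rintro _ ⟨p, q, -, rfl⟩
  rcases p with p | p <;> rcases q with q | q
  · exact SubmonoidClass.swap_mem_trans S (mixed p b) (swap_comm (Sum.inl q) (Sum.inr b) ▸ mixed q b)
  · exact mixed p q
  · exact swap_comm (Sum.inl q) (Sum.inr p) ▸ mixed q p
  · exact SubmonoidClass.swap_mem_trans S (swap_comm (Sum.inl a) (Sum.inr p) ▸ mixed a p) (mixed a q)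

/-- A `2`-element respecting a colouring of the points with two colours, and commuting with an
involution that does not respect the colours, has full subnormalizer. -/
lemma subnormalizer_eq_top {j : ℕ} {α : Type} [Fintype α] (hα : Fintype.card α = 2 ^ (j + 1))
    {x τ : Perm α} (hx : ∃ m, orderOf x = 2 ^ m) (hτ : ∀ p, τ (τ p) = p)
    (hc : ∀ p, τ (x p) = x (τ p)) {f : α → Bool} (hf : Pres f x)
    (hcard : Fintype.card {p // f p = true} = 2 ^ j) {a : α} (ha : f (τ a) ≠ f a) :
    subnormalizer x = ⊤ := by
  classical
  have hcard' : Fintype.card {p // ¬ f p = true} = 2 ^ j := by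
    rw [Fintype.card_subtype_compl, hcard, hα, pow_succ]
    omega
  obtain ⟨e1⟩ := Fintype.card_eq.1 (hcard.trans (Fintype.card_fin (2 ^ j)).symm)
  obtain ⟨e2⟩ := Fintype.card_eq.1 (hcard'.trans (Fintype.card_fin (2 ^ j)).symm)
  let e : α ≃ Fin (2 ^ j) ⊕ Fin (2 ^ j) :=
    (Equiv.sumCompl fun p => f p = true).symm.trans (Equiv.sumCongr e1 e2)
  have he : ∀ p, Sum.isLeft (e p) = f p := by
    intro p
    by_cases h : f p = true
    · simp [e, h]
    · simp [e, h]
  have hx' := orderOf_two_mulEquiv e.permCongrHom hx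
  have hP : Pres Sum.isLeft (e.permCongrHom x) := by
    obtain ⟨s, hs⟩ := hf
    refine ⟨s, fun p => ?_⟩
    have h1 := hs (e.symm p)
    rw [← he, ← he, apply_symm_apply] at h1
    exact h1
  obtain ⟨c, c', hc1, hc2, h1, h2⟩ := exists_half_cycles (Fintype.card_fin (2 ^ j)) hx' hP
  have h3 : swap (e a) (e (τ a)) ∈ subnormalizer (e.permCongrHom x) := by
    have := swap_mem_subnormalizer hx' (τ := e.permCongrHom τ) (fun p => ?_) (fun p => ?_) (e a)
    · simpa [permCongrHom, permCongr_apply] using this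
    · simp [permCongrHom, permCongr_apply, hτ]
    · simp [permCongrHom, permCongr_apply, hc]
  rw [← he, ← he] at ha
  have htop : subnormalizer (e.permCongrHom x) = ⊤ := by
    generalize e a = p at h3 ha
    generalize e (τ a) = q at h3 ha
    rcases p with p | p <;> rcases q with q | q
    · exact absurd rfl ha
    · exact eq_top_of_swap_mem hc1 hc2 h1 h2 h3
    · exact eq_top_of_swap_mem hc1 hc2 h1 h2 (swap_comm (Sum.inl q) (Sum.inr p) ▸ h3)
    · exact absurd rfl ha
  rw [← subnormalizer_map _ hx] at htop
  exact (Subgroup.map_injective e.permCongrHom.injective)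
    (htop.trans (Subgroup.map_top_of_surjective _ e.permCongrHom.surjective).symm)

end Top

section Colourings

open Equiv Equiv.Perm

lemma fullCyc_wrp_one {β : Type} {c : Perm β} (hc : FullCyc c) : FullCyc (wrp c 1 true) := by
  have hsq : ∀ n : ℤ, wrp c 1 true ^ (2 * n) = wrp (c ^ n) (c ^ n) false := by
    intro n
    have h1 : wrp c 1 true ^ (2 : ℤ) = wrp c c false := by
      rw [zpow_two, wrp_mul]
      simp
    rw [zpow_mul, h1, wrp_false, wrp_false]
    have := (map_zpow (sumCongrHom β β) (c, c) n).symm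
    simpa using this
  have hl : ∀ p q, (wrp c 1 true).SameCycle (Sum.inl p) (Sum.inl q) := by
    intro p q
    obtain ⟨n, hn⟩ := hc p q
    refine ⟨2 * n, ?_⟩
    rw [hsq, wrp_apply_inl, hn]
  have hr : ∀ p, (wrp c 1 true).SameCycle (Sum.inl p) (Sum.inr p) := fun p => ⟨1, rfl⟩
  rintro (p | p) (q | q)
  · exact hl p q
  · exact (hl p q).trans (hr q)
  · exact (hr p).symm.trans (hl p q)
  · exact (hr p).symm.trans ((hl p q).trans (hr q))

/-- A permutation with even cycle lengths exchanges two colours. -/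
lemma exists_alternating {M : Multiset ℕ} (hM : ∀ a ∈ M, 1 ≤ a) :
    ∃ (γ : Type) (_ : Fintype γ) (_ : DecidableEq γ) (y : Perm γ) (f : γ → Bool),
      pt y = M.map (2 * ·) ∧ ∀ p, f (y p) = !f p := by
  induction M using Multiset.induction_on with
  | empty =>
    refine ⟨Empty, inferInstance, inferInstance, 1, fun p => p.elim, ?_, fun p => p.elim⟩
    rw [pt_one]
    rfl
  | cons a M ih =>
    obtain ⟨γ, _, _, y, f, h1, h2⟩ := ih fun b hb => hM b (Multiset.mem_cons_of_mem hb)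
    have ha := hM a (Multiset.mem_cons_self a M)
    have : Nonempty (Fin a) := ⟨⟨0, ha⟩⟩
    obtain ⟨c, hc⟩ := exists_fullCyc (Fin a)
    refine ⟨(Fin a ⊕ Fin a) ⊕ γ, inferInstance, inferInstance,
      Equiv.Perm.sumCongr (wrp c 1 true) y, Sum.elim Sum.isLeft f, ?_, ?_⟩
    · rw [pt_sumCongr, (fullCyc_wrp_one hc).pt, h1, Multiset.map_cons, Fintype.card_sum,
        Fintype.card_fin, ← two_mul, Multiset.singleton_add]
    · rintro ((p | p) | p)
      · rfl
      · rfl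
      · exact h2 p

/-- The exchange of the first two of three blocks. -/
def swapBlocks (δ γ : Type) : Perm (δ ⊕ (δ ⊕ γ)) where
  toFun := Sum.elim (fun d => .inr (.inl d)) (Sum.elim .inl fun g => .inr (.inr g))
  invFun := Sum.elim (fun d => .inr (.inl d)) (Sum.elim .inl fun g => .inr (.inr g))
  left_inv := by rintro (d | d | g) <;> rfl
  right_inv := by rintro (d | d | g) <;> rfl

/-- A `2`-element with two cycles of the same kind, which a colouring distinguishes, has full
subnormalizer. -/
lemma subnormalizer_eq_top_of_blocks {j : ℕ} {α δ γ : Type} [Fintype α] [DecidableEq α]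
    [Fintype δ] [DecidableEq δ] [Fintype γ] [DecidableEq γ] [Nonempty δ]
    (hα : Fintype.card α = 2 ^ (j + 1)) {x : Perm α} (hx : ∃ m, orderOf x = 2 ^ m) {w : Perm δ}
    {y : Perm γ} (hpt : pt x = pt w + (pt w + pt y)) {f : δ → Bool} {f' : γ → Bool} {s : Bool}
    (hw : ∀ p, f (w p) = xor s (f p)) (hy : ∀ p, f' (y p) = xor s (f' p))
    (hcard : Fintype.card {p : δ ⊕ (δ ⊕ γ) //
      Sum.elim f (Sum.elim (fun d => !f d) f') p = true} = 2 ^ j) : subnormalizer x = ⊤ := by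
  have hc : Fintype.card α = Fintype.card (δ ⊕ (δ ⊕ γ)) := by
    rw [← pt_sum x, hpt, Multiset.sum_add, Multiset.sum_add, pt_sum, pt_sum, Fintype.card_sum,
      Fintype.card_sum]
  obtain ⟨e⟩ := Fintype.card_eq.1 hc
  let x₀ : Perm (δ ⊕ (δ ⊕ γ)) := Equiv.Perm.sumCongr w (Equiv.Perm.sumCongr w y)
  have hconj : IsConj (e.permCongr x) x₀ := by
    rw [← pt_eq_iff, pt_permCongr, pt_sumCongr, pt_sumCongr, hpt]
  obtain ⟨u, hu⟩ := isConj_iff.1 hconj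
  let φ : Perm α ≃* Perm (δ ⊕ (δ ⊕ γ)) := e.permCongrHom.trans (MulAut.conj u)
  have hφ : φ x = x₀ := hu
  have htop : subnormalizer (φ x) = ⊤ := by
    have hx' := orderOf_two_mulEquiv φ hx
    rw [hφ] at hx' ⊢
    obtain ⟨d⟩ := ‹Nonempty δ›
    refine subnormalizer_eq_top (hc ▸ hα) hx' (τ := swapBlocks δ γ) ?_ ?_ ⟨s, ?_⟩ hcard
      (a := Sum.inl d) ?_
    · rintro (d | d | g) <;> rfl
    · rintro (d | d | g) <;> rfl
    · rintro (d | d | g)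
      · exact hw d
      · show (!f (w d)) = xor s (!f d)
        rw [hw]
        simp
      · exact hy g
    · show (!f d) ≠ f d
      simp
  rw [← subnormalizer_map _ hx] at htop
  exact (Subgroup.map_injective φ.injective)
    (htop.trans (Subgroup.map_top_of_surjective _ φ.surjective).symm)

/-- A colouring exchanged by a permutation is balanced. -/
lemma card_colour {α : Type} [Fintype α] {j : ℕ} (hα : Fintype.card α = 2 ^ (j + 1)) {x : Perm α}
    {f : α → Bool} (h : ∀ p, f (x p) = !f p) : Fintype.card {p // f p = true} = 2 ^ j := by
  have h1 : Fintype.card {p // f p = true} = Fintype.card {p // ¬ f p = true} :=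
    Fintype.card_congr (x.subtypeEquiv fun p => by rw [h]; simp)
  have h2 := Fintype.card_subtype_compl fun p => f p = true
  have h3 := Fintype.card_subtype_le fun p => f p = true
  rw [hα, pow_succ] at h2 h3
  omega

/-- The subnormalizer of a `2`-element that has no fixed points and is not a full cycle. -/
lemma subnormalizer_eq_top_of_one_notMem {j : ℕ} {α : Type} [Fintype α] [DecidableEq α]
    (hα : Fintype.card α = 2 ^ (j + 1)) {x : Perm α} (hx : ∃ m, orderOf x = 2 ^ m)
    (h1 : 1 ∉ pt x) (hk : 2 ^ (j + 1) ∉ pt x) : subnormalizer x = ⊤ := by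
  have hP : PowTwo (pt x) := fun a ha => pt_two_pow hx ha
  obtain ⟨s, N, hN⟩ := hP.exists_dup ((pt_sum x).trans hα) hk
  have hev : ∀ a ∈ pt x, 2 ∣ a := by
    intro a ha
    obtain ⟨i, rfl⟩ := hP a ha
    rcases i with _ | i
    · exact absurd ha h1
    · exact dvd_pow_self 2 i.succ_ne_zero
  have hpos := pt_pos x
  rw [hN] at hev hpos
  obtain ⟨t, rfl⟩ := hev s (by simp)
  have ht := hpos _ (Multiset.mem_cons_self _ _)
  have : Nonempty (Fin t) := ⟨⟨0, by omega⟩⟩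
  obtain ⟨c, hc⟩ := exists_fullCyc (Fin t)
  have hdiv : (N.map (· / 2)).map (2 * ·) = N := by
    rw [Multiset.map_map]
    conv_rhs => rw [← Multiset.map_id N]
    refine Multiset.map_congr rfl fun a ha => ?_
    exact Nat.mul_div_cancel' (hev a (by simp [ha]))
  obtain ⟨γ, _, _, y, f, hy, hf⟩ := exists_alternating (M := N.map (· / 2)) (by
    intro a ha
    obtain ⟨b, hb, rfl⟩ := Multiset.mem_map.1 ha
    have h2 := hev b (by simp [hb])
    have h3 := hpos b (by simp [hb])
    omega)
  rw [hdiv] at hy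
  have hpw : pt (wrp c 1 true) = {2 * t} := by
    rw [(fullCyc_wrp_one hc).pt, Fintype.card_sum, Fintype.card_fin, two_mul]
  have hpt : pt x = pt (wrp c 1 true) + (pt (wrp c 1 true) + pt y) := by
    rw [hN, hpw, hy, Multiset.singleton_add, Multiset.singleton_add]
  have hw : ∀ p, Sum.isLeft (wrp c 1 true p) = !Sum.isLeft p := by
    rintro (p | p) <;> rfl
  refine subnormalizer_eq_top_of_blocks hα hx hpt (f := Sum.isLeft) (f' := f) (s := true)
    (by simpa using hw) (by simpa using hf) (card_colour ?_
      (x := Equiv.Perm.sumCongr (wrp c 1 true) (Equiv.Perm.sumCongr (wrp c 1 true) y)) ?_)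
  · rw [← hα, ← pt_sum x, hpt, Multiset.sum_add, Multiset.sum_add, pt_sum, pt_sum]
    simp only [Fintype.card_sum]
  · rintro (p | p | p)
    · exact hw p
    · show (!Sum.isLeft (wrp c 1 true p)) = !!Sum.isLeft p
      rw [hw]
    · exact hf p

/-- The subnormalizer of a `2`-element all of whose cycles are short. -/
lemma subnormalizer_eq_top_of_lt {j : ℕ} {α : Type} [Fintype α] [DecidableEq α]
    (hα : Fintype.card α = 2 ^ (j + 1)) {x : Perm α} (hx : ∃ m, orderOf x = 2 ^ m)
    (hlt : ∀ a ∈ pt x, a < 2 ^ j) : subnormalizer x = ⊤ := by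
  have hP : PowTwo (pt x) := fun a ha => pt_two_pow hx ha
  obtain ⟨s, M₁, M₂, hM, hs₁, hs₂⟩ := hP.exists_split ((pt_sum x).trans hα) hlt
  have hpos := pt_pos x
  rw [hM] at hpos
  rw [Multiset.sum_cons] at hs₁ hs₂
  have hs := hpos s (by simp)
  have : Nonempty (Fin s) := ⟨⟨0, hs⟩⟩
  obtain ⟨c, hc⟩ := exists_fullCyc (Fin s)
  obtain ⟨y₁, hy₁⟩ := exists_pt (β := Fin M₁.sum) (M := M₁) (fun a ha => hpos a (by simp [ha]))
    (Fintype.card_fin _).symm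
  obtain ⟨y₂, hy₂⟩ := exists_pt (β := Fin M₂.sum) (M := M₂) (fun a ha => hpos a (by simp [ha]))
    (Fintype.card_fin _).symm
  have hpt : pt x = pt c + (pt c + pt (Equiv.Perm.sumCongr y₁ y₂)) := by
    rw [hM, hc.pt, pt_sumCongr, hy₁, hy₂, Fintype.card_fin]
    simp only [← Multiset.singleton_add]
    abel
  refine subnormalizer_eq_top_of_blocks hα hx hpt (f := fun _ => true) (f' := Sum.isLeft)
    (s := false) (by simp) (by rintro (p | p) <;> rfl) ?_
  let e : Fin s ⊕ Fin M₁.sum ≃ {p : Fin s ⊕ (Fin s ⊕ (Fin M₁.sum ⊕ Fin M₂.sum)) //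
      Sum.elim (fun _ => true) (Sum.elim (fun _ => !true) Sum.isLeft) p = true} :=
    { toFun := Sum.elim (fun d => ⟨.inl d, rfl⟩) fun d => ⟨.inr (.inr (.inl d)), rfl⟩
      invFun := fun p => match p with
        | ⟨.inl d, _⟩ => .inl d
        | ⟨.inr (.inr (.inl d)), _⟩ => .inr d
        | ⟨.inr (.inl d), h⟩ => by simp at h
        | ⟨.inr (.inr (.inr d)), h⟩ => by simp at h
      left_inv := by rintro (d | d) <;> rfl
      right_inv := by
        rintro ⟨d | d | d | d, h⟩
        · rfl
        · simp at h
        · rfl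
        · simp at h }
  rw [← Fintype.card_congr e, Fintype.card_sum, Fintype.card_fin, Fintype.card_fin, hs₁]

end Colourings

section Main

open Equiv Equiv.Perm

/-- The main theorem for elements with full subnormalizer. -/
lemma mainAt_of_eq_top {G : Type} [Group G] [Finite G] {x g : G} (h : subnormalizer x = ⊤)
    (hodd : OddAt G g) : MainAt x g := by
  intro hgx
  let e : subnormalizer x ≃* G := (MulEquiv.subgroupCongr h).trans Subgroup.topEquiv
  refine ⟨Corr.right e ⟨Equiv.refl _, fun _ => rfl, fun _ => .inl rfl, fun _ _ =>
    ⟨1, .inl rfl, (one_mul _).symm, (one_mul _).symm⟩⟩, oddAt_top h _ hodd⟩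

/-- The main theorem for all sets of `2`-power size. -/
theorem mainAt (k : ℕ) : ∀ {α : Type} [Fintype α], Fintype.card α = 2 ^ k → ∀ {x g : Perm α},
    (∃ m, orderOf x = 2 ^ m) → FullCyc g → MainAt x g := by
  classical
  induction k with
  | zero =>
    intro α _ hα x g hx hg
    have : Subsingleton α := Fintype.card_le_one_iff_subsingleton.1 (by rw [hα]; simp)
    exact mainAt_of_eq_top (Subsingleton.elim _ _) (perm_oddAt hα hg)
  | succ j ih =>
    intro α _ hα x g hx hg
    have hne : Nonempty α := Fintype.card_pos_iff.1 (by rw [hα]; positivity)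
    have hodd := perm_oddAt hα hg
    by_cases hk : 2 ^ (j + 1) ∈ pt x
    · have h1 : IsConj x g := by
        rw [← pt_eq_iff, hg.pt]
        exact pt_eq_of_mem (hα ▸ hk)
      obtain ⟨u, hu⟩ := isConj_iff.1 h1.symm
      exact main_full hα (hu ▸ hg.conj) hg
    by_cases h1 : 1 ∈ pt x
    swap
    · exact mainAt_of_eq_top (subnormalizer_eq_top_of_one_notMem hα hx h1 hk) hodd
    by_cases hj : 2 ^ j ∈ pt x
    swap
    · refine mainAt_of_eq_top (subnormalizer_eq_top_of_lt hα hx fun a ha => ?_) hodd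
      have h2 := Multiset.single_le_sum (fun _ _ => Nat.zero_le _) _ ha
      obtain ⟨i, rfl⟩ := pt_two_pow hx ha
      rw [pt_sum, hα, Nat.pow_le_pow_iff_right (by norm_num)] at h2
      refine Nat.pow_lt_pow_right (by norm_num) ?_
      have h3 : i ≠ j := by rintro rfl; exact hj ha
      have h4 : i ≠ j + 1 := by rintro rfl; exact hk ha
      omega
    obtain ⟨M, hM⟩ := Multiset.exists_cons_of_mem hj
    have hs : M.sum = 2 ^ j := by
      have := (pt_sum x).trans hα
      rw [hM, Multiset.sum_cons, pow_succ] at this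
      omega
    have hM1 : 1 ∈ M := by
      rw [hM, Multiset.mem_cons] at h1
      rcases h1 with h1 | h1
      · obtain ⟨a, ha⟩ := Multiset.exists_mem_of_ne_zero (s := M) (by
          rintro rfl
          exact pow_ne_zero j two_ne_zero hs.symm)
        have h2 := Multiset.single_le_sum (fun _ _ => Nat.zero_le _) _ ha
        have h3 := pt_pos x a (by rw [hM]; exact Multiset.mem_cons_of_mem ha)
        rw [hs, ← h1] at h2
        obtain rfl : a = 1 := by omega
        exact ha
      · exact h1
    have hne' : Nonempty (Fin (2 ^ j)) := ⟨⟨0, by positivity⟩⟩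
    obtain ⟨y, hy⟩ := exists_pt (β := Fin (2 ^ j)) (M := M)
      (fun a ha => pt_pos x a (by rw [hM]; exact Multiset.mem_cons_of_mem ha))
      (by rw [hs, Fintype.card_fin])
    have hy2 : ∃ m, orderOf y = 2 ^ m := two_element_of_pt fun a ha =>
      pt_two_pow hx (by rw [hM]; exact Multiset.mem_cons_of_mem (hy ▸ ha))
    obtain ⟨z, hz⟩ : ∃ z, y z = z := by
      by_contra! hno
      have h2 : y.support = Finset.univ := Finset.eq_univ_of_forall fun z => mem_support.2 (hno z)
      rw [← hy, pt_eq, h2, Finset.card_univ, Nat.sub_self, Multiset.replicate_zero, add_zero] at hM1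
      exact absurd (two_le_of_mem_cycleType hM1) (by norm_num)
    obtain ⟨Q, hQ, hyQ, c, hcQ, hc⟩ := exists_fullCyc_mem (Fintype.card_fin _) hy2
    obtain ⟨e⟩ : Nonempty (α ≃ Fin (2 ^ j) ⊕ Fin (2 ^ j)) := Fintype.card_eq.1 (by
      rw [hα, Fintype.card_sum, Fintype.card_fin, pow_succ, mul_two])
    have hconj : IsConj (e.permCongr x) (wrp c y false) := by
      rw [wrp_false, ← pt_eq_iff, pt_permCongr, pt_sumCongr, hc.pt, hy, hM, Fintype.card_fin,
        Multiset.singleton_add]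
    obtain ⟨u, hu⟩ := isConj_iff.1 hconj
    let φ : Perm α ≃* Perm (Fin (2 ^ j) ⊕ Fin (2 ^ j)) := e.permCongrHom.trans (MulAut.conj u)
    have hφ : φ x = wrp c y false := hu
    have hg' : FullCyc (φ g) := (hg.permCongr e).conj
    have hx' := orderOf_two_mulEquiv φ hx
    refine MainAt.of_mulEquiv φ hx ?_
    rw [hφ] at hx' ⊢
    exact main_half (Fintype.card_fin _) hc hy2 hz hQ hcQ hyQ hx' (ih (Fintype.card_fin _) hy2 hc) hg'

end Main

/-- For `k ≥ 3`, `g` a `2^k`-cycle and `x` a `2`-element of `S_{2^k}` (with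
`g ∈ Sub_{S_{2^k}}(x)` so that evaluation at `g` makes sense), there is a bijection
`Γ : Irr^x(S_{2^k}) → Irr^x(Sub_{S_{2^k}}(x))` preserving `2`-parts of degrees and
values at `x` up to sign, and such that on characters of odd degree the signs at `x`
and at `g` agree. -/
theorem subnormalizer_bijection_2k (k : ℕ) (hk : 3 ≤ k)
    (g : Equiv.Perm (Fin (2 ^ k))) (hg : g.cycleType = {2 ^ k})
    (x : Equiv.Perm (Fin (2 ^ k))) (hx : ∃ m, orderOf x = 2 ^ m)
    (hgx : g ∈ subnormalizer x) :
    ∃ Γ : ↥(IrrX (Equiv.Perm (Fin (2 ^ k))) x) ≃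
          ↥(IrrX ↥(subnormalizer x) ⟨x, mem_subnormalizer_self x⟩),
      (∀ χ, pPart 2 (charDeg (Γ χ).1) = pPart 2 (charDeg χ.1)) ∧
      (∀ χ, (Γ χ).1 ⟨x, mem_subnormalizer_self x⟩ = χ.1 x ∨
            (Γ χ).1 ⟨x, mem_subnormalizer_self x⟩ = - χ.1 x) ∧
      (∀ χ, χ.1 ∈ IrrP' 2 (Equiv.Perm (Fin (2 ^ k))) →
        ∃ ε : ℂ, (ε = 1 ∨ ε = -1) ∧
          (Γ χ).1 ⟨x, mem_subnormalizer_self x⟩ = ε * χ.1 x ∧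
          (Γ χ).1 ⟨g, hgx⟩ = ε * χ.1 g) := by
  classical
  exact (mainAt k (Fintype.card_fin _) hx (fullCyc_of_cycleType (by rw [hg, Fintype.card_fin])) hgx).1

end
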